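/- arXiv:2403.04101 — 4 statements merged into one kernel-verified Lean document; each statement's English description precedes it below -/
import Mathlib

section
/- Let λ be a partition and j an index with λ_j > λ_{j+1}. Then both symmetric polynomials s_{λ_{(j)}}^2 − s_λ · s_{λ_{(j,↑)}} and s_{λ_{(j)}}^2 − s_λ · s_{λ_{(j,←)}} are Schur positive (in any number of variables n ≥ ℓ(λ)). -/
open MvPolynomial

noncomputable section

/-- The complete homogeneous symmetric polynomial in `n` variables, indexed by an
integer (by convention it is `0` for negative indices). -/
def hInt (n : ℕ) (k : ℤ) : MvPolynomial (Fin n) ℚ :=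
  if 0 ≤ k then MvPolynomial.hsymm (Fin n) ℚ k.toNat else 0

/-- The number of (nonzero) parts of a partition `lam : ℕ → ℕ` (parts are indexed
starting from `0`). -/
def partLen (lam : ℕ → ℕ) : ℕ := sInf {N | lam N = 0}

/-- A partition, recorded as a weakly decreasing, eventually zero function `ℕ → ℕ`
listing its parts (indexed starting from `0`). -/
def IsPartition (lam : ℕ → ℕ) : Prop := Antitone lam ∧ ∃ N, ∀ i, N ≤ i → lam i = 0

/-- The Schur polynomial of a partition in `n` variables, via the Jacobi-Trudi identity
`s_lam = det (h_{lam_i + j - i})`. -/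
def schur (n : ℕ) (lam : ℕ → ℕ) : MvPolynomial (Fin n) ℚ :=
  (Matrix.of fun i j : Fin (partLen lam) =>
    hInt n ((lam i : ℤ) + ((j : ℕ) : ℤ) - ((i : ℕ) : ℤ))).det

/-- The `i`-th derived polynomial `p^{(i)}` of `p`, defined by the identity
`p (x₁ + t, …, xₙ + t) = ∑ i, t^i • p^{(i)} (x₁, …, xₙ)`: substituting `X j + t` for each
variable `X j` yields a polynomial in `t` whose `t^i`-coefficient is `p^{(i)}`. -/
def derived (n i : ℕ) (p : MvPolynomial (Fin n) ℚ) : MvPolynomial (Fin n) ℚ :=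
  (MvPolynomial.aeval
    (fun j : Fin n => (Polynomial.C (X j) + Polynomial.X : Polynomial (MvPolynomial (Fin n) ℚ)))
    p).coeff i

/-- A symmetric polynomial is Schur positive if it is a linear combination of Schur
polynomials (of partitions) with non-negative coefficients. -/
def SchurPositive (n : ℕ) (f : MvPolynomial (Fin n) ℚ) : Prop :=
  ∃ (S : Finset (ℕ → ℕ)) (c : (ℕ → ℕ) → ℚ),
    (∀ μ ∈ S, IsPartition μ) ∧ (∀ μ ∈ S, 0 ≤ c μ) ∧ f = ∑ μ ∈ S, c μ • schur n μ

section JacobiTrudi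

variable {R : Type*} [CommRing R]

/-- The Jacobi–Trudi type determinant `det (h_{α_i + j})` of an integer sequence `α`. -/
def hDet (h : ℤ → R) {L : ℕ} (α : Fin L → ℤ) : R :=
  (Matrix.of fun i j : Fin L => h (α i + (j : ℕ))).det

/-- The first `L` entries of the strictly decreasing sequence `κ_i - i`. -/
def betaSeq (L : ℕ) (κ : ℕ → ℕ) : Fin L → ℤ := fun i => (κ i : ℤ) - (i : ℕ)

theorem hDet_succ_of_last {h : ℤ → R} (h0 : h 0 = 1) (hneg : ∀ m < 0, h m = 0) {L : ℕ}
    (α : Fin (L + 1) → ℤ) (hα : α (Fin.last L) = -L) :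
    hDet h α = hDet h fun i : Fin L => α i.castSucc := by
  unfold hDet
  rw [Matrix.det_succ_row _ (Fin.last L), Finset.sum_eq_single (Fin.last L)]
  · simp [hα, h0, ← two_mul, Matrix.submatrix]
  · intro j _ hj
    have : (j : ℕ) < L := Fin.val_lt_last hj
    rw [Matrix.of_apply, hα, hneg _ (by omega)]
    simp
  · simp

theorem hDet_betaSeq_eq_of_le {h : ℤ → R} (h0 : h 0 = 1) (hneg : ∀ m < 0, h m = 0) {κ : ℕ → ℕ}
    {M L : ℕ} (hML : M ≤ L) (hκ : ∀ r, M ≤ r → κ r = 0) :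
    hDet h (betaSeq L κ) = hDet h (betaSeq M κ) := by
  induction L, hML using Nat.le_induction with
  | base => rfl
  | succ L hL ih =>
    rw [← ih, hDet_succ_of_last h0 hneg _ (by simp [betaSeq, hκ L hL])]
    rfl

/-- The generating series `∑_d h_{m+d} t^d` of the tail of `h` starting at `m`. -/
noncomputable def tailSeries (h : ℤ → R) (m : ℤ) : PowerSeries R :=
  PowerSeries.mk fun d => h (m + d)

theorem tailSeries_eq_add (h : ℤ → R) (m : ℤ) :
    tailSeries h m = PowerSeries.C (h m) + PowerSeries.X * tailSeries h (m + 1) := by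
  ext d
  cases d with
  | zero => simp [tailSeries]
  | succ d =>
    simp only [tailSeries, PowerSeries.coeff_mk, map_add, PowerSeries.coeff_C,
      PowerSeries.coeff_succ_X_mul, Nat.succ_ne_zero, if_false, zero_add]
    push_cast
    ring_nf

theorem tailSeries_eq_sum_add (h : ℤ → R) (m : ℤ) (d : ℕ) :
    tailSeries h m = ∑ e ∈ Finset.range d, PowerSeries.X ^ e * PowerSeries.C (h (m + e)) +
      PowerSeries.X ^ d * tailSeries h (m + d) := by
  induction d with
  | zero => simp
  | succ d ih =>
    rw [ih, Finset.sum_range_succ, tailSeries_eq_add h (m + d), pow_succ]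
    push_cast
    ring_nf

theorem tailSeries_eq_sum_Icc_add (h : ℤ → R) {a b : ℕ} (hab : a ≤ b) (m : ℤ) :
    tailSeries h (a + m) =
      ∑ k ∈ Finset.Icc a b, PowerSeries.X ^ (k - a) * PowerSeries.C (h (k + m)) +
      PowerSeries.X ^ (b + 1 - a) * tailSeries h (b + 1 + m) := by
  rw [tailSeries_eq_sum_add h _ (b + 1 - a), ← Finset.Ico_add_one_right_eq_Icc,
    Finset.sum_Ico_eq_sum_range]
  congr 1
  · refine Finset.sum_congr rfl fun e _ => ?_
    rw [Nat.add_sub_cancel_left]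
    push_cast
    ring_nf
  · congr 2
    have : ((b + 1 - a : ℕ) : ℤ) = b + 1 - a := by omega
    rw [this]
    ring

theorem det_tailSeries {h : ℤ → R} (hneg : ∀ m < 0, h m = 0) {L : ℕ}
    (α : Fin (L + 1) → ℤ) (hα : α (Fin.last L) = -L) :
    (Matrix.of fun i j : Fin (L + 1) => tailSeries h (α i + (j : ℕ))).det =
      tailSeries h 0 * PowerSeries.C (hDet h fun i : Fin L => α i.castSucc) := by
  set A := Matrix.of fun i j : Fin (L + 1) => tailSeries h (α i + (j : ℕ)) with hA
  set B := Matrix.of fun i j : Fin (L + 1) =>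
    if j = Fin.last L then tailSeries h (α i + L) else PowerSeries.C (h (α i + (j : ℕ))) with hB
  have hAB : (A.submatrix id Fin.revPerm).det = (B.submatrix id Fin.revPerm).det := by
    refine Matrix.det_eq_of_forall_col_eq_smul_add_pred (fun _ => PowerSeries.X) ?_ ?_
    · intro i
      simp [hA, hB]
    · intro i j
      have h1 : Fin.rev j.succ ≠ Fin.last L := by
        simp [Fin.ext_iff, Fin.val_rev]
        omega
      have h2 : (((Fin.rev j.castSucc : Fin (L + 1)) : ℕ) : ℤ) = (Fin.rev j.succ : ℕ) + 1 := by
        simp only [Fin.val_rev, Fin.val_castSucc, Fin.val_succ]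
        omega
      simp only [hA, hB, Matrix.submatrix_apply, id, Fin.revPerm_apply, Matrix.of_apply, if_neg h1,
        h2]
      rw [tailSeries_eq_add, add_assoc]
  rw [Matrix.det_permute', Matrix.det_permute'] at hAB
  have hunit : IsUnit (((Equiv.Perm.sign (Fin.revPerm : Equiv.Perm (Fin (L + 1))) : ℤˣ) : ℤ) :
      PowerSeries R) := (Units.isUnit _).map (Int.castRingHom (PowerSeries R))
  rw [hunit.mul_left_cancel hAB, Matrix.det_succ_row _ (Fin.last L),
    Finset.sum_eq_single (Fin.last L)]
  · have hmap : (B.submatrix (Fin.last L).succAbove (Fin.last L).succAbove) =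
        (PowerSeries.C : R →+* PowerSeries R).mapMatrix
          (Matrix.of fun i j : Fin L => h (α i.castSucc + (j : ℕ))) := by
      ext1 i j
      simp [hB, Fin.castSucc_ne_last]
    rw [hmap, ← RingHom.map_det]
    simp [hB, hα, ← two_mul, hDet]
  · intro j _ hj
    have hlt : (j : ℕ) < L := Fin.val_lt_last hj
    rw [hB, Matrix.of_apply, if_neg hj, hα, hneg _ (by omega)]
    simp
  · simp

/-- The upper bound for the `r`-th part of a partition obtained from `κ` by adding a horizontal
strip, when the first part may not exceed `B`. -/
def stripBound (B : ℕ) (κ : ℕ → ℕ) (r : ℕ) : ℕ := if r = 0 then B else κ (r - 1)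

theorem coeff_det_tailSeries (h : ℤ → R) {L B : ℕ} {κ : ℕ → ℕ} (hκ : Antitone κ) (hB : κ 0 ≤ B)
    {k : ℕ} (hk : k + κ 0 ≤ B) :
    PowerSeries.coeff k
        (Matrix.of fun i j : Fin (L + 1) => tailSeries h (betaSeq (L + 1) κ i + (j : ℕ))).det =
      ∑ f ∈ Fintype.piFinset fun i : Fin (L + 1) => Finset.Icc (κ i) (stripBound B κ i),
        if ∑ i, (f i - κ i) = k then hDet h fun i => (f i : ℤ) - (i : ℕ) else 0 := by
  classical
  set A := Matrix.of fun i j : Fin (L + 1) => tailSeries h (betaSeq (L + 1) κ i + (j : ℕ)) with hA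
  let row : Fin (L + 1) → ℕ → Fin (L + 1) → PowerSeries R :=
    fun i a j => PowerSeries.C (h ((a : ℤ) - (i : ℕ) + (j : ℕ)))
  set D : Matrix (Fin (L + 1)) (Fin (L + 1)) (PowerSeries R) := fun i =>
    ∑ a ∈ Finset.Icc (κ i) (stripBound B κ i),
      (PowerSeries.X ^ (a - κ i) : PowerSeries R) • row i a with hD
  have hentry : ∀ (i j : Fin (L + 1)) (b : ℕ), κ i ≤ b → A i j =
      ∑ a ∈ Finset.Icc (κ i) b, PowerSeries.X ^ (a - κ i) *
        PowerSeries.C (h ((a : ℤ) - (i : ℕ) + (j : ℕ))) +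
      PowerSeries.X ^ (b + 1 - κ i) * tailSeries h (b + 1 - (i : ℕ) + (j : ℕ)) := by
    intro i j b hb
    have := tailSeries_eq_sum_Icc_add h hb (-((i : ℕ) : ℤ) + (j : ℕ))
    simp only [hA, Matrix.of_apply, betaSeq, sub_eq_add_neg, add_assoc] at this ⊢
    exact this
  have h1 : A.det = (D.updateRow 0 (A 0)).det := by
    refine Matrix.det_eq_of_forall_row_eq_smul_add_pred
      (fun i => PowerSeries.X ^ (κ i + 1 - κ (i + 1))) ?_ ?_
    · intro j
      simp
    · intro i j
      rw [hentry _ j (κ i) (by simpa using hκ (Nat.le_succ _)),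
        Matrix.updateRow_ne (Fin.succ_ne_zero i)]
      simp [hD, stripBound, row, hA, betaSeq, Finset.sum_apply]
  have h2 : A 0 = D 0 + (PowerSeries.X ^ (B + 1 - κ 0) : PowerSeries R) •
      fun j : Fin (L + 1) => tailSeries h (B + 1 + (j : ℕ)) := by
    ext1 j
    rw [hentry 0 j B (by simpa using hB)]
    simp [hD, stripBound, row, Finset.sum_apply]
  rw [h1, h2, Matrix.det_updateRow_add, Matrix.det_updateRow_smul, Matrix.updateRow_eq_self,
    map_add, PowerSeries.coeff_X_pow_mul', if_neg (by omega), add_zero]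
  have h3 : D.det = ∑ f ∈ Fintype.piFinset fun i : Fin (L + 1) =>
      Finset.Icc (κ i) (stripBound B κ i), PowerSeries.X ^ (∑ i, (f i - κ i)) *
        PowerSeries.C (hDet h fun i => (f i : ℤ) - (i : ℕ)) := by
    have := (Matrix.detRowAlternating (n := Fin (L + 1)) (R := PowerSeries R)).map_sum_finset
      (fun i (a : ℕ) => (PowerSeries.X ^ (a - κ i) : PowerSeries R) • row i a)
      (fun i : Fin (L + 1) => Finset.Icc (κ i) (stripBound B κ i))
    rw [hD]
    refine this.trans (Finset.sum_congr rfl fun f _ => ?_)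
    refine (AlternatingMap.map_smul_univ _ (fun i => (PowerSeries.X ^ (f i - κ i) : PowerSeries R))
      fun i => row i (f i)).trans ?_
    rw [Finset.prod_pow_eq_pow_sum, smul_eq_mul, hDet, RingHom.map_det]
    rfl
  rw [h3, map_sum]
  refine Finset.sum_congr rfl fun f _ => ?_
  rw [PowerSeries.coeff_X_pow_mul', PowerSeries.coeff_C]
  split_ifs <;> first | rfl | omega

end JacobiTrudi

/-- The sum of the first `L` parts. -/
def partSum (L : ℕ) (κ : ℕ → ℕ) : ℤ := ∑ r ∈ Finset.range L, (κ r : ℤ)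

/-- Extension of a finite sequence by zero. -/
def extendZero {L : ℕ} (f : Fin L → ℕ) (r : ℕ) : ℕ := if hr : r < L then f ⟨r, hr⟩ else 0

theorem extendZero_injective {L : ℕ} : Function.Injective (extendZero (L := L)) := by
  intro f g hfg
  ext i
  have := congrFun hfg i
  simpa [extendZero] using this

/-- The partitions with at most `L` parts and first part at most `B` that are obtained from `κ` by
adding a horizontal strip. -/
def strips (L B : ℕ) (κ : ℕ → ℕ) : Finset (ℕ → ℕ) :=
  (Fintype.piFinset fun i : Fin L => Finset.Icc (κ i) (stripBound B κ i)).map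
    ⟨extendZero, extendZero_injective⟩

theorem mem_strips {L B : ℕ} {κ lam : ℕ → ℕ} :
    lam ∈ strips L B κ ↔
      (∀ r < L, κ r ≤ lam r ∧ lam r ≤ stripBound B κ r) ∧ ∀ r, L ≤ r → lam r = 0 := by
  simp only [strips, Finset.mem_map, Fintype.mem_piFinset, Finset.mem_Icc,
    Function.Embedding.coeFn_mk]
  constructor
  · rintro ⟨f, hf, rfl⟩
    refine ⟨fun r hr => ?_, fun r hr => ?_⟩
    · simpa [extendZero, hr] using hf ⟨r, hr⟩
    · simp [extendZero, Nat.not_lt.mpr hr]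
  · rintro ⟨h1, h2⟩
    refine ⟨fun i => lam i, fun i => h1 i i.2, ?_⟩
    ext r
    by_cases hr : r < L
    · simp [extendZero, hr]
    · simp [extendZero, hr, h2 r (not_lt.mp hr)]

section Strips

variable {L B : ℕ} {κ lam : ℕ → ℕ}

theorem antitone_of_mem_strips (h : lam ∈ strips L B κ) : Antitone lam := by
  rw [mem_strips] at h
  refine antitone_nat_of_succ_le fun r => ?_
  by_cases hr : r + 1 < L
  · have h1 := (h.1 (r + 1) hr).2
    have h2 := (h.1 r (by omega)).1
    simp only [stripBound, Nat.succ_ne_zero, if_false, Nat.add_sub_cancel] at h1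
    omega
  · rw [h.2 (r + 1) (by omega)]
    exact Nat.zero_le _

theorem eq_zero_of_mem_strips {M : ℕ} (h : lam ∈ strips L B κ) (hκ : ∀ r, M ≤ r → κ r = 0) (r : ℕ)
    (hr : M + 1 ≤ r) : lam r = 0 := by
  rw [mem_strips] at h
  by_cases hL : r < L
  · have := (h.1 r hL).2
    rw [stripBound, if_neg (by omega), hκ _ (by omega)] at this
    omega
  · exact h.2 r (by omega)

theorem le_of_mem_strips (h : lam ∈ strips L B κ) (hκ : ∀ r, L ≤ r → κ r = 0) (r : ℕ) :
    κ r ≤ lam r := by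
  rw [mem_strips] at h
  by_cases hr : r < L
  · exact (h.1 r hr).1
  · rw [hκ r (by omega)]
    exact Nat.zero_le _

theorem head_sub_le_partSum_sub (h : lam ∈ strips L B κ) (hL : 0 < L) :
    (lam 0 : ℤ) - κ 0 ≤ partSum L lam - partSum L κ := by
  rw [partSum, partSum, ← Finset.sum_sub_distrib]
  refine Finset.single_le_sum (f := fun r => (lam r : ℤ) - κ r) (fun r hr => ?_)
    (Finset.mem_range.mpr hL)
  have := ((mem_strips.mp h).1 r (Finset.mem_range.mp hr)).1
  omega

theorem pieri {R : Type*} [CommRing R] {h : ℤ → R} (h0 : h 0 = 1) (hneg : ∀ m < 0, h m = 0)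
    (hκ : Antitone κ) (hL : ∀ r, L ≤ r → κ r = 0) (hB : κ 0 ≤ B) {k : ℤ} (hk : k + κ 0 ≤ B) :
    h k * hDet h (betaSeq (L + 1) κ) = ∑ lam ∈ strips (L + 1) B κ,
      if partSum (L + 1) lam - partSum (L + 1) κ = k then hDet h (betaSeq (L + 1) lam) else 0 := by
  rcases lt_or_ge k 0 with hk0 | hk0
  · rw [hneg k hk0, zero_mul]
    refine (Finset.sum_eq_zero fun lam hlam => if_neg fun hsum => ?_).symm
    have := head_sub_le_partSum_sub hlam (Nat.succ_pos L)
    have := ((mem_strips.mp hlam).1 0 (Nat.succ_pos L)).1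
    omega
  lift k to ℕ using hk0
  have h1 := coeff_det_tailSeries h (L := L) hκ hB (k := k) (by omega)
  have hlast : betaSeq (L + 1) κ (Fin.last L) = -L := by simp [betaSeq, hL L le_rfl]
  rw [det_tailSeries hneg _ hlast, PowerSeries.coeff_mul_C] at h1
  simp only [tailSeries, PowerSeries.coeff_mk, zero_add] at h1
  rw [hDet_succ_of_last h0 hneg _ hlast, h1, strips, Finset.sum_map]
  refine Finset.sum_congr rfl fun f hf => ?_
  have hf' : ∀ i : Fin (L + 1), κ i ≤ f i := fun i => (Finset.mem_Icc.mp (Fintype.mem_piFinset.mp hf i)).1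
  have hsum : partSum (L + 1) (extendZero f) - partSum (L + 1) κ =
      ((∑ i, (f i - κ i) : ℕ) : ℤ) := by
    rw [partSum, partSum, ← Finset.sum_sub_distrib, Finset.sum_range, Nat.cast_sum]
    refine Finset.sum_congr rfl fun i _ => ?_
    have hi : (i : ℕ) < L + 1 := i.2
    rw [Nat.cast_sub (hf' i)]
    simp only [extendZero, hi, dite_true]
  have hbeta : (betaSeq (L + 1) (extendZero f)) = fun i => (f i : ℤ) - (i : ℕ) := by
    ext i
    have hi : (i : ℕ) < L + 1 := i.2
    simp only [betaSeq, extendZero, hi, dite_true]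
  simp only [Function.Embedding.coeFn_mk, hsum, hbeta, Nat.cast_inj]

end Strips

/-- The chains `μ = T 0, T 1, …, T N` of successive horizontal strips, continued constantly
after step `N`; these are the semistandard skew tableaux with entries `< N` and inner shape `μ`. -/
noncomputable def chains (L B : ℕ) (μ : ℕ → ℕ) : ℕ → Finset (ℕ → ℕ → ℕ)
  | 0 => {fun _ => μ}
  | N + 1 => by
    classical
    exact ((chains L B μ N).sigma fun T => strips L B (T N)).image
      fun p i => if i ≤ N then p.1 i else p.2

section Chains

variable {L B N : ℕ} {μ : ℕ → ℕ} {T : ℕ → ℕ → ℕ}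

theorem mem_chains : T ∈ chains L B μ N ↔
    T 0 = μ ∧ (∀ i < N, T (i + 1) ∈ strips L B (T i)) ∧ ∀ i, N ≤ i → T i = T N := by
  classical
  induction N generalizing T with
  | zero =>
    simp only [chains, Finset.mem_singleton, Nat.not_lt_zero, false_imp_iff, implies_true,
      Nat.zero_le, true_and, forall_const]
    constructor
    · rintro rfl
      simp
    · rintro ⟨h1, h2⟩
      ext1 i
      rw [h2, h1]
  | succ N ih =>
    simp only [chains, Finset.mem_image, Finset.mem_sigma, Sigma.exists]
    constructor
    · rintro ⟨U, lam, ⟨hU, hlam⟩, rfl⟩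
      rw [ih] at hU
      refine ⟨by simpa using hU.1, fun i hi => ?_, fun i hi => ?_⟩
      · rcases Nat.lt_succ_iff_lt_or_eq.mp hi with hi | rfl
        · simpa [hi.le, Nat.succ_le_of_lt hi] using hU.2.1 i hi
        · simpa using hlam
      · simp [Nat.not_le.mpr (Nat.lt_of_succ_le hi)]
    · rintro ⟨h1, h2, h3⟩
      refine ⟨fun i => if i ≤ N then T i else T N, T (N + 1), ⟨ih.mpr ⟨by simpa using h1,
        fun i hi => ?_, fun i hi => ?_⟩, by simpa using h2 N (Nat.lt_succ_self N)⟩, ?_⟩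
      · simpa [hi.le, Nat.succ_le_of_lt hi] using h2 i (by omega)
      · rcases hi.eq_or_lt with rfl | hi
        · rfl
        · simp [Nat.not_le.mpr hi]
      · ext1 i
        by_cases hi : i ≤ N
        · simp [hi]
        · simp [hi, h3 i (by omega)]

theorem sum_chains_succ {A : Type*} [AddCommMonoid A] (F : (ℕ → ℕ → ℕ) → A) :
    ∑ T ∈ chains L B μ (N + 1), F T = ∑ T ∈ chains L B μ N, ∑ lam ∈ strips L B (T N),
      F fun i => if i ≤ N then T i else lam := by
  classical
  rw [Finset.sum_sigma', chains, Finset.sum_image]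
  rintro ⟨T, lam⟩ hT ⟨U, rho⟩ hU heq
  simp only [Finset.coe_sigma, Set.mem_sigma_iff, Finset.mem_coe, mem_chains] at hT hU
  have h1 : ∀ i ≤ N, T i = U i := fun i hi => by simpa [hi] using congrFun heq i
  have h2 : lam = rho := by simpa using congrFun heq (N + 1)
  have h3 : T = U := by
    ext1 i
    rcases le_total i N with hi | hi
    · exact h1 i hi
    · rw [hT.1.2.2 i hi, hU.1.2.2 i hi, h1 N le_rfl]
  subst h2 h3
  rfl

theorem antitone_of_mem_chains (hμ : Antitone μ) (hT : T ∈ chains L B μ N) {i : ℕ} (hi : i ≤ N) :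
    Antitone (T i) := by
  rw [mem_chains] at hT
  cases i with
  | zero => rwa [hT.1]
  | succ i => exact antitone_of_mem_strips (hT.2.1 i hi)

theorem eq_zero_of_mem_chains {M : ℕ} (hμ : ∀ r, M ≤ r → μ r = 0) (hT : T ∈ chains L B μ N) {i : ℕ}
    (hi : i ≤ N) (r : ℕ) (hr : M + i ≤ r) : T i r = 0 := by
  rw [mem_chains] at hT
  induction i generalizing r with
  | zero =>
    rw [hT.1]
    exact hμ r hr
  | succ i ih => exact eq_zero_of_mem_strips (hT.2.1 i hi) (ih (by omega)) r (by omega)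

/-- The number of entries `i` of the tableau `T`. -/
def content (L : ℕ) (T : ℕ → ℕ → ℕ) (i : ℕ) : ℤ := partSum L (T (i + 1)) - partSum L (T i)

theorem head_le_of_content_le {a : ℕ} (hT : T ∈ chains L B μ N) (hL : 0 < L)
    (hc : ∀ i < N, content L T i ≤ a) {i : ℕ} (hi : i ≤ N) : T i 0 ≤ μ 0 + i * a := by
  rw [mem_chains] at hT
  induction i with
  | zero => simp [hT.1]
  | succ i ih =>
    have h1 := head_sub_le_partSum_sub (hT.2.1 i hi) hL
    have h2 := hc i hi
    have h3 := ih (by omega)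
    rw [content] at h2
    have : (i + 1) * a = i * a + a := by ring
    omega

theorem prod_mul_hDet_eq_sum_chains {R : Type*} [CommRing R] {h : ℤ → R} (h0 : h 0 = 1)
    (hneg : ∀ m < 0, h m = 0) (hμ : Antitone μ) {M a : ℕ} (hM : ∀ r, M ≤ r → μ r = 0)
    (α : Fin N → ℤ) (hα : ∀ i, α i ≤ a) (hL : M + N ≤ L) (hB : μ 0 + N * a ≤ B) :
    (∏ i, h (α i)) * hDet h (betaSeq (L + 1) μ) = ∑ T ∈ chains (L + 1) B μ N,
      if ∀ i : Fin N, content (L + 1) T i = α i then hDet h (betaSeq (L + 1) (T N)) else 0 := by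
  induction N with
  | zero => simp [chains]
  | succ N ih =>
    have hBN : μ 0 + N * a + a ≤ B := by
      have : (N + 1) * a = N * a + a := by ring
      omega
    rw [Fin.prod_univ_castSucc, mul_comm (∏ i, _), mul_assoc,
      ih (fun i => α i.castSucc) (fun i => hα _) (by omega) (by omega), Finset.mul_sum,
      sum_chains_succ]
    refine Finset.sum_congr rfl fun T hT => ?_
    rw [mul_ite, mul_zero]
    have hcont : ∀ lam (i : Fin N), content (L + 1) (fun i => if i ≤ N then T i else lam) i =
        content (L + 1) T i := by
      intro lam i
      simp [content, i.2.le, Nat.succ_le_of_lt i.2]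
    have hlast : ∀ lam, content (L + 1) (fun i => if i ≤ N then T i else lam) N =
        partSum (L + 1) lam - partSum (L + 1) (T N) := by
      intro lam
      simp [content]
    simp only [Fin.forall_fin_succ', Fin.val_castSucc, Fin.val_last, hcont, hlast,
      Nat.succ_le_iff, lt_irrefl, if_false]
    split_ifs with hc
    · have hhead := head_le_of_content_le (a := a) hT (Nat.succ_pos L)
        (fun i hi => (hc ⟨i, hi⟩).le.trans (hα _)) le_rfl
      have hlast := hα (Fin.last N)
      rw [pieri h0 hneg (antitone_of_mem_chains hμ hT le_rfl)
        (fun r hr => eq_zero_of_mem_chains hM hT le_rfl r (by omega)) (by omega : T N 0 ≤ B)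
        (by omega)]
      exact Finset.sum_congr rfl fun lam _ => by simp [hc]
    · exact (Finset.sum_eq_zero fun lam _ => by simp [hc]).symm

/-- The coefficient with which the tableau `T` contributes to the product of Schur functions
indexed by `μ` and `ν`. -/
def chainWeight (L N : ℕ) (ν : ℕ → ℕ) (T : ℕ → ℕ → ℕ) : ℤ :=
  (Matrix.of fun i j : Fin N => if content L T j - (j : ℕ) = betaSeq N ν i then (1 : ℤ) else 0).det

theorem hDet_mul_hDet_eq_sum_chains {R : Type*} [CommRing R] {h : ℤ → R} (h0 : h 0 = 1)
    (hneg : ∀ m < 0, h m = 0) (hμ : Antitone μ) {M : ℕ} (hM : ∀ r, M ≤ r → μ r = 0)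
    {ν : ℕ → ℕ} (hν : Antitone ν) (hL : M + N ≤ L) (hB : μ 0 + N * (ν 0 + N) ≤ B) :
    hDet h (betaSeq (L + 1) μ) * hDet h (betaSeq N ν) = ∑ T ∈ chains (L + 1) B μ N,
      chainWeight (L + 1) N ν T • hDet h (betaSeq (L + 1) (T N)) := by
  have hdet : hDet h (betaSeq N ν) = ∑ σ : Equiv.Perm (Fin N),
      (((Equiv.Perm.sign σ : ℤˣ) : ℤ) : R) * ∏ i, h (betaSeq N ν (σ i) + (i : ℕ)) := by
    rw [hDet, Matrix.det_apply']
    rfl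
  rw [hdet, Finset.mul_sum]
  have h1 : ∀ σ : Equiv.Perm (Fin N), hDet h (betaSeq (L + 1) μ) *
      (((Equiv.Perm.sign σ : ℤˣ) : ℤ) * ∏ i, h (betaSeq N ν (σ i) + (i : ℕ))) =
      ∑ T ∈ chains (L + 1) B μ N, (((Equiv.Perm.sign σ : ℤˣ) : ℤ) *
        ∏ i : Fin N, if content (L + 1) T i - (i : ℕ) = betaSeq N ν (σ i) then (1 : ℤ) else 0) •
        hDet h (betaSeq (L + 1) (T N)) := by
    intro σ
    rw [mul_left_comm, mul_comm (hDet h _), prod_mul_hDet_eq_sum_chains h0 hneg hμ hM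
      (fun i => betaSeq N ν (σ i) + (i : ℕ)) (a := ν 0 + N) ?_ hL hB, Finset.mul_sum]
    · refine Finset.sum_congr rfl fun T _ => ?_
      rw [Fintype.prod_ite_zero]
      simp only [sub_eq_iff_eq_add, Finset.prod_const_one]
      split_ifs <;> simp
    · intro i
      have := hν (Nat.zero_le (σ i))
      simp only [betaSeq]
      have := i.2
      push_cast
      omega
  refine (Finset.sum_congr rfl fun σ _ => h1 σ).trans ?_
  rw [Finset.sum_comm]
  refine Finset.sum_congr rfl fun T _ => ?_
  rw [← Finset.sum_smul, chainWeight, Matrix.det_apply']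
  rfl

end Chains

/-- `κ` is obtained from `a` by adding a horizontal strip. -/
def Interlaced (a κ : ℕ → ℕ) : Prop := ∀ r, a r ≤ κ r ∧ κ (r + 1) ≤ a r

theorem mem_strips_iff_interlaced {L B : ℕ} (hL : 0 < L) {a κ : ℕ → ℕ} (ha : ∀ r, L ≤ r → a r = 0) :
    κ ∈ strips L B a ↔ Interlaced a κ ∧ κ 0 ≤ B ∧ ∀ r, L ≤ r → κ r = 0 := by
  constructor
  · intro h
    refine ⟨fun r => ⟨le_of_mem_strips h ha r, ?_⟩, ?_, (mem_strips.mp h).2⟩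
    · by_cases hr : r + 1 < L
      · simpa [stripBound] using ((mem_strips.mp h).1 (r + 1) hr).2
      · rw [(mem_strips.mp h).2 (r + 1) (by omega)]
        exact Nat.zero_le _
    · simpa [stripBound] using ((mem_strips.mp h).1 0 hL).2
  · rintro ⟨h1, h2, h3⟩
    refine mem_strips.mpr ⟨fun r _ => ⟨(h1 r).1, ?_⟩, h3⟩
    cases r with
    | zero => simpa [stripBound] using h2
    | succ r => simpa [stripBound] using (h1 r).2

/-- The number of cells of `κ` in the columns with index at least `c`. -/
def tailSum (L : ℕ) (κ : ℕ → ℕ) (c : ℕ) : ℤ := ∑ r ∈ Finset.range L, ((κ r - c : ℕ) : ℤ)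

/-- The length of the column of `κ` with index `c`. -/
def colLen (L : ℕ) (κ : ℕ → ℕ) (c : ℕ) : ℤ := ∑ r ∈ Finset.range L, if c < κ r then 1 else 0

theorem tailSum_zero (L : ℕ) (κ : ℕ → ℕ) : tailSum L κ 0 = partSum L κ := rfl

theorem tailSum_eq_add_colLen (L : ℕ) (κ : ℕ → ℕ) (c : ℕ) :
    tailSum L κ c = tailSum L κ (c + 1) + colLen L κ c := by
  rw [tailSum, tailSum, colLen, ← Finset.sum_add_distrib]
  refine Finset.sum_congr rfl fun r _ => ?_
  split_ifs <;> omega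

theorem colLen_le_of_interlaced {L c : ℕ} {a κ : ℕ → ℕ} (h : Interlaced a κ) :
    colLen L a c ≤ colLen L κ c := by
  refine Finset.sum_le_sum fun r _ => ?_
  have := (h r).1
  split_ifs <;> omega

theorem colLen_le_add_one_of_interlaced {L c : ℕ} {a κ : ℕ → ℕ} (h : Interlaced a κ) :
    colLen L κ c ≤ colLen L a c + 1 := by
  cases L with
  | zero => simp [colLen]
  | succ L =>
    rw [colLen, Finset.sum_range_succ', colLen, Finset.sum_range_succ]
    have h1 : ∑ r ∈ Finset.range L, (if c < κ (r + 1) then (1 : ℤ) else 0) ≤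
        ∑ r ∈ Finset.range L, if c < a r then (1 : ℤ) else 0 := by
      refine Finset.sum_le_sum fun r _ => ?_
      have := (h r).2
      split_ifs <;> omega
    split_ifs <;> omega

theorem le_of_colLen_eq {L c : ℕ} {a κ : ℕ → ℕ} (h : Interlaced a κ)
    (hκ : ∀ r, L ≤ r → κ r = 0) (heq : colLen L κ c = colLen L a c) (r : ℕ) (hr : a r ≤ c) :
    κ r ≤ c := by
  by_cases hrL : r < L
  · rw [colLen, colLen, eq_comm, Finset.sum_eq_sum_iff_of_le] at heq
    · have := heq r (Finset.mem_range.mpr hrL)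
      rw [if_neg (by omega)] at this
      by_contra hcon
      rw [if_pos (by omega)] at this
      omega
    · intro r _
      have := (h r).1
      split_ifs <;> omega
  · rw [hκ r (by omega)]
    exact Nat.zero_le _

/-- The Bender–Knuth reflection of `κ` between `a` and `b`, performed only on the cells in the
columns with index less than `c`. -/
def flipRow (c : ℕ) (a κ b : ℕ → ℕ) (r : ℕ) : ℕ :=
  if c < a r then κ r
  else max (a r) (b (r + 1)) + min c (if r = 0 then b 0 else min (a (r - 1)) (b r)) - κ r

section Flip

variable {L c : ℕ} {a κ b : ℕ → ℕ}

theorem flipRow_mem_bounds (h1 : Interlaced a κ) (h2 : Interlaced κ b)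
    (hc : ∀ r, a r ≤ c → κ r ≤ c) (r : ℕ) :
    (a r ≤ flipRow c a κ b r ∧ b (r + 1) ≤ flipRow c a κ b r ∧ flipRow c a κ b r ≤ b r ∧
      (∀ s, r = s + 1 → flipRow c a κ b r ≤ a s)) ∧ (a r ≤ c → flipRow c a κ b r ≤ c) ∧
      (¬ c < a r → flipRow c a κ b r + κ r =
        max (a r) (b (r + 1)) + min c (if r = 0 then b 0 else min (a (r - 1)) (b r))) := by
  have e1 := h1 r
  have e2 := h2 r
  have e3 := hc r
  cases r with
  | zero =>
    simp only [flipRow, if_true]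
    split_ifs <;> refine ⟨⟨?_, ?_, ?_, fun s hs => by cases hs⟩, ?_, ?_⟩ <;> intros <;>
      omega
  | succ r =>
    have e4 := h1 r
    simp only [flipRow, Nat.succ_ne_zero, if_false, Nat.add_sub_cancel, Nat.add_right_cancel_iff,
      forall_eq']
    split_ifs <;> refine ⟨⟨?_, ?_, ?_, ?_⟩, ?_, ?_⟩ <;> intros <;> omega

theorem interlaced_flipRow_left (h1 : Interlaced a κ) (h2 : Interlaced κ b)
    (hc : ∀ r, a r ≤ c → κ r ≤ c) : Interlaced a (flipRow c a κ b) := fun r =>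
  ⟨(flipRow_mem_bounds h1 h2 hc r).1.1, (flipRow_mem_bounds h1 h2 hc (r + 1)).1.2.2.2 r rfl⟩

theorem interlaced_flipRow_right (h1 : Interlaced a κ) (h2 : Interlaced κ b)
    (hc : ∀ r, a r ≤ c → κ r ≤ c) : Interlaced (flipRow c a κ b) b := fun r =>
  ⟨(flipRow_mem_bounds h1 h2 hc r).1.2.2.1, (flipRow_mem_bounds h1 h2 hc r).1.2.1⟩

theorem flipRow_sub_of_le (h1 : Interlaced a κ) (h2 : Interlaced κ b)
    (hc : ∀ r, a r ≤ c → κ r ≤ c) {d : ℕ} (hd : c ≤ d) (r : ℕ) :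
    flipRow c a κ b r - d = κ r - d := by
  by_cases h : c < a r
  · simp [flipRow, h]
  · have := (flipRow_mem_bounds h1 h2 hc r).2.1 (by omega)
    have := hc r (by omega)
    omega

theorem flipRow_flipRow (h1 : Interlaced a κ) (h2 : Interlaced κ b)
    (hc : ∀ r, a r ≤ c → κ r ≤ c) : flipRow c a (flipRow c a κ b) b = κ := by
  ext r
  by_cases h : c < a r
  · simp [flipRow, h]
  · have := (flipRow_mem_bounds h1 h2 hc r).2.2 h
    rw [flipRow, if_neg h, ← this]
    omega

theorem sum_max_add_min (A C : ℕ → ℕ) (L : ℕ) :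
    ∑ r ∈ Finset.range L, (max (A r) (C (r + 1)) +
      if r = 0 then C 0 else min (A (r - 1)) (C r)) +
      (if L = 0 then C 0 else min (A (L - 1)) (C L)) =
    ∑ r ∈ Finset.range L, A r + ∑ r ∈ Finset.range (L + 1), C r := by
  induction L with
  | zero => simp
  | succ L ih =>
    rw [Finset.sum_range_succ, Finset.sum_range_succ _ (L + 1), Finset.sum_range_succ A]
    simp only [Nat.succ_ne_zero, if_false, Nat.add_sub_cancel] at ih ⊢
    omega

theorem partSum_flipRow_add (h1 : Interlaced a κ) (h2 : Interlaced κ b)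
    (hc : ∀ r, a r ≤ c → κ r ≤ c) (hb : b L = 0) :
    partSum L (flipRow c a κ b) + partSum L κ = partSum L a + partSum L b +
      (2 * tailSum L κ c - tailSum L a c - tailSum L b c) := by
  have hsum := sum_max_add_min (fun r => min (a r) c) (fun r => min (b r) c) L
  have hzero : (if L = 0 then min (b 0) c else min (min (a (L - 1)) c) (min (b L) c)) = 0 := by
    split_ifs with h
    · subst h
      simp [hb]
    · simp [hb]
  rw [hzero, add_zero, Finset.sum_range_succ _ L, hb, Nat.zero_min, add_zero] at hsum
  have hpt : ∀ r, (flipRow c a κ b r : ℤ) + κ r = 2 * ((κ r - c : ℕ) : ℤ) +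
      ((max (min (a r) c) (min (b (r + 1)) c) +
        if r = 0 then min (b 0) c else min (min (a (r - 1)) c) (min (b r) c) : ℕ) : ℤ) := by
    intro r
    have e1 := h1 r
    have e2 := h2 r
    have e3 := hc r
    by_cases h : c < a r
    · rw [flipRow, if_pos h]
      cases r with
      | zero =>
        simp only [if_true]
        omega
      | succ r =>
        have e4 := h1 r
        simp only [Nat.succ_ne_zero, if_false, Nat.add_sub_cancel]
        omega
    · have e5 := (flipRow_mem_bounds h1 h2 hc r).2.2 h
      cases r with
      | zero =>
        simp only [if_true] at e5 ⊢
        omega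
      | succ r =>
        have e4 := h1 r
        simp only [Nat.succ_ne_zero, if_false, Nat.add_sub_cancel] at e5 ⊢
        omega
  have hsplit : ∀ x : ℕ → ℕ, partSum L x = tailSum L x c +
      ((∑ r ∈ Finset.range L, min (x r) c : ℕ) : ℤ) := by
    intro x
    rw [partSum, tailSum, Nat.cast_sum, ← Finset.sum_add_distrib]
    exact Finset.sum_congr rfl fun r _ => by omega
  have hlhs : partSum L (flipRow c a κ b) + partSum L κ = 2 * tailSum L κ c +
      ((∑ r ∈ Finset.range L, min (a r) c + ∑ r ∈ Finset.range L, min (b r) c : ℕ) : ℤ) := by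
    rw [← hsum, partSum, partSum, ← Finset.sum_add_distrib, Finset.sum_congr rfl fun r _ => hpt r,
      Finset.sum_add_distrib, ← Finset.mul_sum, tailSum, Nat.cast_sum]
  rw [hlhs, hsplit a, hsplit b]
  push_cast
  ring

end Flip

/-- The number of entries `i` minus the number of entries `i + 1` of the tableau `T` in the columns
with index at least `c`. -/
def excess (L : ℕ) (T : ℕ → ℕ → ℕ) (i c : ℕ) : ℤ :=
  2 * tailSum L (T (i + 1)) c - tailSum L (T i) c - tailSum L (T (i + 2)) c

/-- `p.1` is the last column, and `p.2` the first entry, at which the right-to-left column reading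
of `T` fails to be a lattice word. -/
structure IsPivot (L N : ℕ) (T : ℕ → ℕ → ℕ) (p : ℕ × ℕ) : Prop where
  lt : p.2 + 1 < N
  neg : excess L T p.2 p.1 < 0
  later : ∀ i c, i + 1 < N → p.1 < c → 0 ≤ excess L T i c
  smaller : ∀ i < p.2, 0 ≤ excess L T i p.1

section Pivot

variable {L B N : ℕ} {μ : ℕ → ℕ} {T : ℕ → ℕ → ℕ}

theorem IsPivot.unique {p q : ℕ × ℕ} (hp : IsPivot L N T p) (hq : IsPivot L N T q) : p = q := by
  have h1 : p.1 = q.1 := by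
    rcases lt_trichotomy p.1 q.1 with h | h | h
    · exact absurd hq.neg (hp.later _ _ hq.lt h).not_gt
    · exact h
    · exact absurd hp.neg (hq.later _ _ hp.lt h).not_gt
  refine Prod.ext h1 ?_
  rcases lt_trichotomy p.2 q.2 with h | h | h
  · exact absurd hp.neg (h1 ▸ hq.smaller _ h).not_gt
  · exact h
  · exact absurd hq.neg (h1 ▸ hp.smaller _ h).not_gt

theorem interlaced_of_mem_chains (hμ : ∀ r, L ≤ r → μ r = 0) (hL : 0 < L)
    (hT : T ∈ chains L B μ N) : ∀ i ≤ N,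
      (∀ r, L ≤ r → T i r = 0) ∧ (i < N → Interlaced (T i) (T (i + 1)) ∧ T (i + 1) 0 ≤ B) := by
  rw [mem_chains] at hT
  have h0 : ∀ i ≤ N, ∀ r, L ≤ r → T i r = 0 := by
    intro i hi
    cases i with
    | zero => rwa [hT.1]
    | succ i => exact (mem_strips.mp (hT.2.1 i hi)).2
  refine fun i hi => ⟨h0 i hi, fun hlt => ?_⟩
  have := (mem_strips_iff_interlaced hL (h0 i hi)).mp (hT.2.1 i hlt)
  exact ⟨this.1, this.2.1⟩

theorem exists_isPivot (hμ : ∀ r, L ≤ r → μ r = 0) (hL : 0 < L) (hT : T ∈ chains L B μ N)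
    {i c : ℕ} (hi : i + 1 < N) (hneg : excess L T i c < 0) : ∃ p, IsPivot L N T p := by
  classical
  have hT' := interlaced_of_mem_chains hμ hL hT
  have hbound : ∀ j ≤ N, ∀ r, T j r ≤ max B (∑ j ∈ Finset.range (N + 1), ∑ r ∈ Finset.range L, T j r) := by
    intro j hj r
    by_cases hr : r < L
    · refine le_max_of_le_right ((Finset.single_le_sum (f := fun r => T j r)
        (fun _ _ => Nat.zero_le _) (Finset.mem_range.mpr hr)).trans ?_)
      exact Finset.single_le_sum (f := fun j => ∑ r ∈ Finset.range L, T j r)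
        (fun _ _ => Nat.zero_le _) (Finset.mem_range.mpr (by omega))
    · rw [(hT' j hj).1 r (by omega)]
      exact Nat.zero_le _
  set K := max B (∑ j ∈ Finset.range (N + 1), ∑ r ∈ Finset.range L, T j r)
  have htail : ∀ j ≤ N, ∀ d, K ≤ d → tailSum L (T j) d = 0 := by
    intro j hj d hd
    refine Finset.sum_eq_zero fun r _ => ?_
    have := hbound j hj r
    omega
  let P : ℕ → Prop := fun d => ∃ i, i + 1 < N ∧ excess L T i d < 0
  have hP : ∀ d, P d → d ≤ K := by
    rintro d ⟨i, hi, hd⟩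
    by_contra hcon
    rw [excess, htail _ (by omega) _ (by omega), htail _ (by omega) _ (by omega),
      htail _ (by omega) _ (by omega)] at hd
    omega
  have hPc : P c := ⟨i, hi, hneg⟩
  have hg : P (Nat.findGreatest P K) := Nat.findGreatest_spec (hP c hPc) hPc
  refine ⟨(Nat.findGreatest P K, Nat.find hg), (Nat.find_spec hg).1, (Nat.find_spec hg).2, ?_, ?_⟩
  · intro i d hi hd
    by_contra hcon
    have hPd : P d := ⟨i, hi, not_le.mp hcon⟩
    exact absurd hPd (Nat.findGreatest_is_greatest hd (hP d hPd))
  · intro i hi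
    by_contra hcon
    exact Nat.find_min hg hi ⟨by have := (Nat.find_spec hg).1; omega, not_le.mp hcon⟩

theorem IsPivot.excess_eq {p : ℕ × ℕ} (hp : IsPivot L N T p) (hμ : ∀ r, L ≤ r → μ r = 0)
    (hL : 0 < L) (hT : T ∈ chains L B μ N) :
    excess L T p.2 p.1 = -1 ∧ ∀ r, T p.2 r ≤ p.1 → T (p.2 + 1) r ≤ p.1 := by
  have hT' := interlaced_of_mem_chains hμ hL hT
  have hlt := hp.lt
  have i1 := ((hT' p.2 (by omega)).2 (by omega)).1
  have i2 := ((hT' (p.2 + 1) (by omega)).2 (by omega)).1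
  have e0 := hp.neg
  have e1 := hp.later p.2 (p.1 + 1) hp.lt (Nat.lt_succ_self _)
  have c1 := colLen_le_of_interlaced (L := L) (c := p.1) i1
  have c2 := colLen_le_add_one_of_interlaced (L := L) (c := p.1) i2
  have t0 := tailSum_eq_add_colLen L (T p.2) p.1
  have t1 := tailSum_eq_add_colLen L (T (p.2 + 1)) p.1
  have t2 := tailSum_eq_add_colLen L (T (p.2 + 2)) p.1
  rw [add_assoc] at c2
  simp only [excess] at e0 e1 ⊢
  norm_num at c2
  exact ⟨by omega, le_of_colLen_eq i1 (hT' (p.2 + 1) (by omega)).1 (by omega)⟩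

/-- The tableau obtained from `T` by the Bender–Knuth involution for the entries `p.2` and
`p.2 + 1` in the columns with index less than `p.1`. -/
def flipChain (T : ℕ → ℕ → ℕ) (p : ℕ × ℕ) : ℕ → ℕ → ℕ :=
  Function.update T (p.2 + 1) (flipRow p.1 (T p.2) (T (p.2 + 1)) (T (p.2 + 2)))

theorem flipChain_same (T : ℕ → ℕ → ℕ) (p : ℕ × ℕ) :
    flipChain T p (p.2 + 1) = flipRow p.1 (T p.2) (T (p.2 + 1)) (T (p.2 + 2)) := by
  simp [flipChain]

theorem flipChain_of_ne (T : ℕ → ℕ → ℕ) (p : ℕ × ℕ) {i : ℕ} (hi : i ≠ p.2 + 1) :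
    flipChain T p i = T i := by
  simp [flipChain, hi]

variable {p : ℕ × ℕ} (hμ : ∀ r, L ≤ r → μ r = 0) (hL : 0 < L) (hT : T ∈ chains L B μ N)
  (hp : IsPivot L N T p)

include hμ hL hT hp

theorem IsPivot.interlaced : Interlaced (T p.2) (T (p.2 + 1)) ∧
    Interlaced (T (p.2 + 1)) (T (p.2 + 2)) := by
  have hT' := interlaced_of_mem_chains hμ hL hT
  have hlt := hp.lt
  exact ⟨((hT' p.2 (by omega)).2 (by omega)).1, ((hT' (p.2 + 1) (by omega)).2 (by omega)).1⟩

theorem flipChain_mem_chains : flipChain T p ∈ chains L B μ N := by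
  have hT' := interlaced_of_mem_chains hμ hL hT
  have hlt := hp.lt
  obtain ⟨i1, i2⟩ := hp.interlaced hμ hL hT
  have hc := (hp.excess_eq hμ hL hT).2
  have hT0 := mem_chains.mp hT
  rw [mem_chains]
  refine ⟨by rw [flipChain_of_ne _ _ (by omega), hT0.1], fun i hi => ?_, fun i hi => ?_⟩
  · by_cases h1 : i = p.2
    · subst h1
      rw [flipChain_same, flipChain_of_ne _ _ (by omega),
        mem_strips_iff_interlaced hL (hT' p.2 (by omega)).1]
      have hle := fun r => (interlaced_flipRow_right i1 i2 hc r).1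
      refine ⟨interlaced_flipRow_left i1 i2 hc, (hle 0).trans
        ((hT' (p.2 + 1) (by omega)).2 (by omega)).2, fun r hr => Nat.le_zero.mp ?_⟩
      exact (hle r).trans ((hT' (p.2 + 2) (by omega)).1 r hr).le
    · by_cases h2 : i = p.2 + 1
      · subst h2
        rw [flipChain_same, flipChain_of_ne _ _ (by omega), mem_strips_iff_interlaced hL]
        · exact ⟨interlaced_flipRow_right i1 i2 hc, ((hT' (p.2 + 1) (by omega)).2 (by omega)).2,
            (hT' (p.2 + 2) (by omega)).1⟩
        · intro r hr
          exact Nat.le_zero.mp (((interlaced_flipRow_right i1 i2 hc r).1).trans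
            ((hT' (p.2 + 2) (by omega)).1 r hr).le)
      · rw [flipChain_of_ne _ _ (by omega), flipChain_of_ne _ _ (by omega)]
        exact hT0.2.1 i hi
  · rw [flipChain_of_ne _ _ (by omega), flipChain_of_ne _ _ (by omega)]
    exact hT0.2.2 i hi

theorem excess_flipChain (i : ℕ) {d : ℕ} (hd : p.1 ≤ d) :
    excess L (flipChain T p) i d = excess L T i d := by
  obtain ⟨i1, i2⟩ := hp.interlaced hμ hL hT
  have hc := (hp.excess_eq hμ hL hT).2
  have htail : ∀ j, tailSum L (flipChain T p j) d = tailSum L (T j) d := by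
    intro j
    by_cases hj : j = p.2 + 1
    · rw [hj, flipChain_same]
      exact Finset.sum_congr rfl fun r _ => by rw [flipRow_sub_of_le i1 i2 hc hd]
    · rw [flipChain_of_ne _ _ hj]
  simp only [excess, htail]

theorem isPivot_flipChain : IsPivot L N (flipChain T p) p where
  lt := hp.lt
  neg := by
    rw [excess_flipChain hμ hL hT hp _ le_rfl]
    exact hp.neg
  later i c hi hc := by
    rw [excess_flipChain hμ hL hT hp _ hc.le]
    exact hp.later i c hi hc
  smaller i hi := by
    rw [excess_flipChain hμ hL hT hp _ le_rfl]
    exact hp.smaller i hi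

theorem flipChain_flipChain : flipChain (flipChain T p) p = T := by
  obtain ⟨i1, i2⟩ := hp.interlaced hμ hL hT
  have hc := (hp.excess_eq hμ hL hT).2
  ext1 i
  by_cases hi : i = p.2 + 1
  · rw [hi, flipChain_same, flipChain_of_ne _ _ (by omega : p.2 ≠ p.2 + 1), flipChain_same,
      flipChain_of_ne _ _ (by omega : p.2 + 2 ≠ p.2 + 1), flipRow_flipRow i1 i2 hc]
  · rw [flipChain_of_ne _ _ hi, flipChain_of_ne _ _ hi]

theorem content_flipChain (i : ℕ) : content L (flipChain T p) i - i =
    content L T (Equiv.swap p.2 (p.2 + 1) i) - (Equiv.swap p.2 (p.2 + 1) i : ℕ) := by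
  obtain ⟨i1, i2⟩ := hp.interlaced hμ hL hT
  obtain ⟨he, hc⟩ := hp.excess_eq hμ hL hT
  have hlt := hp.lt
  have hsum := partSum_flipRow_add (L := L) i1 i2 hc
    ((interlaced_of_mem_chains hμ hL hT (p.2 + 2) (by omega)).1 L le_rfl)
  rw [excess] at he
  rw [he] at hsum
  by_cases h1 : i = p.2
  · subst h1
    rw [Equiv.swap_apply_left, content, content, flipChain_same, flipChain_of_ne _ _ (by omega)]
    push_cast
    linarith
  · by_cases h2 : i = p.2 + 1
    · subst h2
      rw [Equiv.swap_apply_right, content, content, flipChain_same, flipChain_of_ne _ _ (by omega)]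
      push_cast
      linarith
    · rw [Equiv.swap_apply_of_ne_of_ne h1 h2, content, content, flipChain_of_ne _ _ (by omega),
        flipChain_of_ne _ _ h2]

theorem chainWeight_flipChain (ν : ℕ → ℕ) :
    chainWeight L N ν (flipChain T p) = -chainWeight L N ν T := by
  have hlt := hp.lt
  let x : Fin N := ⟨p.2, by omega⟩
  let y : Fin N := ⟨p.2 + 1, hlt⟩
  have hxy : x ≠ y := by simp [x, y]
  have hswap : ∀ j : Fin N, ((Equiv.swap x y j : Fin N) : ℕ) = Equiv.swap p.2 (p.2 + 1) (j : ℕ) := by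
    intro j
    simp only [Equiv.swap_apply_def, x, y, Fin.ext_iff]
    split_ifs <;> rfl
  have := Matrix.det_permute' (Equiv.swap x y) (Matrix.of fun i j : Fin N =>
    if content L T j - (j : ℕ) = betaSeq N ν i then (1 : ℤ) else 0)
  rw [Equiv.Perm.sign_swap hxy] at this
  rw [chainWeight, chainWeight]
  simp only [Units.val_neg, Units.val_one, Int.cast_neg, Int.cast_one, neg_mul, one_mul] at this
  rw [← this]
  congr 1
  ext i j
  simp only [Matrix.of_apply, Matrix.submatrix_apply, id, content_flipChain hμ hL hT hp, hswap]

end Pivot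

theorem det_ite_eq_nonneg {N : ℕ} {u v : Fin N → ℤ} (hu : StrictAnti u) (hv : StrictAnti v) :
    0 ≤ (Matrix.of fun i j : Fin N => if u j = v i then (1 : ℤ) else 0).det := by
  by_cases h : ∀ i, ∃ j, u j = v i
  · choose g hg using h
    have hginj : Function.Injective g := fun i j hij => hv.injective (by rw [← hg i, ← hg j, hij])
    have hgsurj : Function.Surjective g := Finite.injective_iff_surjective.mp hginj
    have hrange : Set.range (OrderDual.toDual ∘ u) = Set.range (OrderDual.toDual ∘ v) := by
      ext x
      constructor
      · rintro ⟨j, rfl⟩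
        obtain ⟨i, rfl⟩ := hgsurj j
        exact ⟨i, congrArg OrderDual.toDual (hg i).symm⟩
      · rintro ⟨i, rfl⟩
        exact ⟨g i, congrArg OrderDual.toDual (hg i)⟩
    have huv : u = v := (StrictMono.range_inj hu.dual_right hv.dual_right).mp hrange
    have hone : (Matrix.of fun i j : Fin N => if u j = v i then (1 : ℤ) else 0) = 1 := by
      ext i j
      simp [huv, Matrix.one_apply, hv.injective.eq_iff, eq_comm]
    rw [hone, Matrix.det_one]
    exact zero_le_one
  · push Not at h
    obtain ⟨i, hi⟩ := h
    rw [Matrix.det_eq_zero_of_row_eq_zero i fun j => by simp [hi j]]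

theorem betaSeq_strictAnti {κ : ℕ → ℕ} (hκ : Antitone κ) (L : ℕ) : StrictAnti (betaSeq L κ) := by
  intro i j hij
  have := hκ (show (i : ℕ) ≤ j from hij.le)
  have : (i : ℕ) < j := hij
  simp only [betaSeq]
  omega

theorem chainWeight_nonneg {L N : ℕ} {T : ℕ → ℕ → ℕ} {ν : ℕ → ℕ} (hν : Antitone ν)
    (hT : ∀ i, i + 1 < N → 0 ≤ excess L T i 0) : 0 ≤ chainWeight L N ν T := by
  refine det_ite_eq_nonneg (u := fun j : Fin N => content L T j - (j : ℕ)) ?_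
    (betaSeq_strictAnti hν N)
  have hanti : ∀ i j : ℕ, i ≤ j → j < N → content L T j ≤ content L T i := by
    intro i j hij
    induction j, hij using Nat.le_induction with
    | base => exact fun _ => le_rfl
    | succ j _ ih =>
      intro hj
      have h1 := ih (by omega)
      have h2 := hT j hj
      simp only [excess, tailSum_zero] at h2
      simp only [content] at h1 ⊢
      rw [add_assoc]
      norm_num
      linarith
  intro i j hij
  have h1 : (i : ℕ) < j := hij
  have := hanti i j h1.le j.2
  simp only
  omega

/-- The product of two Schur functions as a non-negative combination of Schur functions. -/
theorem hDet_mul_hDet_eq_sum_nonneg {R : Type*} [CommRing R] {h : ℤ → R} (h0 : h 0 = 1)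
    (hneg : ∀ m < 0, h m = 0) {μ ν : ℕ → ℕ} (hμ : Antitone μ) {M N L : ℕ}
    (hM : ∀ r, M ≤ r → μ r = 0) (hν : Antitone ν) (hL : M + N ≤ L) :
    ∃ (S : Finset (ℕ → ℕ → ℕ)) (w : (ℕ → ℕ → ℕ) → ℤ),
      (∀ T ∈ S, 0 ≤ w T ∧ Antitone (T N) ∧ ∀ r, L + 1 ≤ r → T N r = 0) ∧
      hDet h (betaSeq (L + 1) μ) * hDet h (betaSeq N ν) =
        ∑ T ∈ S, w T • hDet h (betaSeq (L + 1) (T N)) := by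
  classical
  set B := μ 0 + N * (ν 0 + N) with hB
  have hμL : ∀ r, L + 1 ≤ r → μ r = 0 := fun r hr => hM r (by omega)
  refine ⟨(chains (L + 1) B μ N).filter fun T => ¬ ∃ p, IsPivot (L + 1) N T p,
    chainWeight (L + 1) N ν, fun T hT => ?_, ?_⟩
  · rw [Finset.mem_filter] at hT
    refine ⟨chainWeight_nonneg hν fun i hi => ?_, antitone_of_mem_chains hμ hT.1 le_rfl,
      (interlaced_of_mem_chains hμL (Nat.succ_pos L) hT.1 N le_rfl).1⟩
    by_contra hcon
    exact hT.2 (exists_isPivot hμL (Nat.succ_pos L) hT.1 hi (not_le.mp hcon))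
  · rw [hDet_mul_hDet_eq_sum_chains h0 hneg hμ hM hν hL le_rfl,
      ← Finset.sum_filter_add_sum_filter_not _ fun T => ∃ p, IsPivot (L + 1) N T p]
    refine (congrArg (· + _) ?_).trans (zero_add _)
    have hmem : ∀ {T} (hT : T ∈ (chains (L + 1) B μ N).filter fun T =>
        ∃ p, IsPivot (L + 1) N T p), T ∈ chains (L + 1) B μ N ∧
          IsPivot (L + 1) N T (Finset.mem_filter.mp hT).2.choose := fun hT =>
      ⟨(Finset.mem_filter.mp hT).1, (Finset.mem_filter.mp hT).2.choose_spec⟩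
    have hw := fun {T} hT => chainWeight_flipChain hμL (Nat.succ_pos L) (hmem (T := T) hT).1
      (hmem hT).2 ν
    refine Finset.sum_involution
      (fun T hT => flipChain T (Finset.mem_filter.mp hT).2.choose) ?_ ?_ ?_ ?_
    · intro T hT
      have hlt := (hmem hT).2.lt
      rw [hw hT, flipChain_of_ne _ _ (by omega : N ≠ _)]
      simp
    · intro T hT hne heq
      have := hw hT
      rw [heq] at this
      have hzero : chainWeight (L + 1) N ν T = 0 := by omega
      exact hne (by rw [hzero, zero_smul])
    · intro T hT
      exact Finset.mem_filter.mpr ⟨flipChain_mem_chains hμL (Nat.succ_pos L) (hmem hT).1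
        (hmem hT).2, _, isPivot_flipChain hμL (Nat.succ_pos L) (hmem hT).1 (hmem hT).2⟩
    · intro T hT
      have hp := (hmem hT).2
      have hp' := isPivot_flipChain hμL (Nat.succ_pos L) (hmem hT).1 hp
      have heq := fun h => ((Exists.choose_spec h).unique hp' :
        Exists.choose (p := IsPivot (L + 1) N _) h = _)
      rw [heq]
      exact flipChain_flipChain hμL (Nat.succ_pos L) (hmem hT).1 hp

/-- The matrix obtained by adding a row on top. -/
def consRow {R : Type*} {L n : ℕ} (v : Fin n → R) (A : Fin L → Fin n → R) : Matrix (Fin (L + 1)) (Fin n) R :=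
  Matrix.of fun i c => (Fin.cons v A : Fin (L + 1) → Fin n → R) i c

@[simp]
theorem consRow_zero {R : Type*} {L n : ℕ} (v : Fin n → R) (A : Fin L → Fin n → R) (c : Fin n) :
    consRow v A 0 c = v c := rfl

@[simp]
theorem consRow_succ {R : Type*} {L n : ℕ} (v : Fin n → R) (A : Fin L → Fin n → R) (i : Fin L) (c : Fin n) :
    consRow v A i.succ c = A i c := rfl

section Pluecker

variable {R : Type*} [CommRing R]

theorem det_mul_det_eq_sum_updateRow {n : Type*} [Fintype n] [DecidableEq n] (A B : Matrix n n R)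
    (r : n) : A.det * B.det =
      ∑ i, (A.updateRow i (B.row r)).det * (B.updateRow r (A.row i)).det := by
  have hb : A.det • B.row r = ∑ i, (A.updateRow i (B.row r)).det • A.row i := by
    have := Matrix.mulVec_cramer A.transpose (B.row r)
    rw [Matrix.det_transpose] at this
    rw [← this]
    ext c
    simp [Matrix.mulVec, dotProduct, Matrix.cramer_transpose_apply, mul_comm]
  have := congrFun (congrArg (Matrix.cramer B.transpose) hb) r
  rw [map_smul, map_sum] at this
  simpa [Matrix.cramer_transpose_apply, Matrix.updateRow_eq_self, Matrix.row] using this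

theorem det_consRow_single_zero {L : ℕ} (A : Fin L → Fin (L + 1) → R) :
    (consRow (Pi.single 0 1) A).det = (Matrix.of fun i c : Fin L => A i c.succ).det := by
  rw [Matrix.det_succ_row_zero, Finset.sum_eq_single 0]
  · simp only [consRow_zero, Pi.single_eq_same, Fin.val_zero, pow_zero, one_mul]
    rfl
  · intro c _ hc
    simp [hc]
  · simp

theorem det_consRow_single_last {L : ℕ} (A : Fin L → Fin (L + 1) → R) :
    (consRow (Pi.single (Fin.last L) 1) A).det =
      (-1) ^ L * (Matrix.of fun i c : Fin L => A i c.castSucc).det := by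
  rw [Matrix.det_succ_row_zero, Finset.sum_eq_single (Fin.last L)]
  · simp only [consRow_zero, Pi.single_eq_same, Fin.val_last, mul_one]
    refine congrArg (fun M : Matrix _ _ R => (-1) ^ L * M.det) ?_
    ext i c
    simp
  · intro c _ hc
    simp [hc]
  · simp

theorem sq_hDet_eq_sum (h : ℤ → R) {m : ℕ} (α : Fin (m + 1) → ℤ) (j : Fin (m + 1)) :
    hDet h α ^ 2 =
      (-1) ^ (j : ℕ) * hDet h (Fin.cons (α j) fun i => α i - 1 : Fin (m + 2) → ℤ) *
        hDet h (fun i => j.removeNth α i + 1) +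
      ∑ i, hDet h (Function.update α i (α j + 1)) * hDet h (Function.update α j (α i - 1)) := by
  let A : (Fin (m + 1) → ℤ) → Matrix (Fin (m + 2)) (Fin (m + 2)) R := fun α =>
    consRow (Pi.single 0 1) fun i c => h (α i - 1 + (c : ℕ))
  let B : (Fin (m + 1) → ℤ) → Matrix (Fin (m + 2)) (Fin (m + 2)) R := fun α =>
    consRow (Pi.single (Fin.last _) 1) fun i c => h (α i + (c : ℕ))
  have hA : ∀ α, (A α).det = hDet h α := fun α => by
    refine (det_consRow_single_zero _).trans ?_
    unfold hDet
    congr 1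
    ext i c
    simp only [Matrix.of_apply, Fin.val_succ]
    push_cast
    ring_nf
  have hB : ∀ α, (B α).det = (-1) ^ (m + 1) * hDet h α := fun α => by
    refine (det_consRow_single_last _).trans ?_
    rfl
  have hAu : ∀ i : Fin (m + 1), (A α).updateRow i.succ ((B α).row j.succ) =
      A (Function.update α i (α j + 1)) := fun i => by
    ext k c
    refine Fin.cases ?_ (fun k => ?_) k
    · rw [Matrix.updateRow_ne (Fin.succ_ne_zero i).symm]
      rfl
    · by_cases hk : k = i
      · subst hk
        simp [A, B]
      · rw [Matrix.updateRow_ne (fun h => hk (Fin.succ_injective _ h))]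
        simp [A, hk]
  have hBu : ∀ i : Fin (m + 1), (B α).updateRow j.succ ((A α).row i.succ) =
      B (Function.update α j (α i - 1)) := fun i => by
    ext k c
    refine Fin.cases ?_ (fun k => ?_) k
    · rw [Matrix.updateRow_ne (Fin.succ_ne_zero j).symm]
      rfl
    · by_cases hk : k = j
      · subst hk
        simp [A, B]
      · rw [Matrix.updateRow_ne (fun h => hk (Fin.succ_injective _ h))]
        simp [B, hk]
  have hA0 : ((A α).updateRow 0 ((B α).row j.succ)).det =
      hDet h (Fin.cons (α j) fun i => α i - 1 : Fin (m + 2) → ℤ) := by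
    unfold hDet
    congr 1
    ext k c
    refine Fin.cases ?_ (fun k => ?_) k
    · simp [B]
    · rw [Matrix.updateRow_ne (Fin.succ_ne_zero k)]
      simp [A]
  have hB0 : ((B α).updateRow j.succ ((A α).row 0)).det =
      (-1) ^ (m + 1 + (j : ℕ)) * hDet h (fun i => j.removeNth α i + 1) := by
    rw [Matrix.det_succ_row _ j.succ, Finset.sum_eq_single 0]
    · have : ((B α).updateRow j.succ ((A α).row 0)).submatrix j.succ.succAbove (Fin.succAbove 0) =
          consRow (Pi.single (Fin.last m) 1) fun i c => h (j.removeNth α i + 1 + (c : ℕ)) := by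
        ext k c
        rw [Matrix.submatrix_apply, Matrix.updateRow_ne (Fin.succAbove_ne _ _)]
        refine Fin.cases ?_ (fun k => ?_) k
        · simp [B, Pi.single_apply, ← Fin.succ_last, Fin.succ_inj]
        · simp [B, Fin.removeNth]
          ring_nf
      rw [this, det_consRow_single_last, Matrix.updateRow_self]
      simp only [A, Matrix.row, consRow_zero, Pi.single_eq_same, Fin.val_succ, Fin.val_zero]
      rw [pow_add, pow_add, pow_add]
      have e : (Matrix.of fun i c : Fin m => h (j.removeNth α i + 1 + (c.castSucc : ℕ))).det =
          hDet h (fun i => j.removeNth α i + 1) := rfl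
      rw [e]
      ring
    · intro c _ hc
      simp [A, hc]
    · simp
  have key := det_mul_det_eq_sum_updateRow (A α) (B α) j.succ
  rw [Fin.sum_univ_succ, hA0, hB0] at key
  simp only [hAu, hBu, hA, hB] at key
  have hsq : ((-1 : R) ^ (m + 1)) * (-1) ^ (m + 1) = 1 := by
    rw [← mul_pow]
    simp
  calc hDet h α ^ 2 = (-1) ^ (m + 1) * (hDet h α * ((-1) ^ (m + 1) * hDet h α)) := by
        linear_combination (-hDet h α ^ 2) * hsq
    _ = _ := by
        rw [key, mul_add, Finset.mul_sum]
        congr 1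
        · rw [pow_add]
          linear_combination (hDet h (Fin.cons (α j) fun i => α i - 1 : Fin (m + 2) → ℤ) *
            hDet h (fun i => j.removeNth α i + 1) * (-1) ^ (j : ℕ)) * hsq
        · refine Finset.sum_congr rfl fun i _ => ?_
          linear_combination (hDet h (Function.update α i (α j + 1)) *
            hDet h (Function.update α j (α i - 1))) * hsq

theorem hDet_insertNth (h : ℤ → R) {L : ℕ} (p : Fin (L + 1)) (x : ℤ) (γ : Fin L → ℤ) :
    hDet h (p.insertNth x γ : Fin (L + 1) → ℤ) =
      (-1) ^ (p : ℕ) * hDet h (Fin.cons x γ : Fin (L + 1) → ℤ) := by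
  have e : (p.insertNth x γ : Fin (L + 1) → ℤ) = Fin.cons x γ ∘ p.cycleRange :=
    (Fin.cons_comp_cycleRange ..).symm
  rw [e]
  have := Matrix.det_permute p.cycleRange
    (Matrix.of fun i c : Fin (L + 1) => h ((Fin.cons x γ : Fin (L + 1) → ℤ) i + (c : ℕ)))
  rw [Fin.sign_cycleRange] at this
  simp only [Units.val_pow_eq_pow_val, Units.val_neg, Units.val_one, Int.cast_pow, Int.cast_neg,
    Int.cast_one] at this
  exact this

theorem hDet_update_eq_insertNth (h : ℤ → R) {L : ℕ} (i p : Fin (L + 1)) (x : ℤ)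
    (α : Fin (L + 1) → ℤ) :
    hDet h (Function.update α i x) =
      (-1) ^ ((i : ℕ) + p) * hDet h (p.insertNth x (i.removeNth α) : Fin (L + 1) → ℤ) := by
  rw [← Fin.insertNth_removeNth, hDet_insertNth, hDet_insertNth, ← mul_assoc, ← pow_add]
  congr 1
  rw [add_assoc, pow_add, ← two_mul, pow_mul]
  simp

theorem antitone_insertNth {L : ℕ} {p : Fin (L + 1)} {x : ℤ} {γ : Fin L → ℤ} (hγ : Antitone γ)
    (h1 : ∀ k : Fin L, (k : ℕ) < p → x ≤ γ k) (h2 : ∀ k : Fin L, (p : ℕ) ≤ k → γ k ≤ x) :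
    Antitone (p.insertNth x γ : Fin (L + 1) → ℤ) := by
  intro a b hab
  rcases Fin.eq_self_or_eq_succAbove p a with ha | ⟨a, rfl⟩ <;>
    rcases Fin.eq_self_or_eq_succAbove p b with hb | ⟨b, rfl⟩ <;>
    (try subst ha) <;> (try subst hb)
  · exact le_rfl
  · simp only [Fin.insertNth_apply_same, Fin.insertNth_apply_succAbove]
    refine h2 b ?_
    by_contra hcon
    rw [Fin.succAbove_of_castSucc_lt _ _ (by simpa [Fin.lt_def] using hcon)] at hab
    simp [Fin.le_def] at hab
    omega
  · simp only [Fin.insertNth_apply_same, Fin.insertNth_apply_succAbove]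
    refine h1 a ?_
    by_contra hcon
    rw [Fin.succAbove_of_le_castSucc _ _ (by simpa [Fin.le_def] using hcon)] at hab
    simp [Fin.le_def] at hab
    omega
  · simp only [Fin.insertNth_apply_succAbove]
    exact hγ (Fin.succAbove_le_succAbove_iff.mp hab)

theorem val_succAbove_eq {L : ℕ} (p : Fin (L + 1)) (k : Fin L) :
    (p.succAbove k : ℕ) = if (k : ℕ) < p then (k : ℕ) else k + 1 := by
  simp only [Fin.succAbove, Fin.lt_def, Fin.val_castSucc]
  split_ifs <;> simp

theorem exists_antitone_hDet_update_mul (h : ℤ → R) {m : ℕ} {α : Fin (m + 1) → ℤ}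
    (hα : StrictAnti α) (i j : Fin (m + 1)) :
    ∃ β γ : Fin (m + 1) → ℤ, Antitone β ∧ Antitone γ ∧
      hDet h (Function.update α i (α j + 1)) * hDet h (Function.update α j (α i - 1)) =
        hDet h β * hDet h γ := by
  have hrem : ∀ p : Fin (m + 1), Antitone (p.removeNth α) := fun p =>
    hα.antitone.comp_monotone (Fin.strictMono_succAbove p).monotone
  obtain ⟨p, q, hp, hq, hpq⟩ : ∃ p q : Fin (m + 1),
      (p : ℕ) = (if (i : ℕ) < j then (j : ℕ) - 1 else j) ∧
      (q : ℕ) = (if (i : ℕ) < j then (i : ℕ) + 1 else i) ∧ Even ((i : ℕ) + p + (j + q)) := by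
    refine ⟨⟨if (i : ℕ) < j then (j : ℕ) - 1 else j, by split_ifs <;> omega⟩,
      ⟨if (i : ℕ) < j then (i : ℕ) + 1 else i, by split_ifs <;> omega⟩, rfl, rfl, ?_⟩
    rw [Nat.even_iff]
    simp only
    split_ifs <;> omega
  refine ⟨p.insertNth (α j + 1) (i.removeNth α), q.insertNth (α i - 1) (j.removeNth α),
    antitone_insertNth (hrem i) (fun k hk => ?_) (fun k hk => ?_),
    antitone_insertNth (hrem j) (fun k hk => ?_) (fun k hk => ?_), ?_⟩
  · have hv := val_succAbove_eq i k
    have : i.succAbove k < j := by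
      rw [Fin.lt_def, hv]
      split_ifs at hp ⊢ <;> omega
    have := hα this
    simp only [Fin.removeNth]
    omega
  · have hv := val_succAbove_eq i k
    have : j ≤ i.succAbove k := by
      rw [Fin.le_def, hv]
      split_ifs at hp ⊢ <;> omega
    have := hα.antitone this
    simp only [Fin.removeNth]
    omega
  · have hv := val_succAbove_eq j k
    have : j.succAbove k ≤ i := by
      rw [Fin.le_def, hv]
      split_ifs at hq ⊢ <;> omega
    have := hα.antitone this
    simp only [Fin.removeNth]
    omega
  · have hv := val_succAbove_eq j k
    have : i < j.succAbove k := by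
      rw [Fin.lt_def, hv]
      split_ifs at hq ⊢ <;> omega
    have := hα this
    simp only [Fin.removeNth]
    omega
  · rw [hDet_update_eq_insertNth h i p, hDet_update_eq_insertNth h j q, mul_mul_mul_comm,
      ← pow_add, hpq.neg_one_pow, one_mul]

theorem exists_antitone_hDet_cons_mul (h : ℤ → R) {m : ℕ} {α : Fin (m + 1) → ℤ}
    (hα : StrictAnti α) (j : Fin (m + 1)) :
    ∃ (β : Fin (m + 2) → ℤ) (γ : Fin m → ℤ), Antitone β ∧ Antitone γ ∧
      (-1) ^ (j : ℕ) * hDet h (Fin.cons (α j) fun i => α i - 1 : Fin (m + 2) → ℤ) *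
        hDet h (fun i => j.removeNth α i + 1) = hDet h β * hDet h γ := by
  refine ⟨j.castSucc.insertNth (α j) fun i => α i - 1, fun i => j.removeNth α i + 1,
    antitone_insertNth (fun a b hab => ?_) (fun k hk => ?_) (fun k hk => ?_),
    fun a b hab => ?_, ?_⟩
  · have := hα.antitone hab
    omega
  · have := hα (show k < j from hk)
    omega
  · have := hα.antitone (show j ≤ k from hk)
    omega
  · have := hα.antitone ((Fin.strictMono_succAbove j).monotone hab)
    simp only [Fin.removeNth]
    omega
  · rw [hDet_insertNth]
    rfl

theorem hDet_eq_zero_or_exists_betaSeq {h : ℤ → R} (hneg : ∀ m < 0, h m = 0) {L : ℕ}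
    {β : Fin L → ℤ} (hβ : Antitone β) :
    hDet h β = 0 ∨ ∃ κ : ℕ → ℕ, Antitone κ ∧ (∀ r, L ≤ r → κ r = 0) ∧ β = betaSeq L κ := by
  by_cases hinj : Function.Injective β
  · have hst : StrictAnti β := hβ.strictAnti_of_injective hinj
    have hanti : ∀ a b : Fin L, a ≤ b → β b + (b : ℕ) ≤ β a + (a : ℕ) := by
      rintro ⟨a, ha⟩ ⟨b, hb⟩ hab
      simp only [Fin.mk_le_mk] at hab
      simp only
      induction b, hab using Nat.le_induction with
      | base => exact le_rfl
      | succ b hab ih =>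
        have := hst (show (⟨b, by omega⟩ : Fin L) < ⟨b + 1, hb⟩ by simp)
        have := ih (by omega)
        push_cast
        omega
    by_cases hz : ∃ a : Fin L, β a + (a : ℕ) < 0
    · obtain ⟨a, ha⟩ := hz
      left
      have ha' := a.2
      have hL : L - 1 < L := by omega
      refine Matrix.det_eq_zero_of_row_eq_zero ⟨L - 1, hL⟩ fun c => ?_
      have := hanti a ⟨L - 1, hL⟩ (by rw [Fin.le_def]; simp only; omega)
      have hc := c.2
      rw [Matrix.of_apply]
      apply hneg
      simp only at this
      omega
    · push Not at hz
      refine Or.inr ⟨fun r => if hr : r < L then (β ⟨r, hr⟩ + r).toNat else 0, ?_, ?_, ?_⟩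
      · intro a b hab
        by_cases hb : b < L
        · have := hanti ⟨a, by omega⟩ ⟨b, hb⟩ hab
          simp only [hb, show a < L by omega, dif_pos]
          exact Int.toNat_le_toNat this
        · simp [hb]
      · intro r hr
        simp [not_lt.mpr hr]
      · ext a
        have := hz a
        simp only [betaSeq, a.2, dif_pos]
        rw [Int.toNat_of_nonneg this]
        simp
  · left
    simp only [Function.Injective, not_forall] at hinj
    obtain ⟨a, b, hab, hne⟩ := hinj
    exact Matrix.det_zero_of_row_eq hne (by ext c; simp [hab])

end Pluecker

section SchurPositive

variable {n : ℕ}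

theorem hInt_zero (n : ℕ) : hInt n 0 = 1 := by simp [hInt]

theorem hInt_of_neg (n : ℕ) : ∀ m < 0, hInt n m = 0 := fun m hm => by
  simp [hInt, not_le.mpr hm]

theorem IsPartition.eq_zero_of_partLen_le {κ : ℕ → ℕ} (hκ : IsPartition κ) {r : ℕ}
    (hr : partLen κ ≤ r) : κ r = 0 := by
  obtain ⟨h1, N, hN⟩ := hκ
  have : κ (partLen κ) = 0 := Nat.sInf_mem (s := {N | κ N = 0}) ⟨N, hN N le_rfl⟩
  exact Nat.le_zero.mp (this ▸ h1 hr)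

theorem schur_eq_hDet {κ : ℕ → ℕ} (hκ : Antitone κ) {L : ℕ} (hL : ∀ r, L ≤ r → κ r = 0) :
    schur n κ = hDet (hInt n) (betaSeq L κ) := by
  have hle : partLen κ ≤ L := Nat.sInf_le (hL L le_rfl)
  rw [hDet_betaSeq_eq_of_le (hInt_zero n) (hInt_of_neg n) hle
    fun r hr => IsPartition.eq_zero_of_partLen_le ⟨hκ, L, hL⟩ hr]
  unfold schur hDet betaSeq
  congr 1
  ext1 i j
  simp only [Matrix.of_apply]
  ring_nf

theorem SchurPositive.zero : SchurPositive n 0 := ⟨∅, 0, by simp⟩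

theorem SchurPositive.smul_schur {κ : ℕ → ℕ} (hκ : IsPartition κ) {q : ℚ} (hq : 0 ≤ q) :
    SchurPositive n (q • schur n κ) := ⟨{κ}, fun _ => q, by simp [hκ, hq]⟩

theorem SchurPositive.add {f g : MvPolynomial (Fin n) ℚ} (hf : SchurPositive n f)
    (hg : SchurPositive n g) : SchurPositive n (f + g) := by
  classical
  obtain ⟨S, c, hS, hc, rfl⟩ := hf
  obtain ⟨S', c', hS', hc', rfl⟩ := hg
  refine ⟨S ∪ S', fun μ => (if μ ∈ S then c μ else 0) + if μ ∈ S' then c' μ else 0,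
    fun μ hμ => (Finset.mem_union.mp hμ).elim (hS μ) (hS' μ), fun μ _ => ?_, ?_⟩
  · refine add_nonneg ?_ ?_
    · split_ifs with h
      exacts [hc μ h, le_rfl]
    · split_ifs with h
      exacts [hc' μ h, le_rfl]
  · simp only [add_smul, Finset.sum_add_distrib, ite_smul, zero_smul, Finset.sum_ite_mem,
      Finset.union_inter_cancel_left, Finset.union_inter_cancel_right]

theorem SchurPositive.sum {ι : Type*} (s : Finset ι) {f : ι → MvPolynomial (Fin n) ℚ}
    (hf : ∀ i ∈ s, SchurPositive n (f i)) : SchurPositive n (∑ i ∈ s, f i) :=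
  Finset.sum_induction f (SchurPositive n) (fun _ _ => SchurPositive.add) SchurPositive.zero hf

theorem schurPositive_hDet_betaSeq_mul {M N : ℕ} {μ ν : ℕ → ℕ} (hμ : Antitone μ)
    (hM : ∀ r, M ≤ r → μ r = 0) (hν : Antitone ν) :
    SchurPositive n (hDet (hInt n) (betaSeq M μ) * hDet (hInt n) (betaSeq N ν)) := by
  obtain ⟨S, w, hS, hsum⟩ := hDet_mul_hDet_eq_sum_nonneg (hInt_zero n) (hInt_of_neg n) hμ hM hν
    (le_refl (M + N))
  rw [hDet_betaSeq_eq_of_le (hInt_zero n) (hInt_of_neg n) (show M ≤ M + N + 1 by omega) hM] at hsum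
  rw [hsum]
  refine SchurPositive.sum S fun T hT => ?_
  obtain ⟨hw, hanti, hzero⟩ := hS T hT
  rw [← schur_eq_hDet hanti hzero, ← Int.cast_smul_eq_zsmul ℚ]
  exact SchurPositive.smul_schur ⟨hanti, _, hzero⟩ (Int.cast_nonneg hw)

theorem schurPositive_hDet_mul {M N : ℕ} {β : Fin M → ℤ} {γ : Fin N → ℤ} (hβ : Antitone β)
    (hγ : Antitone γ) : SchurPositive n (hDet (hInt n) β * hDet (hInt n) γ) := by
  rcases hDet_eq_zero_or_exists_betaSeq (hInt_of_neg n) hβ with h | ⟨μ, hμ, hM, rfl⟩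
  · rw [h, zero_mul]
    exact SchurPositive.zero
  rcases hDet_eq_zero_or_exists_betaSeq (hInt_of_neg n) hγ with h | ⟨ν, hν, -, rfl⟩
  · rw [h, mul_zero]
    exact SchurPositive.zero
  exact schurPositive_hDet_betaSeq_mul hμ hM hν

theorem schurPositive_sq_hDet_sub {m : ℕ} {α : Fin (m + 1) → ℤ} (hα : StrictAnti α)
    (i j : Fin (m + 1)) :
    SchurPositive n (hDet (hInt n) α ^ 2 -
      hDet (hInt n) (Function.update α i (α j + 1)) *
        hDet (hInt n) (Function.update α j (α i - 1))) := by
  rw [sq_hDet_eq_sum _ α j, ← Finset.add_sum_erase _ _ (Finset.mem_univ i), add_left_comm,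
    add_sub_cancel_left]
  refine SchurPositive.add ?_ (SchurPositive.sum _ fun k _ => ?_)
  · obtain ⟨β, γ, hβ, hγ, h⟩ := exists_antitone_hDet_cons_mul (hInt n) hα j
    rw [h]
    exact schurPositive_hDet_mul hβ hγ
  · obtain ⟨β, γ, hβ, hγ, h⟩ := exists_antitone_hDet_update_mul (hInt n) hα k j
    rw [h]
    exact schurPositive_hDet_mul hβ hγ

end SchurPositive

/-- for a partition `λ` and a row `j` (indexed from `0`) with
`λ_j > λ_(j+1)`, both `s_{λ_(j)}^2 - s_λ * s_{λ_(j,↑)}` and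
`s_{λ_(j)}^2 - s_λ * s_{λ_(j,←)}` are Schur positive in any number `n ≥ ℓ(λ)` of
variables.  Here `λ_(j)` removes the last cell of row `j`; `λ_(j,↑)` additionally removes
the cell directly above it (it exists iff `j ≥ 1` and `λ_(j-1) = λ_j`, and by convention
`s_{λ_(j,↑)} = 0` otherwise); `λ_(j,←)` removes the last two cells of row `j` (it exists
iff `λ_j - λ_(j+1) > 1`, and by convention `s_{λ_(j,←)} = 0` otherwise). -/
theorem typeII_typeIII_schur_positive (lam : ℕ → ℕ) (hlam : IsPartition lam) (j : ℕ)
    (hj : lam (j + 1) < lam j) (n : ℕ) (hn : partLen lam ≤ n) :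
    SchurPositive n ((schur n fun i => if i = j then lam j - 1 else lam i) ^ 2 -
      schur n lam *
        (if 0 < j ∧ lam (j - 1) = lam j then
          schur n (fun i => if i = j ∨ i + 1 = j then lam j - 1 else lam i) else 0)) ∧
    SchurPositive n ((schur n fun i => if i = j then lam j - 1 else lam i) ^ 2 -
      schur n lam *
        (if lam (j + 1) + 1 < lam j then
          schur n (fun i => if i = j then lam j - 2 else lam i) else 0)) := by
  set κ : ℕ → ℕ := fun i => if i = j then lam j - 1 else lam i with hκ_def
  obtain ⟨m, hm⟩ : ∃ m, partLen lam = m + 1 := by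
    refine Nat.exists_eq_succ_of_ne_zero fun h0 => ?_
    have := hlam.eq_zero_of_partLen_le (r := j) (by omega)
    omega
  have hzero : ∀ r, m + 1 ≤ r → lam r = 0 := fun r hr => hlam.eq_zero_of_partLen_le (hm ▸ hr)
  have hjm : j < m + 1 := by
    by_contra hcon
    have := hzero j (by omega)
    omega
  have hstep : ∀ r, lam (r + 1) ≤ lam r := fun r => hlam.1 (Nat.le_succ r)
  have schur_eq : ∀ {τ : ℕ → ℕ}, (∀ r, τ (r + 1) ≤ τ r) → (∀ r, τ r ≤ lam r) →
      schur n τ = hDet (hInt n) (betaSeq (m + 1) τ) := fun h1 h2 =>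
    schur_eq_hDet (antitone_nat_of_succ_le h1) fun r hr => Nat.le_zero.mp (hzero r hr ▸ h2 r)
  have hκ : ∀ r, κ (r + 1) ≤ κ r := fun r => by
    have := hstep r
    simp only [hκ_def]
    split_ifs <;> subst_vars <;> omega
  have hα := betaSeq_strictAnti (antitone_nat_of_succ_le hκ) (m + 1)
  have hsq : SchurPositive n (schur n κ ^ 2) := by
    rw [schur_eq hκ fun r => by simp only [hκ_def]; split_ifs <;> subst_vars <;> omega, sq]
    exact schurPositive_hDet_mul hα.antitone hα.antitone
  rw [schur_eq hκ fun r => by simp only [hκ_def]; split_ifs <;> subst_vars <;> omega] at hsq ⊢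
  rw [schur_eq hstep fun r => le_rfl]
  constructor
  · split_ifs with h
    · obtain ⟨hj0, hprev⟩ := h
      rw [schur_eq (fun r => ?_) fun r => ?_]
      · convert schurPositive_sq_hDet_sub hα ⟨j - 1, by omega⟩ ⟨j, hjm⟩ using 2
        rw [mul_comm]
        congr 2
        · ext r
          simp only [Function.update_apply, Fin.ext_iff, betaSeq, hκ_def]
          split_ifs <;> subst_vars <;> omega
        · ext r
          simp only [Function.update_apply, Fin.ext_iff, betaSeq, hκ_def]
          split_ifs <;> subst_vars <;> omega
      · have := hstep r
        have hcast : r + 2 = j → lam (r + 1) = lam j := fun h => by rw [← hprev, ← h]; rfl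
        have hcast' : r = j → lam (r + 1) = lam (j + 1) ∧ lam r = lam j := fun h => by simp [h]
        split_ifs <;> omega
      · split_ifs with hr
        · rcases hr with rfl | rfl
          · omega
          · simp at hprev
            omega
        · exact le_rfl
    · simpa using hsq
  · split_ifs with h
    · rw [schur_eq (fun r => ?_) fun r => ?_]
      · convert schurPositive_sq_hDet_sub hα ⟨j, hjm⟩ ⟨j, hjm⟩ using 2
        congr 2
        · ext r
          simp only [Function.update_apply, Fin.ext_iff, betaSeq, hκ_def, if_true]
          split_ifs with hr
          · rw [hr]
            omega
          · rfl
        · ext r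
          simp only [Function.update_apply, Fin.ext_iff, betaSeq, hκ_def, if_true]
          split_ifs with hr
          · rw [hr]
            omega
          · rfl
      · have := hstep r
        split_ifs <;> subst_vars <;> omega
      · split_ifs <;> subst_vars <;> omega
    · simpa using hsq

end
end

section
/- Let k, ℓ ≥ 3, let λ = (k, 1^{ℓ−1}), and set λ_{(1)} = (k−1, 1^{ℓ−1}), λ_{(ℓ)} = (k, 1^{ℓ−2}), λ_{(1,ℓ)} = (k−1, 1^{ℓ−2}). Then for every partition α of 2k + 2ℓ − 4 = 2|λ| − 2 that contains λ and is not equal to (k^2, 2^{ℓ−2}), the Littlewood–Richardson coefficients satisfy c^α_{λ_{(1)}, λ_{(ℓ)}} ≥ c^α_{λ, λ_{(1,ℓ)}}. -/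
noncomputable section

/-- `(i, j)` is a cell of the skew shape `lam / mu` (rows and columns indexed from `0`). -/
def IsCell (lam mu : ℕ → ℕ) (i j : ℕ) : Prop := mu i ≤ j ∧ j < lam i

/-- A Littlewood–Richardson tableau of skew shape `lam / mu` with content `nu`:
a filling of the cells of `lam / mu` with positive integers (`0` outside the shape),
weakly increasing along rows, strictly increasing down columns, with exactly `nu (m - 1)`
entries equal to `m` for each `m ≥ 1`, whose reverse reading word (right to left, top
row to bottom row) is a lattice permutation. -/
structure LRTableau (lam mu nu : ℕ → ℕ) where
  entry : ℕ → ℕ → ℕ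
  pos : ∀ i j, IsCell lam mu i j → 1 ≤ entry i j
  zero : ∀ i j, ¬ IsCell lam mu i j → entry i j = 0
  row_weak : ∀ i j j', j ≤ j' → IsCell lam mu i j → IsCell lam mu i j' →
    entry i j ≤ entry i j'
  col_strict : ∀ i i' j, i < i' → IsCell lam mu i j → IsCell lam mu i' j →
    entry i j < entry i' j
  content : ∀ m, 1 ≤ m →
    Nat.card {p : ℕ × ℕ // IsCell lam mu p.1 p.2 ∧ entry p.1 p.2 = m} = nu (m - 1)
  lattice : ∀ i j m, 1 ≤ m →
    Nat.card {p : ℕ × ℕ // IsCell lam mu p.1 p.2 ∧ entry p.1 p.2 = m + 1 ∧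
        (p.1 < i ∨ (p.1 = i ∧ j ≤ p.2))} ≤
      Nat.card {p : ℕ × ℕ // IsCell lam mu p.1 p.2 ∧ entry p.1 p.2 = m ∧
        (p.1 < i ∨ (p.1 = i ∧ j ≤ p.2))}

/-- The Littlewood–Richardson coefficient `c^{lam}_{mu, nu}`: the number of
Littlewood–Richardson tableaux of shape `lam / mu` with content `nu`. -/
def lrCoeff (lam mu nu : ℕ → ℕ) : ℕ := Nat.card (LRTableau lam mu nu)


/-- The hook partition `(k, 1^(ℓ-1))`. -/
def hookP (k ℓ : ℕ) : ℕ → ℕ := fun i => if i = 0 then k else if i < ℓ then 1 else 0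

/-- `λ_(1) = (k - 1, 1^(ℓ-1))` for the hook `λ = (k, 1^(ℓ-1))`. -/
def hookP1 (k ℓ : ℕ) : ℕ → ℕ := fun i => if i = 0 then k - 1 else if i < ℓ then 1 else 0

/-- `λ_(ℓ) = (k, 1^(ℓ-2))` for the hook `λ = (k, 1^(ℓ-1))`. -/
def hookPL (k ℓ : ℕ) : ℕ → ℕ := fun i => if i = 0 then k else if i < ℓ - 1 then 1 else 0

/-- `λ_(1,ℓ) = (k - 1, 1^(ℓ-2))` for the hook `λ = (k, 1^(ℓ-1))`. -/
def hookP1L (k ℓ : ℕ) : ℕ → ℕ :=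
  fun i => if i = 0 then k - 1 else if i < ℓ - 1 then 1 else 0

open Finset in
/-- The cells of `lam / mu` in the first `N` rows. -/
def skewCells (lam mu : ℕ → ℕ) (N : ℕ) : Finset (ℕ × ℕ) :=
  ((range N).sigma fun i => Ico (mu i) (lam i)).map (Equiv.sigmaEquivProd ℕ ℕ).toEmbedding

theorem card_skewCells (lam mu : ℕ → ℕ) (N : ℕ) :
    (skewCells lam mu N).card = ∑ i ∈ Finset.range N, (lam i - mu i) := by
  simp [skewCells]

theorem mem_skewCells {lam mu : ℕ → ℕ} {N : ℕ} (hN : ∀ i, N ≤ i → lam i = 0) (p : ℕ × ℕ) :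
    p ∈ skewCells lam mu N ↔ IsCell lam mu p.1 p.2 := by
  obtain ⟨i, j⟩ := p
  have h : IsCell lam mu i j → i < N := by
    rintro ⟨_, h2⟩
    by_contra hc
    have := hN i (by omega)
    omega
  simp only [skewCells, Finset.mem_map, Finset.mem_sigma, Finset.mem_range, Finset.mem_Ico,
    Equiv.coe_toEmbedding, Sigma.exists, Equiv.sigmaEquivProd_apply, Prod.mk.injEq]
  constructor
  · rintro ⟨a, b, ⟨_, hab⟩, rfl, rfl⟩
    exact hab
  · intro hc
    exact ⟨i, j, ⟨h hc, hc⟩, rfl, rfl⟩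

theorem finite_isCell_and {lam mu : ℕ → ℕ} (hlam : IsPartition lam) (q : ℕ × ℕ → Prop) :
    Finite {p : ℕ × ℕ // IsCell lam mu p.1 p.2 ∧ q p} := by
  obtain ⟨N, hN⟩ := hlam.2
  refine Set.Finite.subset (skewCells lam mu N).finite_toSet fun p hp => ?_
  exact (mem_skewCells hN p).2 hp.1

/-- The number of elements of `S` smaller than `i`. -/
def rankIn (S : Finset ℕ) (i : ℕ) : ℕ := (S.filter (· < i)).card

theorem rankIn_lt_rankIn {S : Finset ℕ} {i i' : ℕ} (hi : i ∈ S) (h : i < i') :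
    rankIn S i < rankIn S i' := by
  refine Finset.card_lt_card ?_
  rw [Finset.ssubset_iff_of_subset]
  · exact ⟨i, by simp [hi, h], by simp⟩
  · intro x hx
    simp only [Finset.mem_filter] at hx ⊢
    exact ⟨hx.1, hx.2.trans h⟩

theorem rankIn_lt_card {S : Finset ℕ} {i : ℕ} (hi : i ∈ S) : rankIn S i < S.card := by
  refine Finset.card_lt_card ?_
  rw [Finset.ssubset_iff_of_subset (Finset.filter_subset _ _)]
  exact ⟨i, hi, by simp⟩

theorem rankIn_injOn (S : Finset ℕ) : Set.InjOn (rankIn S) S := by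
  intro a ha b hb h
  rcases lt_trichotomy a b with hab | hab | hab
  · have := rankIn_lt_rankIn (Finset.mem_coe.1 ha) hab
    omega
  · exact hab
  · have := rankIn_lt_rankIn (Finset.mem_coe.1 hb) hab
    omega

theorem exists_rankIn_eq {S : Finset ℕ} {r : ℕ} (hr : r < S.card) : ∃ i ∈ S, rankIn S i = r := by
  have him : S.image (rankIn S) = Finset.range S.card := by
    refine Finset.eq_of_subset_of_card_le ?_ ?_
    · intro x hx
      obtain ⟨i, hi, rfl⟩ := Finset.mem_image.1 hx
      exact Finset.mem_range.2 (rankIn_lt_card hi)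
    · rw [Finset.card_image_of_injOn (rankIn_injOn S), Finset.card_range]
  have : r ∈ S.image (rankIn S) := by
    rw [him]
    exact Finset.mem_range.2 hr
  simpa using this

open Classical in
/-- The filling of `lam / mu` by ones, except that the last cells of the rows in `S`
are filled from top to bottom by `2, 3, …`. -/
def rowFilling (lam mu : ℕ → ℕ) (S : Finset ℕ) (i j : ℕ) : ℕ :=
  if IsCell lam mu i j then (if i ∈ S ∧ j + 1 = lam i then rankIn S i + 2 else 1) else 0

/-- `S` is the set of rows ending with an entry larger than one in a Littlewood–Richardson
tableau of shape `lam / mu` with content `(m, 1 ^ n)`. -/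
structure IsHookRowSet (lam mu : ℕ → ℕ) (n : ℕ) (S : Finset ℕ) : Prop where
  nonempty : ∀ i ∈ S, mu i < lam i
  exists_above : ∀ i ∈ S, ∃ i' < i, mu i' < lam i'
  mem_of_overlap : ∀ i, mu i < lam (i + 1) → i + 1 ∈ S
  overlap_le : ∀ i, lam (i + 1) ≤ mu i + 1
  card_eq : S.card = n

section Filling

variable {lam mu : ℕ → ℕ} {n : ℕ} {S : Finset ℕ}

theorem one_le_rowFilling {i j : ℕ} (h : IsCell lam mu i j) : 1 ≤ rowFilling lam mu S i j := by
  unfold rowFilling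
  split_ifs <;> omega

theorem rowFilling_last {i j : ℕ} (h : IsCell lam mu i j) (hi : i ∈ S) (hj : j + 1 = lam i) :
    rowFilling lam mu S i j = rankIn S i + 2 := by
  simp [rowFilling, h, hi, hj]

theorem rowFilling_eq_one {i j : ℕ} (h : IsCell lam mu i j) (hi : ¬ (i ∈ S ∧ j + 1 = lam i)) :
    rowFilling lam mu S i j = 1 := by
  rw [rowFilling, if_pos h, if_neg hi]

theorem rowFilling_eq_add_two_iff {i j r : ℕ} :
    (IsCell lam mu i j ∧ rowFilling lam mu S i j = r + 2) ↔
      IsCell lam mu i j ∧ i ∈ S ∧ j + 1 = lam i ∧ rankIn S i = r := by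
  refine and_congr_right fun h => ?_
  by_cases hc : i ∈ S ∧ j + 1 = lam i
  · rw [rowFilling_last h hc.1 hc.2]
    simp [hc]
  · rw [rowFilling_eq_one h hc]
    constructor
    · omega
    · rintro ⟨h1, h2, _⟩
      exact absurd ⟨h1, h2⟩ hc

theorem IsHookRowSet.isCell_last (hS : IsHookRowSet lam mu n S) {i : ℕ} (hi : i ∈ S) :
    IsCell lam mu i (lam i - 1) := by
  have := hS.nonempty i hi
  constructor <;> omega

theorem IsHookRowSet.rowFilling_col_strict (hmu : Antitone mu)
    (hS : IsHookRowSet lam mu n S) {i i' j : ℕ} (hi : i < i') (h : IsCell lam mu i j)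
    (h' : IsCell lam mu i' j) : rowFilling lam mu S i j < rowFilling lam mu S i' j := by
  obtain ⟨d, rfl⟩ : ∃ d, i' = d + 1 := ⟨i' - 1, by omega⟩
  have h1 : mu d ≤ mu i := hmu (by omega)
  have h2 := h.1
  have h3 := h'.2
  have hmem := hS.mem_of_overlap d (by omega)
  have hle := hS.overlap_le d
  rw [rowFilling_last h' hmem (by omega)]
  by_cases hc : i ∈ S ∧ j + 1 = lam i
  · rw [rowFilling_last h hc.1 hc.2]
    have := rankIn_lt_rankIn hc.1 hi
    omega
  · rw [rowFilling_eq_one h hc]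
    omega

theorem IsHookRowSet.card_eq_add_two (hS : IsHookRowSet lam mu n S) (r : ℕ) :
    Nat.card {p : ℕ × ℕ // IsCell lam mu p.1 p.2 ∧ rowFilling lam mu S p.1 p.2 = r + 2} =
      if r < n then 1 else 0 := by
  split_ifs with hr
  · obtain ⟨i, hi, hri⟩ := exists_rankIn_eq (hS.card_eq.symm ▸ hr : r < S.card)
    rw [Nat.card_eq_one_iff_exists]
    have hlt := hS.nonempty i hi
    have hi1 : lam i - 1 + 1 = lam i := by omega
    refine ⟨⟨(i, lam i - 1), rowFilling_eq_add_two_iff.2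
      ⟨hS.isCell_last hi, hi, hi1, hri⟩⟩, ?_⟩
    rintro ⟨⟨a, b⟩, hab⟩
    obtain ⟨_, ha, hb, hra⟩ := rowFilling_eq_add_two_iff.1 hab
    have : a = i := rankIn_injOn S ha hi (hra.trans hri.symm)
    subst this
    simp only [Subtype.mk.injEq, Prod.mk.injEq, true_and] at hb ⊢
    omega
  · rw [Nat.card_eq_zero]
    left
    constructor
    rintro ⟨⟨a, b⟩, hab⟩
    obtain ⟨_, ha, hb, hra⟩ := rowFilling_eq_add_two_iff.1 hab
    have := rankIn_lt_card ha
    rw [hS.card_eq, hra] at this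
    exact hr this

theorem IsHookRowSet.card_eq_one {N m : ℕ} (hN : ∀ i, N ≤ i → lam i = 0)
    (hsum : ∑ i ∈ Finset.range N, (lam i - mu i) = m + n) (hS : IsHookRowSet lam mu n S) :
    Nat.card {p : ℕ × ℕ // IsCell lam mu p.1 p.2 ∧ rowFilling lam mu S p.1 p.2 = 1} = m := by
  have hsub : S.image (fun i => (i, lam i - 1)) ⊆ skewCells lam mu N := by
    intro p hp
    obtain ⟨i, hi, rfl⟩ := Finset.mem_image.1 hp
    exact (mem_skewCells hN _).2 (hS.isCell_last hi)
  have hcard : (skewCells lam mu N \ S.image (fun i => (i, lam i - 1))).card = m := by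
    rw [Finset.card_sdiff_of_subset hsub, card_skewCells, hsum, Finset.card_image_of_injective,
      hS.card_eq, Nat.add_sub_cancel]
    intro a b h
    exact (Prod.mk.inj h).1
  rw [← hcard, ← Nat.card_eq_finsetCard]
  refine Nat.card_congr (Equiv.subtypeEquivRight ?_)
  rintro ⟨i, j⟩
  rw [Finset.mem_sdiff, mem_skewCells hN]
  refine and_congr_right fun h => ?_
  have h2 : j < lam i := h.2
  simp only [Finset.mem_image, Prod.mk.injEq, not_exists, not_and]
  constructor
  · rintro h1 a ha rfl h3
    rw [rowFilling_last h ha (show j + 1 = lam a by omega)] at h1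
    omega
  · intro h1
    refine rowFilling_eq_one h fun hc => h1 i hc.1 rfl ?_
    omega

theorem IsHookRowSet.rowFilling_lattice (hlam : IsPartition lam) (hS : IsHookRowSet lam mu n S)
    (i j m : ℕ) (hm : 1 ≤ m) :
    Nat.card {p : ℕ × ℕ // IsCell lam mu p.1 p.2 ∧ rowFilling lam mu S p.1 p.2 = m + 1 ∧
        (p.1 < i ∨ (p.1 = i ∧ j ≤ p.2))} ≤
      Nat.card {p : ℕ × ℕ // IsCell lam mu p.1 p.2 ∧ rowFilling lam mu S p.1 p.2 = m ∧
        (p.1 < i ∨ (p.1 = i ∧ j ≤ p.2))} := by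
  have hfin := finite_isCell_and (mu := mu) hlam
    (fun p => rowFilling lam mu S p.1 p.2 = m ∧ (p.1 < i ∨ (p.1 = i ∧ j ≤ p.2)))
  obtain ⟨r, rfl⟩ : ∃ r, m = r + 1 := ⟨m - 1, by omega⟩
  rcases isEmpty_or_nonempty {p : ℕ × ℕ // IsCell lam mu p.1 p.2 ∧
      rowFilling lam mu S p.1 p.2 = r + 1 + 1 ∧ (p.1 < i ∨ (p.1 = i ∧ j ≤ p.2))} with he | hne
  · rw [Nat.card_of_isEmpty]
    exact Nat.zero_le _
  · refine le_trans (b := 1) ?_ ?_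
    · have := finite_isCell_and (mu := mu) hlam
        (fun p => rowFilling lam mu S p.1 p.2 = r + 1 + 1 ∧ (p.1 < i ∨ (p.1 = i ∧ j ≤ p.2)))
      refine Finite.card_le_one_iff_subsingleton.2 ⟨?_⟩
      rintro ⟨⟨a, b⟩, h1, h2, h3⟩ ⟨⟨a', b'⟩, h1', h2', h3'⟩
      obtain ⟨_, ha, hb, hr⟩ := rowFilling_eq_add_two_iff.1 ⟨h1, h2⟩
      obtain ⟨_, ha', hb', hr'⟩ := rowFilling_eq_add_two_iff.1 ⟨h1', h2'⟩
      have : a = a' := rankIn_injOn S ha ha' (hr.trans hr'.symm)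
      subst this
      simp only [Subtype.mk.injEq, Prod.mk.injEq, true_and] at hb hb' ⊢
      omega
    · obtain ⟨⟨⟨a, b⟩, h1, h2, h3⟩⟩ := hne
      obtain ⟨_, ha, hb, hr⟩ := rowFilling_eq_add_two_iff.1 ⟨h1, h2⟩
      dsimp only at ha hb hr h3
      suffices h : ∃ a' b', a' < a ∧ IsCell lam mu a' b' ∧ rowFilling lam mu S a' b' = r + 1 by
        obtain ⟨a', b', hlt, hc, hv⟩ := h
        have : Nonempty {p : ℕ × ℕ // IsCell lam mu p.1 p.2 ∧
            rowFilling lam mu S p.1 p.2 = r + 1 ∧ (p.1 < i ∨ (p.1 = i ∧ j ≤ p.2))} :=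
          ⟨⟨(a', b'), hc, hv, Or.inl (by dsimp only; omega)⟩⟩
        exact Nat.card_pos
      rcases r with _ | r
      · classical
        have hex : ∃ i, mu i < lam i := ⟨a, hS.nonempty a ha⟩
        have hmin : Nat.find hex ∉ S := fun hmem => by
          obtain ⟨i', hi', hc⟩ := hS.exists_above _ hmem
          exact Nat.find_min hex hi' hc
        have hcell : IsCell lam mu (Nat.find hex) (mu (Nat.find hex)) :=
          ⟨le_rfl, Nat.find_spec hex⟩
        refine ⟨Nat.find hex, mu (Nat.find hex), ?_, hcell,
          rowFilling_eq_one hcell fun hc => hmin hc.1⟩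
        refine lt_of_le_of_ne (Nat.find_min' hex (hS.nonempty a ha)) fun h => hmin ?_
        rwa [h]
      · have hlt := rankIn_lt_card ha
        obtain ⟨a', ha', hr'⟩ := exists_rankIn_eq (S := S) (r := r) (by omega)
        have hpos := hS.nonempty a' ha'
        refine ⟨a', lam a' - 1, ?_, rowFilling_eq_add_two_iff.2
          ⟨hS.isCell_last ha', ha', by omega, hr'⟩⟩
        by_contra hc
        rcases (not_lt.1 hc).eq_or_lt with h | h
        · subst h
          omega
        · have := rankIn_lt_rankIn ha h
          omega

/-- The Littlewood–Richardson tableau of hook content determined by its set of rows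
ending with an entry larger than one. -/
def IsHookRowSet.tableau {N m : ℕ} {nu : ℕ → ℕ} (hlam : IsPartition lam) (hmu : Antitone mu)
    (hN : ∀ i, N ≤ i → lam i = 0) (hsum : ∑ i ∈ Finset.range N, (lam i - mu i) = m + n)
    (hnu0 : nu 0 = m) (hnu : ∀ r, nu (r + 1) = if r < n then 1 else 0)
    (hS : IsHookRowSet lam mu n S) : LRTableau lam mu nu where
  entry := rowFilling lam mu S
  pos _ _ h := one_le_rowFilling h
  zero _ _ h := if_neg h
  row_weak i j j' hj h h' := by
    by_cases hc : i ∈ S ∧ j + 1 = lam i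
    · have := h'.2
      obtain rfl : j = j' := by omega
      exact le_rfl
    · rw [rowFilling_eq_one h hc]
      exact one_le_rowFilling h'
  col_strict _ _ _ hi h h' := hS.rowFilling_col_strict hmu hi h h'
  content m hm := by
    obtain ⟨r, rfl⟩ : ∃ r, m = r + 1 := ⟨m - 1, by omega⟩
    rcases r with _ | r
    · exact (hS.card_eq_one hN hsum).trans hnu0.symm
    · exact (hS.card_eq_add_two r).trans (hnu r).symm
  lattice := hS.rowFilling_lattice hlam

end Filling

namespace LRTableau

variable {lam mu nu : ℕ → ℕ} {n : ℕ}

/-- The rows of a tableau which end with an entry larger than one. -/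
def bigRows (T : LRTableau lam mu nu) (N : ℕ) : Finset ℕ :=
  (Finset.range N).filter fun i => 2 ≤ T.entry i (lam i - 1)

theorem isCell_of_entry_pos (T : LRTableau lam mu nu) {i j : ℕ} (h : 1 ≤ T.entry i j) :
    IsCell lam mu i j := by
  by_contra hc
  rw [T.zero i j hc] at h
  omega

theorem isCell_last (T : LRTableau lam mu nu) {i j : ℕ} (h : 1 ≤ T.entry i j) :
    IsCell lam mu i (lam i - 1) := by
  have hc := T.isCell_of_entry_pos h
  have h1 := hc.1
  have h2 := hc.2
  constructor <;> omega

theorem mem_bigRows (T : LRTableau lam mu nu) {N : ℕ} (hN : ∀ i, N ≤ i → lam i = 0) {i : ℕ} :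
    i ∈ T.bigRows N ↔ 2 ≤ T.entry i (lam i - 1) := by
  simp only [bigRows, Finset.mem_filter, Finset.mem_range, and_iff_right_iff_imp]
  intro h
  have := (T.isCell_of_entry_pos (one_le_two.trans h)).2
  by_contra hc
  have := hN i (by omega)
  omega

theorem entry_unique (hlam : IsPartition lam) (T : LRTableau lam mu nu)
    (hnu : ∀ r, nu (r + 1) = if r < n then 1 else 0)
    {i j i' j' : ℕ} (h : 2 ≤ T.entry i j) (heq : T.entry i' j' = T.entry i j) :
    i' = i ∧ j' = j := by
  have hc := T.content (T.entry i j) (by omega)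
  obtain ⟨r, hr⟩ : ∃ r, T.entry i j = r + 2 := ⟨T.entry i j - 2, by omega⟩
  have hp : 1 ≤ T.entry i j := by omega
  have hfin := finite_isCell_and (mu := mu) hlam (fun p => T.entry p.1 p.2 = T.entry i j)
  have hle : nu (T.entry i j - 1) ≤ 1 := by
    rw [show T.entry i j - 1 = r + 1 by omega, hnu]
    split_ifs <;> simp
  rw [← hc, Finite.card_le_one_iff_subsingleton] at hle
  have := congrArg Subtype.val (hle.elim
    ⟨(i', j'), T.isCell_of_entry_pos (heq ▸ hp), heq⟩
    ⟨(i, j), T.isCell_of_entry_pos hp, rfl⟩)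
  exact Prod.mk.inj this

theorem exists_entry_eq (T : LRTableau lam mu nu)
    (hnu : ∀ r, nu (r + 1) = if r < n then 1 else 0) {r : ℕ} (hr : r < n) :
    ∃ i j, T.entry i j = r + 2 := by
  have hc := T.content (r + 2) (by omega)
  rw [show r + 2 - 1 = r + 1 by omega, hnu, if_pos hr] at hc
  obtain ⟨⟨⟨i, j⟩, _, h⟩, _⟩ := Nat.card_eq_one_iff_exists.1 hc
  exact ⟨i, j, h⟩

theorem entry_lt (hlam : IsPartition lam) (T : LRTableau lam mu nu)
    (hnu : ∀ r, nu (r + 1) = if r < n then 1 else 0) {i j r : ℕ}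
    (h : T.entry i j = r + 2) : r < n := by
  have hc := T.content (r + 2) (by omega)
  have hfin := finite_isCell_and (mu := mu) hlam (fun p => T.entry p.1 p.2 = r + 2)
  have hij := T.isCell_of_entry_pos (show 1 ≤ T.entry i j by omega)
  by_contra hr
  rw [show r + 2 - 1 = r + 1 by omega, hnu, if_neg hr, Finite.card_eq_zero_iff] at hc
  exact hc.false ⟨(i, j), hij, h⟩

theorem exists_pred_above (hlam : IsPartition lam) (T : LRTableau lam mu nu) {i j r : ℕ}
    (h : T.entry i j = r + 2) : ∃ i' j', i' < i ∧ T.entry i' j' = r + 1 := by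
  have hl := T.lattice i j (r + 1) (by omega)
  have hfin := finite_isCell_and (mu := mu) hlam
    (fun p => T.entry p.1 p.2 = r + 1 + 1 ∧ (p.1 < i ∨ (p.1 = i ∧ j ≤ p.2)))
  have hij := T.isCell_of_entry_pos (show 1 ≤ T.entry i j by omega)
  have hne : Nonempty {p : ℕ × ℕ // IsCell lam mu p.1 p.2 ∧ T.entry p.1 p.2 = r + 1 + 1 ∧
      (p.1 < i ∨ (p.1 = i ∧ j ≤ p.2))} := ⟨⟨(i, j), hij, h, Or.inr ⟨rfl, le_rfl⟩⟩⟩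
  obtain ⟨⟨⟨⟨i', j'⟩, h1, h2, h3⟩⟩, _⟩ := Nat.card_pos_iff.1 (Nat.card_pos.trans_le hl)
  refine ⟨i', j', ?_, h2⟩
  dsimp only at h1 h2 h3
  rcases h3 with h3 | ⟨rfl, h3⟩
  · exact h3
  · have := T.row_weak _ _ _ h3 hij h1
    omega

theorem row_lt_row (hlam : IsPartition lam) (T : LRTableau lam mu nu)
    (hnu : ∀ r, nu (r + 1) = if r < n then 1 else 0) {i j i' j' : ℕ}
    (h : 2 ≤ T.entry i j) (hlt : T.entry i j < T.entry i' j') : i < i' := by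
  obtain ⟨d, hd⟩ : ∃ d, T.entry i' j' = T.entry i j + d + 1 :=
    ⟨T.entry i' j' - T.entry i j - 1, by omega⟩
  induction d generalizing i' j' with
  | zero =>
    obtain ⟨a, b, ha, hab⟩ := T.exists_pred_above hlam (i := i') (j := j')
      (r := T.entry i j - 1) (by omega)
    have := (T.entry_unique hlam hnu h (i' := a) (j' := b) (by omega)).1
    omega
  | succ d ih =>
    obtain ⟨a, b, ha, hab⟩ := T.exists_pred_above hlam (i := i') (j := j')
      (r := T.entry i j + d) (by omega)
    exact (ih (i' := a) (j' := b) (by omega) (by omega)).trans ha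

theorem eq_last (hlam : IsPartition lam) (T : LRTableau lam mu nu)
    (hnu : ∀ r, nu (r + 1) = if r < n then 1 else 0) {i j : ℕ}
    (h : 2 ≤ T.entry i j) : j + 1 = lam i := by
  have hc := T.isCell_of_entry_pos (one_le_two.trans h)
  have hl := T.isCell_last (one_le_two.trans h)
  have h2 := hc.2
  have hle := T.row_weak i j (lam i - 1) (by omega) hc hl
  rcases hle.eq_or_lt with he | hlt
  · have := (T.entry_unique hlam hnu h he.symm).2
    omega
  · exact absurd (T.row_lt_row hlam hnu h hlt) (lt_irrefl _)

theorem entry_bigRows_lt (hlam : IsPartition lam) (T : LRTableau lam mu nu)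
    (hnu : ∀ r, nu (r + 1) = if r < n then 1 else 0) {i i' : ℕ}
    (h : 2 ≤ T.entry i (lam i - 1)) (h' : 2 ≤ T.entry i' (lam i' - 1)) :
    T.entry i (lam i - 1) < T.entry i' (lam i' - 1) ↔ i < i' := by
  refine ⟨T.row_lt_row hlam hnu h, fun hlt => ?_⟩
  by_contra hc
  rcases (not_lt.1 hc).eq_or_lt with he | hlt'
  · have := (T.entry_unique hlam hnu h he).1
    omega
  · have := T.row_lt_row hlam hnu h' hlt'
    omega

theorem card_filter_bigRows {N : ℕ} (hN : ∀ i, N ≤ i → lam i = 0) (hlam : IsPartition lam)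
    (T : LRTableau lam mu nu) (hnu : ∀ r, nu (r + 1) = if r < n then 1 else 0) {c : ℕ}
    (hc : c ≤ n) :
    ((T.bigRows N).filter fun i => T.entry i (lam i - 1) < c + 2).card = c := by
  rw [← Finset.card_range c]
  refine Finset.card_bij (fun i _ => T.entry i (lam i - 1) - 2) ?_ ?_ ?_
  · intro i hi
    obtain ⟨h1, h2⟩ := Finset.mem_filter.1 hi
    rw [T.mem_bigRows hN] at h1
    rw [Finset.card_range] at h2
    rw [Finset.mem_range]
    omega
  · intro a ha b hb hab
    have h1 := (T.mem_bigRows hN).1 (Finset.mem_filter.1 ha).1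
    have h2 := (T.mem_bigRows hN).1 (Finset.mem_filter.1 hb).1
    exact (T.entry_unique hlam hnu h2 (show T.entry a (lam a - 1) = _ by omega)).1
  · intro r hr
    rw [Finset.mem_range] at hr
    obtain ⟨i, j, hij⟩ := T.exists_entry_eq hnu (hr.trans_le hc)
    have hj := T.eq_last hlam hnu (i := i) (j := j) (by omega)
    obtain rfl : j = lam i - 1 := by omega
    refine ⟨i, Finset.mem_filter.2 ⟨(T.mem_bigRows hN).2 (by omega), ?_⟩, by omega⟩
    rw [Finset.card_range]
    omega

theorem entry_eq_rowFilling {N : ℕ} (hN : ∀ i, N ≤ i → lam i = 0) (hlam : IsPartition lam)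
    (T : LRTableau lam mu nu) (hnu : ∀ r, nu (r + 1) = if r < n then 1 else 0) (i j : ℕ) :
    T.entry i j = rowFilling lam mu (T.bigRows N) i j := by
  by_cases hc : IsCell lam mu i j
  · by_cases hi : i ∈ T.bigRows N ∧ j + 1 = lam i
    · rw [rowFilling_last hc hi.1 hi.2]
      obtain rfl : j = lam i - 1 := by omega
      have h2 := (T.mem_bigRows hN).1 hi.1
      obtain ⟨r, hr⟩ : ∃ r, T.entry i (lam i - 1) = r + 2 :=
        ⟨T.entry i (lam i - 1) - 2, by omega⟩
      have hcard := T.card_filter_bigRows hN hlam hnu (T.entry_lt hlam hnu hr).le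
      rw [hr, Nat.add_right_cancel_iff, ← hcard, rankIn]
      congr 1
      refine Finset.filter_congr fun a ha => ?_
      rw [← hr]
      exact T.entry_bigRows_lt hlam hnu ((T.mem_bigRows hN).1 ha) h2
    · rw [rowFilling_eq_one hc hi]
      have h1 := T.pos i j hc
      by_contra hne
      have hj := T.eq_last hlam hnu (i := i) (j := j) (by omega)
      obtain rfl : j = lam i - 1 := by omega
      exact hi ⟨(T.mem_bigRows hN).2 (by omega), hj⟩
  · rw [T.zero i j hc, rowFilling, if_neg hc]

theorem isHookRowSet_bigRows {N : ℕ} (hN : ∀ i, N ≤ i → lam i = 0) (hlam : IsPartition lam)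
    (hmu : Antitone mu) (T : LRTableau lam mu nu)
    (hnu : ∀ r, nu (r + 1) = if r < n then 1 else 0) :
    IsHookRowSet lam mu n (T.bigRows N) := by
  have hover : ∀ i j, mu i ≤ j → j < lam (i + 1) → 2 ≤ T.entry (i + 1) j := by
    intro i j h1 h2
    have h3 := hlam.1 (Nat.le_succ i)
    have hc : IsCell lam mu i j := ⟨h1, h2.trans_le h3⟩
    have hc' : IsCell lam mu (i + 1) j := ⟨(hmu (Nat.le_succ i)).trans h1, h2⟩
    have := T.col_strict i (i + 1) j (Nat.lt_succ_self i) hc hc'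
    have := T.pos i j hc
    omega
  refine ⟨?_, ?_, ?_, ?_, ?_⟩
  · intro i hi
    have hc := T.isCell_of_entry_pos (one_le_two.trans ((T.mem_bigRows hN).1 hi))
    exact hc.1.trans_lt hc.2
  · intro i hi
    rw [T.mem_bigRows hN] at hi
    obtain ⟨a, b, hai, hab⟩ := T.exists_pred_above hlam (i := i) (j := lam i - 1)
      (r := T.entry i (lam i - 1) - 2) (by omega)
    have hc := T.isCell_of_entry_pos (i := a) (j := b) (by omega)
    exact ⟨a, hai, hc.1.trans_lt hc.2⟩
  · intro i hi
    rw [T.mem_bigRows hN]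
    exact hover i _ (by omega) (by omega)
  · intro i
    by_contra hc
    have := T.eq_last hlam hnu (hover i (mu i) le_rfl (by omega))
    omega
  · have h := T.card_filter_bigRows hN hlam hnu (le_refl n)
    rwa [Finset.filter_true_of_mem] at h
    intro i hi
    rw [T.mem_bigRows hN] at hi
    have := T.entry_lt hlam hnu (i := i) (j := lam i - 1)
      (r := T.entry i (lam i - 1) - 2) (by omega)
    omega

theorem entry_injective : Function.Injective (entry : LRTableau lam mu nu → ℕ → ℕ → ℕ) := by
  rintro ⟨⟩ ⟨⟩ h
  simpa using h

end LRTableau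

/-- A Littlewood–Richardson coefficient of hook content counts the admissible row sets. -/
theorem lrCoeff_eq_card_isHookRowSet {lam mu nu : ℕ → ℕ} {m n N : ℕ} (hlam : IsPartition lam)
    (hmu : Antitone mu) (hN : ∀ i, N ≤ i → lam i = 0)
    (hsum : ∑ i ∈ Finset.range N, (lam i - mu i) = m + n)
    (hnu0 : nu 0 = m) (hnu : ∀ r, nu (r + 1) = if r < n then 1 else 0) :
    lrCoeff lam mu nu = Nat.card {S : Finset ℕ // IsHookRowSet lam mu n S} := by
  refine Nat.card_congr (Equiv.ofBijective
    (fun T => ⟨T.bigRows N, T.isHookRowSet_bigRows hN hlam hmu hnu⟩) ⟨?_, ?_⟩)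
  · intro T T' h
    have h' : T.bigRows N = T'.bigRows N := congrArg Subtype.val h
    apply LRTableau.entry_injective
    funext i j
    rw [T.entry_eq_rowFilling hN hlam hnu, T'.entry_eq_rowFilling hN hlam hnu, h']
  · rintro ⟨S, hS⟩
    refine ⟨hS.tableau hlam hmu hN hsum hnu0 hnu, Subtype.ext ?_⟩
    ext i
    rw [LRTableau.mem_bigRows _ hN]
    change 2 ≤ rowFilling lam mu S i (lam i - 1) ↔ i ∈ S
    constructor
    · intro h
      by_contra hi
      unfold rowFilling at h
      split_ifs at h with h1 h2
      · exact hi h2.1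
      all_goals omega
    · intro hi
      have := hS.nonempty i hi
      rw [rowFilling_last (hS.isCell_last hi) hi (by omega)]
      omega

theorem hookP_zero (k ℓ : ℕ) : hookP k ℓ 0 = k := rfl

theorem hookP_of_lt {k ℓ i : ℕ} (h0 : 0 < i) (h : i < ℓ) : hookP k ℓ i = 1 := by
  rw [hookP, if_neg h0.ne', if_pos h]

theorem hookP_of_le {k ℓ i : ℕ} (h0 : 0 < i) (h : ℓ ≤ i) : hookP k ℓ i = 0 := by
  rw [hookP, if_neg h0.ne', if_neg h.not_gt]

theorem hookP_of_pos (k k' ℓ : ℕ) {i : ℕ} (h0 : 0 < i) : hookP k ℓ i = hookP k' ℓ i := by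
  rw [hookP, hookP, if_neg h0.ne', if_neg h0.ne']

theorem hookP_antitone {k : ℕ} (ℓ : ℕ) (hk : 1 ≤ k) : Antitone (hookP k ℓ) := by
  refine antitone_nat_of_succ_le fun i => ?_
  simp only [hookP, if_neg i.succ_ne_zero]
  split_ifs <;> omega

theorem sum_hookP {k ℓ N : ℕ} (hℓ : 1 ≤ ℓ) (hN : ℓ ≤ N) :
    ∑ i ∈ Finset.range N, hookP k ℓ i = k + (ℓ - 1) := by
  induction N, hN using Nat.le_induction with
  | base =>
    obtain ⟨ℓ, rfl⟩ : ∃ r, ℓ = r + 1 := ⟨ℓ - 1, by omega⟩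
    rw [Finset.sum_range_succ', hookP_zero, Finset.sum_congr rfl (g := fun _ => 1)]
    · simp [add_comm]
    · intro i hi
      exact hookP_of_lt (Nat.succ_pos i) (by simpa using hi)
  | succ N hN ih =>
    rw [Finset.sum_range_succ, ih, hookP_of_le (by omega) hN, add_zero]

theorem lrCoeff_hookP {k k' ℓ ℓ' N : ℕ} {α : ℕ → ℕ} (hα : IsPartition α) (hk : 1 ≤ k)
    (hℓ' : 1 ≤ ℓ') (hN : ∀ i, N ≤ i → α i = 0)
    (hsum : ∑ i ∈ Finset.range N, (α i - hookP k ℓ i) = k' + (ℓ' - 1)) :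
    lrCoeff α (hookP k ℓ) (hookP k' ℓ') =
      Nat.card {S : Finset ℕ // IsHookRowSet α (hookP k ℓ) (ℓ' - 1) S} := by
  refine lrCoeff_eq_card_isHookRowSet hα (hookP_antitone ℓ hk) hN hsum rfl fun r => ?_
  simp only [hookP, if_neg r.succ_ne_zero]
  split_ifs <;> omega

theorem IsHookRowSet.subset_range {lam mu : ℕ → ℕ} {n N : ℕ} {S : Finset ℕ}
    (hS : IsHookRowSet lam mu n S) (hN : ∀ i, N ≤ i → lam i = 0) : S ⊆ Finset.range N := by
  intro i hi
  have := hS.nonempty i hi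
  rw [Finset.mem_range]
  by_contra hc
  have := hN i (by omega)
  omega

theorem IsHookRowSet.pos_of_mem {lam mu : ℕ → ℕ} {n i : ℕ} {S : Finset ℕ}
    (hS : IsHookRowSet lam mu n S) (hi : i ∈ S) : 0 < i := by
  obtain ⟨i', hlt, _⟩ := hS.exists_above i hi
  omega

theorem IsHookRowSet.erase_one_subset {lam mu : ℕ → ℕ} {n N : ℕ} {S : Finset ℕ}
    (hS : IsHookRowSet lam mu n S) (hN : ∀ i, N ≤ i → lam i = 0) :
    S.erase 1 ⊆ Finset.Ico 2 N := by
  intro i hi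
  obtain ⟨h1, h2⟩ := Finset.mem_erase.1 hi
  have := hS.pos_of_mem h2
  have := Finset.mem_range.1 (hS.subset_range hN h2)
  rw [Finset.mem_Ico]
  omega

theorem IsHookRowSet.card_erase_one_le {lam mu : ℕ → ℕ} {n N : ℕ} {S : Finset ℕ}
    (hS : IsHookRowSet lam mu n S) (hN : ∀ i, N ≤ i → lam i = 0) :
    (S.erase 1).card ≤ ∑ i ∈ Finset.Ico 2 N, (lam i - mu i) := by
  refine le_trans ?_ (Finset.sum_le_sum_of_subset (hS.erase_one_subset hN))
  rw [Finset.card_eq_sum_ones]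
  refine Finset.sum_le_sum fun i hi => ?_
  have := hS.nonempty i (Finset.mem_of_mem_erase hi)
  omega

section Comparison

variable {k ℓ N : ℕ} {α : ℕ → ℕ} {S : Finset ℕ}

theorem IsHookRowSet.second_row_le (hα : IsPartition α) (hN : ∀ i, N ≤ i → α i = 0)
    (hrest : ∑ i ∈ Finset.Ico 2 N, (α i - hookP k ℓ i) + α 0 + α 1 = 2 * k + ℓ - 2)
    (hℓ : 3 ≤ ℓ) (hS : IsHookRowSet α (hookP k ℓ) (ℓ - 2) S) :
    α 1 ≤ k := by
  by_contra hc
  have hmem := hS.mem_of_overlap 0 (by rw [hookP_zero, zero_add]; omega)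
  have hle := hS.card_erase_one_le hN
  rw [Finset.card_erase_of_mem hmem, hS.card_eq] at hle
  have h01 : α 1 ≤ α 0 := hα.1 zero_le_one
  omega

theorem IsHookRowSet.one_mem (hN : ∀ i, N ≤ i → α i = 0)
    (hrest : ∑ i ∈ Finset.Ico 2 N, (α i - hookP k ℓ i) + α 0 + α 1 = 2 * k + ℓ - 2)
    (hℓ : 3 ≤ ℓ) (hS : IsHookRowSet α (hookP k ℓ) (ℓ - 2) S)
    (h0 : k < α 0) (h1 : α 1 = k) : 1 ∈ S := by
  by_contra hc
  have hle := hS.card_erase_one_le hN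
  rw [Finset.erase_eq_of_notMem hc, hS.card_eq] at hle
  omega

/-- Away from `α 0 = α 1 = k`, shrinking the first row of the inner hook keeps row sets
admissible. -/
theorem IsHookRowSet.shrink_row (hα : IsPartition α) (hN : ∀ i, N ≤ i → α i = 0)
    (hrest : ∑ i ∈ Finset.Ico 2 N, (α i - hookP k ℓ i) + α 0 + α 1 = 2 * k + ℓ - 2)
    (hk : 1 ≤ k) (hℓ : 3 ≤ ℓ) (h0 : k ≤ α 0) (hne : ¬ (α 0 = k ∧ α 1 = k))
    (hS : IsHookRowSet α (hookP k ℓ) (ℓ - 2) S) :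
    IsHookRowSet α (hookP (k - 1) ℓ) (ℓ - 2) S := by
  have h1 := hS.second_row_le hα hN hrest hℓ
  refine ⟨?_, ?_, ?_, ?_, hS.card_eq⟩
  · intro i hi
    rw [hookP_of_pos (k - 1) k ℓ (hS.pos_of_mem hi)]
    exact hS.nonempty i hi
  · intro i hi
    exact ⟨0, hS.pos_of_mem hi, by rw [hookP_zero]; omega⟩
  · intro i hi
    rcases i.eq_zero_or_pos with rfl | hpos
    · rw [hookP_zero, zero_add] at hi
      exact hS.one_mem hN hrest hℓ (by omega) (by omega)
    · rw [hookP_of_pos (k - 1) k ℓ hpos] at hi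
      exact hS.mem_of_overlap i hi
  · intro i
    rcases i.eq_zero_or_pos with rfl | hpos
    · rw [hookP_zero, zero_add]
      omega
    · rw [hookP_of_pos (k - 1) k ℓ hpos]
      exact hS.overlap_le i

theorem IsHookRowSet.one_notMem (hS : IsHookRowSet α (hookP k ℓ) (ℓ - 2) S)
    (h0 : α 0 = k) : 1 ∉ S := by
  intro h
  obtain ⟨i, hi, hlt⟩ := hS.exists_above 1 h
  obtain rfl : i = 0 := by omega
  rw [hookP_zero] at hlt
  omega

theorem IsHookRowSet.sub_eq_ite (hN : ∀ i, N ≤ i → α i = 0)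
    (hrest : ∑ i ∈ Finset.Ico 2 N, (α i - hookP k ℓ i) + α 0 + α 1 = 2 * k + ℓ - 2)
    (hℓ : 3 ≤ ℓ) (hS : IsHookRowSet α (hookP k ℓ) (ℓ - 2) S)
    (h0 : α 0 = k) (h1 : α 1 = k) {i : ℕ} (hi : 2 ≤ i) :
    α i - hookP k ℓ i = if i ∈ S then 1 else 0 := by
  by_cases hiN : i < N
  · have hsub := hS.erase_one_subset hN
    rw [Finset.erase_eq_of_notMem (hS.one_notMem h0)] at hsub
    have hsum : ∑ i ∈ Finset.Ico 2 N, (if i ∈ S then 1 else 0) =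
        ∑ i ∈ Finset.Ico 2 N, (α i - hookP k ℓ i) := by
      rw [Finset.sum_ite_mem, Finset.inter_eq_right.2 hsub, ← Finset.card_eq_sum_ones,
        hS.card_eq]
      omega
    refine ((Finset.sum_eq_sum_iff_of_le fun j _ => ?_).1 hsum i
      (Finset.mem_Ico.2 ⟨hi, hiN⟩)).symm
    split_ifs with hj
    · have := hS.nonempty j hj
      omega
    · exact Nat.zero_le _
  · rw [hN i (by omega), if_neg fun h => hiN (Finset.mem_range.1 (hS.subset_range hN h)),
      Nat.zero_sub]

theorem IsHookRowSet.length_mem (hα : IsPartition α) (hN : ∀ i, N ≤ i → α i = 0)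
    (hrest : ∑ i ∈ Finset.Ico 2 N, (α i - hookP k ℓ i) + α 0 + α 1 = 2 * k + ℓ - 2)
    (hℓ : 3 ≤ ℓ)
    (hne : α ≠ fun i => if i < 2 then k else if i < ℓ then 2 else 0)
    (hS : IsHookRowSet α (hookP k ℓ) (ℓ - 2) S) (h0 : α 0 = k) (h1 : α 1 = k) : ℓ ∈ S := by
  by_contra hmem
  have hzero : ∀ i, ℓ ≤ i → α i = 0 := by
    intro i hi
    have h := hS.sub_eq_ite hN hrest hℓ h0 h1 (i := ℓ) (by omega)
    rw [if_neg hmem, hookP_of_le (by omega) le_rfl] at h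
    have := hα.1 hi
    omega
  have hsub := hS.erase_one_subset hzero
  rw [Finset.erase_eq_of_notMem (hS.one_notMem h0)] at hsub
  have hSeq : S = Finset.Ico 2 ℓ :=
    Finset.eq_of_subset_of_card_le hsub (by rw [hS.card_eq, Nat.card_Ico])
  refine hne (funext fun i => ?_)
  split_ifs with hi2 hiℓ
  · interval_cases i
    · exact h0
    · exact h1
  · have h := hS.sub_eq_ite hN hrest hℓ h0 h1 (i := i) (by omega)
    have hi : i ∈ S := by
      rw [hSeq, Finset.mem_Ico]
      omega
    rw [if_pos hi, hookP_of_lt (by omega) hiℓ] at h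
    omega
  · exact hzero i (by omega)

/-- For `α 0 = α 1 = k`, shrinking the first row of the inner hook forces row `1` into the
row set, and row `ℓ` is given up for it. -/
theorem IsHookRowSet.swap_row (hN : ∀ i, N ≤ i → α i = 0)
    (hrest : ∑ i ∈ Finset.Ico 2 N, (α i - hookP k ℓ i) + α 0 + α 1 = 2 * k + ℓ - 2)
    (hk : 2 ≤ k) (hℓ : 3 ≤ ℓ)
    (hS : IsHookRowSet α (hookP k ℓ) (ℓ - 2) S) (h0 : α 0 = k) (h1 : α 1 = k) (hmem : ℓ ∈ S) :
    IsHookRowSet α (hookP (k - 1) ℓ) (ℓ - 2) (insert 1 (S.erase ℓ)) := by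
  have hpos : ∀ i ∈ insert 1 (S.erase ℓ), 0 < i := by
    intro i hi
    rcases Finset.mem_insert.1 hi with rfl | hi
    · exact one_pos
    · exact hS.pos_of_mem (Finset.mem_of_mem_erase hi)
  refine ⟨?_, ?_, ?_, ?_, ?_⟩
  · intro i hi
    rw [hookP_of_pos (k - 1) k ℓ (hpos i hi)]
    rcases Finset.mem_insert.1 hi with rfl | hi
    · rw [hookP_of_lt one_pos (by omega)]
      omega
    · exact hS.nonempty i (Finset.mem_of_mem_erase hi)
  · intro i hi
    exact ⟨0, hpos i hi, by rw [hookP_zero]; omega⟩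
  · intro i hi
    rcases i.eq_zero_or_pos with rfl | hi0
    · exact Finset.mem_insert_self _ _
    · rw [hookP_of_pos (k - 1) k ℓ hi0] at hi
      refine Finset.mem_insert_of_mem (Finset.mem_erase.2 ⟨?_, hS.mem_of_overlap i hi⟩)
      rintro rfl
      have h := hS.sub_eq_ite hN hrest hℓ h0 h1 (i := i + 1) (by omega)
      rw [if_pos hmem, hookP_of_le (by omega) le_rfl] at h
      rw [hookP_of_lt hi0 (by omega)] at hi
      omega
  · intro i
    rcases i.eq_zero_or_pos with rfl | hi0
    · rw [hookP_zero, zero_add]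
      omega
    · rw [hookP_of_pos (k - 1) k ℓ hi0]
      exact hS.overlap_le i
  · rw [Finset.card_insert_of_notMem
      (fun h => hS.one_notMem h0 (Finset.mem_of_mem_erase h)), Finset.card_erase_of_mem hmem,
      hS.card_eq]
    omega

theorem card_isHookRowSet_le (hα : IsPartition α) (hN : ∀ i, N ≤ i → α i = 0)
    (hrest : ∑ i ∈ Finset.Ico 2 N, (α i - hookP k ℓ i) + α 0 + α 1 = 2 * k + ℓ - 2)
    (hk : 2 ≤ k) (hℓ : 3 ≤ ℓ) (hcont : ∀ i, hookP k ℓ i ≤ α i)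
    (hne : α ≠ fun i => if i < 2 then k else if i < ℓ then 2 else 0) :
    Nat.card {S : Finset ℕ // IsHookRowSet α (hookP k ℓ) (ℓ - 2) S} ≤
      Nat.card {S : Finset ℕ // IsHookRowSet α (hookP (k - 1) ℓ) (ℓ - 2) S} := by
  have hfin : Finite {S : Finset ℕ // IsHookRowSet α (hookP (k - 1) ℓ) (ℓ - 2) S} := by
    refine Set.Finite.subset (Finset.range N).powerset.finite_toSet fun S hS => ?_
    exact Finset.mem_coe.2 (Finset.mem_powerset.2 (IsHookRowSet.subset_range hS hN))
  by_cases h : α 0 = k ∧ α 1 = k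
  · obtain ⟨h0, h1⟩ := h
    have hmem : ∀ S, IsHookRowSet α (hookP k ℓ) (ℓ - 2) S → ℓ ∈ S := fun S hS =>
      hS.length_mem hα hN hrest hℓ hne h0 h1
    refine Nat.card_le_card_of_injective
      (fun S => ⟨insert 1 (S.1.erase ℓ),
        S.2.swap_row hN hrest hk hℓ h0 h1 (hmem S.1 S.2)⟩) ?_
    rintro ⟨S, hS⟩ ⟨S', hS'⟩ heq
    have heq' : insert 1 (S.erase ℓ) = insert 1 (S'.erase ℓ) := congrArg Subtype.val heq
    have hrec : ∀ S, IsHookRowSet α (hookP k ℓ) (ℓ - 2) S →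
        insert ℓ ((insert 1 (S.erase ℓ)).erase 1) = S := by
      intro S hS
      rw [Finset.erase_insert fun h => hS.one_notMem h0 (Finset.mem_of_mem_erase h),
        Finset.insert_erase (hmem S hS)]
    exact Subtype.ext ((hrec S hS).symm.trans (heq' ▸ hrec S' hS'))
  · have h0 := hcont 0
    rw [hookP_zero] at h0
    refine Nat.card_le_card_of_injective
      (fun S => ⟨S.1, S.2.shrink_row hα hN hrest (by omega) hℓ h0 h⟩) ?_
    intro S S' heq
    exact Subtype.ext (Subtype.mk.inj heq)

end Comparison

/-- for the hook `λ = (k, 1^(ℓ-1))` with `k, ℓ ≥ 3` and any partition `α` of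
`2k + 2ℓ - 4 = 2|λ| - 2` containing `λ` and different from `(k^2, 2^(ℓ-2))`, we have
`c^α_{λ_(1), λ_(ℓ)} ≥ c^α_{λ, λ_(1,ℓ)}`. -/
theorem hook_lr_inequality (k ℓ : ℕ) (hk : 3 ≤ k) (hℓ : 3 ≤ ℓ) (α : ℕ → ℕ)
    (hα : IsPartition α) (hsize : ∑ᶠ i, α i = 2 * k + 2 * ℓ - 4)
    (hcont : ∀ i, hookP k ℓ i ≤ α i)
    (hne : α ≠ fun i => if i < 2 then k else if i < ℓ then 2 else 0) :
    lrCoeff α (hookP k ℓ) (hookP1L k ℓ) ≤ lrCoeff α (hookP1 k ℓ) (hookPL k ℓ) := by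
  obtain ⟨N, hN⟩ := hα.2
  have hℓN : ℓ ≤ N := by
    by_contra hlt
    have h1 := hcont (ℓ - 1)
    rw [hookP_of_lt (by omega) (by omega), hN (ℓ - 1) (by omega)] at h1
    omega
  have hsum : ∑ i ∈ Finset.range N, α i = 2 * k + 2 * ℓ - 4 := by
    rw [← hsize]
    refine (finsum_eq_sum_of_support_subset _ fun i hi => ?_).symm
    rw [Finset.mem_coe, Finset.mem_range]
    by_contra hc
    exact hi (hN i (by omega))
  have hcont' : ∀ i, hookP (k - 1) ℓ i ≤ α i := by
    intro i
    refine le_trans ?_ (hcont i)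
    unfold hookP
    split_ifs <;> omega
  have hsum1 : ∑ i ∈ Finset.range N, (α i - hookP k ℓ i) = k + ℓ - 3 := by
    rw [Finset.sum_tsub_distrib _ fun i _ => hcont i, hsum, sum_hookP (by omega) hℓN]
    omega
  have hsum2 : ∑ i ∈ Finset.range N, (α i - hookP (k - 1) ℓ i) = k + ℓ - 2 := by
    rw [Finset.sum_tsub_distrib _ fun i _ => hcont' i, hsum, sum_hookP (by omega) hℓN]
    omega
  have hrest : ∑ i ∈ Finset.Ico 2 N, (α i - hookP k ℓ i) + α 0 + α 1 = 2 * k + ℓ - 2 := by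
    have h0 := hcont 0
    have h1 := hcont 1
    rw [← Finset.sum_range_add_sum_Ico _ (show 2 ≤ N by omega), Finset.sum_range_succ,
      Finset.sum_range_one, hookP_of_lt one_pos (by omega), hookP_zero] at hsum1
    rw [hookP_zero] at h0
    rw [hookP_of_lt one_pos (by omega)] at h1
    omega
  have hL : lrCoeff α (hookP k ℓ) (hookP1L k ℓ) = _ :=
    lrCoeff_hookP (k' := k - 1) (ℓ' := ℓ - 1) hα (by omega) (by omega) hN
      (by rw [hsum1]; omega)
  have hR : lrCoeff α (hookP1 k ℓ) (hookPL k ℓ) = _ :=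
    lrCoeff_hookP (k := k - 1) (k' := k) (ℓ' := ℓ - 1) hα (by omega) (by omega) hN
      (by rw [hsum2]; omega)
  rw [hL, hR]
  exact card_isHookRowSet_le hα hN hrest (by omega) hℓ hcont hne

end
end

section
/- Let k, ℓ ≥ 3, let λ = (k, 1^{ℓ−1}), and set λ_{(1)} = (k−1, 1^{ℓ−1}), λ_{(ℓ)} = (k, 1^{ℓ−2}), λ_{(1,ℓ)} = (k−1, 1^{ℓ−2}), λ_{(ℓ,↑)} = (k, 1^{ℓ−3}), λ_{(1,←)} = (k−2, 1^{ℓ−1}). Let β = (k^2, 2^{ℓ−2}). Then the Littlewood–Richardson coefficients are: c^β_{λ_{(1)}, λ_{(ℓ)}} = 0, c^β_{λ_{(ℓ)}, λ_{(ℓ)}} = 1, c^β_{λ_{(1)}, λ_{(1)}} = 1, c^β_{λ, λ_{(1,ℓ)}} = 1, c^β_{λ, λ_{(ℓ,↑)}} = 0, and c^β_{λ, λ_{(1,←)}} = 0. -/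
noncomputable section

/-- `λ_(ℓ,↑) = (k, 1^(ℓ-3))` for the hook `λ = (k, 1^(ℓ-1))`. -/
def hookPUp (k ℓ : ℕ) : ℕ → ℕ := fun i => if i = 0 then k else if i < ℓ - 2 then 1 else 0

/-- `λ_(1,←) = (k - 2, 1^(ℓ-1))` for the hook `λ = (k, 1^(ℓ-1))`. -/
def hookPLeft (k ℓ : ℕ) : ℕ → ℕ :=
  fun i => if i = 0 then k - 2 else if i < ℓ then 1 else 0

namespace LRTableau

variable {lam mu nu : ℕ → ℕ}

@[ext] theorem ext {T U : LRTableau lam mu nu}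
    (h : ∀ i j, IsCell lam mu i j → T.entry i j = U.entry i j) : T = U := by
  have hentry : T.entry = U.entry := by
    funext i j
    by_cases hc : IsCell lam mu i j
    · exact h i j hc
    · rw [T.zero i j hc, U.zero i j hc]
  cases T
  cases U
  cases hentry
  rfl

/-- In the reading word, every letter `m + 1 ≥ 2` is preceded by a letter `m`. -/
theorem exists_pred (T : LRTableau lam mu nu)
    (hfin : {p : ℕ × ℕ | IsCell lam mu p.1 p.2}.Finite) {i j m : ℕ} (hm : 1 ≤ m)
    (hc : IsCell lam mu i j) (he : T.entry i j = m + 1) :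
    ∃ i' j', IsCell lam mu i' j' ∧ T.entry i' j' = m ∧ (i' < i ∨ (i' = i ∧ j ≤ j')) := by
  have hle := T.lattice i j m hm
  have : Finite {p : ℕ × ℕ // IsCell lam mu p.1 p.2 ∧ T.entry p.1 p.2 = m + 1 ∧
      (p.1 < i ∨ (p.1 = i ∧ j ≤ p.2))} := hfin.subset fun p hp => hp.1
  have : Nonempty {p : ℕ × ℕ // IsCell lam mu p.1 p.2 ∧ T.entry p.1 p.2 = m + 1 ∧
      (p.1 < i ∨ (p.1 = i ∧ j ≤ p.2))} := ⟨⟨(i, j), hc, he, Or.inr ⟨rfl, le_rfl⟩⟩⟩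
  obtain ⟨⟨⟨⟨i', j'⟩, h⟩⟩, -⟩ := Nat.card_pos_iff.1 (Nat.card_pos.trans_le hle)
  exact ⟨i', j', h⟩

theorem content_entry_ne_zero (T : LRTableau lam mu nu)
    (hfin : {p : ℕ × ℕ | IsCell lam mu p.1 p.2}.Finite) {i j : ℕ}
    (hc : IsCell lam mu i j) : nu (T.entry i j - 1) ≠ 0 := by
  rw [← T.content _ (T.pos i j hc)]
  have : Finite {p : ℕ × ℕ // IsCell lam mu p.1 p.2 ∧ T.entry p.1 p.2 = T.entry i j} :=
    hfin.subset fun p hp => hp.1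
  have : Nonempty {p : ℕ × ℕ // IsCell lam mu p.1 p.2 ∧ T.entry p.1 p.2 = T.entry i j} :=
    ⟨⟨(i, j), hc, rfl⟩⟩
  exact Nat.card_pos.ne'

theorem cell_unique (T : LRTableau lam mu nu) {i j i' j' : ℕ}
    (hc : IsCell lam mu i j) (hc' : IsCell lam mu i' j')
    (he : T.entry i j = T.entry i' j') (hnu : nu (T.entry i' j' - 1) = 1) :
    i = i' ∧ j = j' := by
  rw [← T.content _ (T.pos i' j' hc')] at hnu
  have := (Nat.card_eq_one_iff_unique.1 hnu).1
  have h := Subsingleton.elim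
    (⟨(i, j), hc, he⟩ :
      {p : ℕ × ℕ // IsCell lam mu p.1 p.2 ∧ T.entry p.1 p.2 = T.entry i' j'})
    ⟨(i', j'), hc', rfl⟩
  simpa using h

/-- Entries grow at least as fast as the row index along a contiguous stretch of a column. -/
theorem entry_add_le (T : LRTableau lam mu nu) {a j : ℕ} (n : ℕ)
    (hc : ∀ i, a ≤ i → i ≤ a + n → IsCell lam mu i j) :
    T.entry a j + n ≤ T.entry (a + n) j := by
  induction n with
  | zero => simp
  | succ n ih =>
    have h := ih fun i h1 h2 => hc i h1 (by omega)
    have h' := T.col_strict (a + n) (a + (n + 1)) j (by omega)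
      (hc _ (by omega) (by omega)) (hc _ (by omega) le_rfl)
    omega

/-- If no letter `m ≥ 2` is repeated, the lattice condition says only that each letter
`m + 1 ≥ 2` is preceded by a letter `m`. -/
theorem nonempty_of_exists_pred (hfin : {p : ℕ × ℕ | IsCell lam mu p.1 p.2}.Finite)
    (hnu : ∀ m, 1 ≤ m → nu m ≤ 1) (f : ℕ → ℕ → ℕ)
    (pos : ∀ i j, IsCell lam mu i j → 1 ≤ f i j)
    (row_weak : ∀ i j j', j ≤ j' → IsCell lam mu i j → IsCell lam mu i j' → f i j ≤ f i j')
    (col_strict : ∀ i i' j, i < i' → IsCell lam mu i j → IsCell lam mu i' j →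
      f i j < f i' j)
    (content : ∀ m, 1 ≤ m →
      Nat.card {p : ℕ × ℕ // IsCell lam mu p.1 p.2 ∧ f p.1 p.2 = m} = nu (m - 1))
    (pred : ∀ i j m, 1 ≤ m → IsCell lam mu i j → f i j = m + 1 →
      ∃ i' j', IsCell lam mu i' j' ∧ f i' j' = m ∧ (i' < i ∨ (i' = i ∧ j ≤ j'))) :
    Nonempty (LRTableau lam mu nu) := by
  classical
  let g : ℕ → ℕ → ℕ := fun i j => if IsCell lam mu i j then f i j else 0
  have hg : ∀ {i j}, IsCell lam mu i j → g i j = f i j := fun h => if_pos h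
  have hcontent : ∀ m, 1 ≤ m →
      Nat.card {p : ℕ × ℕ // IsCell lam mu p.1 p.2 ∧ g p.1 p.2 = m} = nu (m - 1) := by
    intro m hm
    rw [← content m hm]
    refine Nat.card_congr (Equiv.subtypeEquivRight fun p => and_congr_right fun h => ?_)
    rw [hg h]
  refine ⟨⟨g, ?_, fun i j h => if_neg h, ?_, ?_, hcontent, ?_⟩⟩
  · intro i j h
    rw [hg h]
    exact pos i j h
  · intro i j j' hj h h'
    rw [hg h, hg h']
    exact row_weak i j j' hj h h'
  · intro i i' j hi h h'
    rw [hg h, hg h']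
    exact col_strict i i' j hi h h'
  · intro i j m hm
    rcases isEmpty_or_nonempty {p : ℕ × ℕ // IsCell lam mu p.1 p.2 ∧ g p.1 p.2 = m + 1 ∧
        (p.1 < i ∨ (p.1 = i ∧ j ≤ p.2))} with hE | ⟨⟨⟨a, b⟩, hab, he, hlt⟩⟩
    · rw [Nat.card_of_isEmpty]
      exact Nat.zero_le _
    · obtain ⟨a', b', hab', he', hlt'⟩ := pred a b m hm hab (by rw [← hg hab]; exact he)
      have : Finite {p : ℕ × ℕ // IsCell lam mu p.1 p.2 ∧ g p.1 p.2 = m + 1} :=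
        hfin.subset fun p hp => hp.1
      have : Finite {p : ℕ × ℕ // IsCell lam mu p.1 p.2 ∧ g p.1 p.2 = m ∧
          (p.1 < i ∨ (p.1 = i ∧ j ≤ p.2))} := hfin.subset fun p hp => hp.1
      have : Nonempty {p : ℕ × ℕ // IsCell lam mu p.1 p.2 ∧ g p.1 p.2 = m ∧
          (p.1 < i ∨ (p.1 = i ∧ j ≤ p.2))} :=
        ⟨⟨(a', b'), hab', (hg hab').trans he', by dsimp only at hlt ⊢; omega⟩⟩
      refine le_trans ?_ (Nat.one_le_iff_ne_zero.2 Nat.card_pos.ne')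
      refine le_trans ?_ (hnu m hm)
      have h := hcontent (m + 1) (by omega)
      rw [Nat.add_sub_cancel] at h
      rw [← h]
      exact Nat.card_le_card_of_injective
        (Subtype.map id fun p hp => ⟨hp.1, hp.2.1⟩)
        (Subtype.map_injective _ Function.injective_id)

end LRTableau

theorem lrCoeff_eq_zero {lam mu nu : ℕ → ℕ} (h : LRTableau lam mu nu → False) :
    lrCoeff lam mu nu = 0 := by
  have : IsEmpty (LRTableau lam mu nu) := ⟨h⟩
  exact Nat.card_of_isEmpty

theorem lrCoeff_eq_one {lam mu nu : ℕ → ℕ} (hne : Nonempty (LRTableau lam mu nu))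
    (f : ℕ → ℕ → ℕ)
    (h : ∀ T : LRTableau lam mu nu, ∀ i j, IsCell lam mu i j → T.entry i j = f i j) :
    lrCoeff lam mu nu = 1 :=
  Nat.card_eq_one_iff_unique.2
    ⟨⟨fun T U => LRTableau.ext fun i j hc => (h T i j hc).trans (h U i j hc).symm⟩, hne⟩

/-- The partition `(k ^ 2, 2 ^ (ℓ - 2))`. -/
abbrev twoRowsTwoCols (k ℓ : ℕ) : ℕ → ℕ := fun i => if i < 2 then k else if i < ℓ then 2 else 0

section

variable {k ℓ : ℕ}

theorem finite_cells_twoRowsTwoCols (k ℓ : ℕ) (mu : ℕ → ℕ) :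
    {p : ℕ × ℕ | IsCell (twoRowsTwoCols k ℓ) mu p.1 p.2}.Finite := by
  refine (Finset.range (ℓ + 2) ×ˢ Finset.range (k + 2)).finite_toSet.subset ?_
  rintro ⟨i, j⟩ ⟨-, h⟩
  simp only [twoRowsTwoCols] at h
  simp only [Finset.coe_product, Finset.coe_range, Set.mem_prod, Set.mem_Iio]
  split_ifs at h <;> omega

theorem isCell_hookP_iff (hℓ : 3 ≤ ℓ) (i j : ℕ) :
    IsCell (twoRowsTwoCols k ℓ) (hookP k ℓ) i j ↔
      (i = 1 ∧ 1 ≤ j ∧ j < k) ∨ (2 ≤ i ∧ i < ℓ ∧ j = 1) := by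
  simp only [IsCell, twoRowsTwoCols, hookP]
  split_ifs <;> omega

theorem isCell_hookPL_iff (hk : 3 ≤ k) (hℓ : 3 ≤ ℓ) (i j : ℕ) :
    IsCell (twoRowsTwoCols k ℓ) (hookPL k ℓ) i j ↔
      (i = 1 ∧ 1 ≤ j ∧ j < k) ∨ (2 ≤ i ∧ i < ℓ ∧ j = 1) ∨ (i = ℓ - 1 ∧ j = 0) := by
  simp only [IsCell, twoRowsTwoCols, hookPL]
  split_ifs <;> omega

theorem isCell_hookP1_iff (hk : 3 ≤ k) (hℓ : 3 ≤ ℓ) (i j : ℕ) :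
    IsCell (twoRowsTwoCols k ℓ) (hookP1 k ℓ) i j ↔
      (i = 0 ∧ j = k - 1) ∨ (i = 1 ∧ 1 ≤ j ∧ j < k) ∨ (2 ≤ i ∧ i < ℓ ∧ j = 1) := by
  simp only [IsCell, twoRowsTwoCols, hookP1]
  split_ifs <;> omega

/-- The first letter of the reading word is `1`. -/
theorem LRTableau.entry_eq_one_of_first {lam mu nu : ℕ → ℕ} (T : LRTableau lam mu nu)
    (hfin : {p : ℕ × ℕ | IsCell lam mu p.1 p.2}.Finite) {i j : ℕ} (hc : IsCell lam mu i j)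
    (hfirst : ∀ i' j', IsCell lam mu i' j' → (i' < i ∨ (i' = i ∧ j ≤ j')) → i' = i ∧ j' = j) :
    T.entry i j = 1 := by
  by_contra hne
  have hpos := T.pos i j hc
  obtain ⟨i', j', hc', he, hb⟩ := T.exists_pred hfin (m := T.entry i j - 1) (by omega) hc
    (by omega)
  obtain ⟨rfl, rfl⟩ := hfirst i' j' hc' hb
  omega

theorem entry_row_one_of_hookP (hk : 3 ≤ k) (hℓ : 3 ≤ ℓ) {nu : ℕ → ℕ}
    (T : LRTableau (twoRowsTwoCols k ℓ) (hookP k ℓ) nu) {j : ℕ} (hj : 1 ≤ j) (hjk : j < k) :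
    T.entry 1 j = 1 := by
  have hC := isCell_hookP_iff (k := k) hℓ
  have hlast : T.entry 1 (k - 1) = 1 :=
    T.entry_eq_one_of_first (finite_cells_twoRowsTwoCols _ _ _) ((hC _ _).2 (by omega))
      fun i' j' h => by rw [hC] at h; omega
  have hc : IsCell (twoRowsTwoCols k ℓ) (hookP k ℓ) 1 j := (hC _ _).2 (by omega)
  have h1 := T.row_weak 1 j (k - 1) (by omega) hc ((hC _ _).2 (by omega))
  have h2 := T.pos _ _ hc
  omega

theorem entry_row_one_of_hookPL (hk : 3 ≤ k) (hℓ : 3 ≤ ℓ) {nu : ℕ → ℕ}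
    (T : LRTableau (twoRowsTwoCols k ℓ) (hookPL k ℓ) nu) {j : ℕ} (hj : 1 ≤ j) (hjk : j < k) :
    T.entry 1 j = 1 := by
  have hC := isCell_hookPL_iff hk hℓ
  have hlast : T.entry 1 (k - 1) = 1 :=
    T.entry_eq_one_of_first (finite_cells_twoRowsTwoCols _ _ _) ((hC _ _).2 (by omega))
      fun i' j' h => by rw [hC] at h; omega
  have hc : IsCell (twoRowsTwoCols k ℓ) (hookPL k ℓ) 1 j := (hC _ _).2 (by omega)
  have h1 := T.row_weak 1 j (k - 1) (by omega) hc ((hC _ _).2 (by omega))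
  have h2 := T.pos _ _ hc
  omega

theorem entry_of_hookP1 (hk : 3 ≤ k) (hℓ : 3 ≤ ℓ) {nu : ℕ → ℕ} (hnu : nu 1 = 1)
    (T : LRTableau (twoRowsTwoCols k ℓ) (hookP1 k ℓ) nu) :
    T.entry 0 (k - 1) = 1 ∧ T.entry 1 (k - 1) = 2 ∧
      (∀ j, 1 ≤ j → j < k - 1 → T.entry 1 j = 1) ∧
      ∀ i, 2 ≤ i → i < ℓ → i + 1 ≤ T.entry i 1 := by
  have hC := isCell_hookP1_iff hk hℓ
  have hfin := finite_cells_twoRowsTwoCols k ℓ (hookP1 k ℓ)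
  have c0 := (hC 0 (k - 1)).2 (by omega)
  have c1 := (hC 1 (k - 1)).2 (by omega)
  have h0 : T.entry 0 (k - 1) = 1 :=
    T.entry_eq_one_of_first hfin c0 fun i' j' h => by rw [hC] at h; omega
  have h1 : T.entry 1 (k - 1) = 2 := by
    have hlt := T.col_strict 0 1 (k - 1) (by omega) c0 c1
    obtain ⟨i', j', hc', he, hb⟩ := T.exists_pred hfin (m := T.entry 1 (k - 1) - 1)
      (by omega) c1 (by omega)
    have hc'' := (hC _ _).1 hc'
    have : (i' = 0 ∧ j' = k - 1) ∨ (i' = 1 ∧ j' = k - 1) := by omega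
    rcases this with ⟨rfl, rfl⟩ | ⟨rfl, rfl⟩ <;> omega
  have huniq : ∀ i j, IsCell (twoRowsTwoCols k ℓ) (hookP1 k ℓ) i j → T.entry i j = 2 →
      i = 1 ∧ j = k - 1 := fun i j hc he =>
    T.cell_unique hc c1 (he.trans h1.symm) (by rw [h1]; exact hnu)
  have hrow : ∀ j, 1 ≤ j → j < k - 1 → T.entry 1 j = 1 := by
    intro j hj hjk
    have hc := (hC 1 j).2 (by omega)
    have hle := T.row_weak 1 j (k - 1) (by omega) hc c1
    have hpos := T.pos 1 j hc
    have hne : T.entry 1 j ≠ 2 := fun h => by have := huniq 1 j hc h; omega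
    omega
  refine ⟨h0, h1, hrow, fun i hi hiℓ => ?_⟩
  have c2 := (hC 2 1).2 (by omega)
  have hlt := T.col_strict 1 2 1 (by omega) ((hC 1 1).2 (by omega)) c2
  have hne : T.entry 2 1 ≠ 2 := fun h => by have := huniq 2 1 c2 h; omega
  have hone := hrow 1 le_rfl (by omega)
  have hadd := T.entry_add_le (a := 2) (j := 1) (i - 2) fun i' _ _ => (hC _ _).2 (by omega)
  rw [show 2 + (i - 2) = i by omega] at hadd
  omega

theorem le_entry_of_hookP (hk : 3 ≤ k) (hℓ : 3 ≤ ℓ) {nu : ℕ → ℕ}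
    (T : LRTableau (twoRowsTwoCols k ℓ) (hookP k ℓ) nu) {i : ℕ} (hi : 1 ≤ i) (hiℓ : i < ℓ) :
    i ≤ T.entry i 1 := by
  have hadd := T.entry_add_le (a := 1) (j := 1) (i - 1)
    fun i' _ _ => (isCell_hookP_iff hℓ _ _).2 (by omega)
  rw [show 1 + (i - 1) = i by omega, entry_row_one_of_hookP hk hℓ T le_rfl (by omega)] at hadd
  omega

theorem lrCoeff_hookP1_hookPL (hk : 3 ≤ k) (hℓ : 3 ≤ ℓ) :
    lrCoeff (twoRowsTwoCols k ℓ) (hookP1 k ℓ) (hookPL k ℓ) = 0 := by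
  refine lrCoeff_eq_zero fun T => ?_
  have hnu : hookPL k ℓ 1 = 1 := by
      simp [hookPL]
      omega
  have h := (entry_of_hookP1 hk hℓ hnu T).2.2.2 (ℓ - 1) (by omega) (by omega)
  refine T.content_entry_ne_zero (finite_cells_twoRowsTwoCols _ _ _)
    ((isCell_hookP1_iff hk hℓ (ℓ - 1) 1).2 (by omega)) ?_
  simp only [hookPL]
  split_ifs <;> omega

theorem lrCoeff_hookP_hookPUp (hk : 3 ≤ k) (hℓ : 3 ≤ ℓ) :
    lrCoeff (twoRowsTwoCols k ℓ) (hookP k ℓ) (hookPUp k ℓ) = 0 := by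
  refine lrCoeff_eq_zero fun T => ?_
  have h := le_entry_of_hookP hk hℓ T (i := ℓ - 1) (by omega) (by omega)
  refine T.content_entry_ne_zero (finite_cells_twoRowsTwoCols _ _ _)
    ((isCell_hookP_iff hℓ (ℓ - 1) 1).2 (by omega)) ?_
  simp only [hookPUp]
  split_ifs <;> omega

theorem lrCoeff_hookP_hookPLeft (hk : 3 ≤ k) (hℓ : 3 ≤ ℓ) :
    lrCoeff (twoRowsTwoCols k ℓ) (hookP k ℓ) (hookPLeft k ℓ) = 0 := by
  refine lrCoeff_eq_zero fun T => ?_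
  have hC := isCell_hookP_iff (k := k) hℓ
  have hcard := T.content 1 le_rfl
  rw [Nat.subtype_card ({1} ×ˢ Finset.Ico 1 k)] at hcard
  · simp [hookPLeft] at hcard
    omega
  · rintro ⟨i, j⟩
    simp only [Finset.mem_product, Finset.mem_singleton, Finset.mem_Ico]
    constructor
    · rintro ⟨rfl, hj, hjk⟩
      exact ⟨(hC _ _).2 (by omega), entry_row_one_of_hookP hk hℓ T hj hjk⟩
    · rintro ⟨hc, he⟩
      rw [hC] at hc
      rcases hc with hc | ⟨hi, hiℓ, rfl⟩
      · exact hc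
      · have := le_entry_of_hookP hk hℓ T (i := i) (by omega) hiℓ
        omega

theorem lrCoeff_hookP_hookP1L (hk : 3 ≤ k) (hℓ : 3 ≤ ℓ) :
    lrCoeff (twoRowsTwoCols k ℓ) (hookP k ℓ) (hookP1L k ℓ) = 1 := by
  have hC := isCell_hookP_iff (k := k) hℓ
  have hfin := finite_cells_twoRowsTwoCols k ℓ (hookP k ℓ)
  refine lrCoeff_eq_one ?_ (fun i _ => i) fun T i j hc => ?_
  · refine LRTableau.nonempty_of_exists_pred hfin ?_ (fun i _ => i) ?_ ?_ ?_ ?_ ?_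
    · intro m hm
      simp only [hookP1L]
      split_ifs <;> omega
    · intro i j hc
      rw [hC] at hc
      omega
    · intros
      exact le_rfl
    · intro i i' j hi _ _
      exact hi
    · intro m hm
      rcases lt_trichotomy m 1 with h | rfl | h
      · omega
      · rw [Nat.subtype_card ({1} ×ˢ Finset.Ico 1 k)]
        · simp [hookP1L]
        · rintro ⟨i, j⟩
          simp only [Finset.mem_product, Finset.mem_singleton, Finset.mem_Ico, hC]
          omega
      · rw [Nat.subtype_card (if m < ℓ then {(m, 1)} else ∅)]
        · simp only [hookP1L]
          split_ifs <;> first | rfl | omega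
        · rintro ⟨i, j⟩
          split_ifs <;> simp only [Finset.mem_singleton, Prod.mk.injEq, Finset.notMem_empty, hC,
              false_iff]
            <;> omega
    · intro i j m hm hc he
      rw [hC] at hc
      exact ⟨m, 1, (hC _ _).2 (by omega), rfl, by omega⟩
  · have hc' := (hC _ _).1 hc
    rcases hc' with ⟨rfl, hj, hjk⟩ | ⟨hi, hiℓ, rfl⟩
    · exact entry_row_one_of_hookP hk hℓ T hj hjk
    · have hle := le_entry_of_hookP hk hℓ T (i := i) (by omega) hiℓ
      have hadd := T.entry_add_le (a := i) (j := 1) (ℓ - 1 - i)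
        fun i' _ _ => (hC _ _).2 (by omega)
      rw [show i + (ℓ - 1 - i) = ℓ - 1 by omega] at hadd
      have hne := T.content_entry_ne_zero hfin ((hC (ℓ - 1) 1).2 (by omega))
      have : T.entry (ℓ - 1) 1 ≤ ℓ - 1 := by
        simp only [hookP1L] at hne
        split_ifs at hne <;> omega
      omega

theorem lrCoeff_hookP1_hookP1 (hk : 3 ≤ k) (hℓ : 3 ≤ ℓ) :
    lrCoeff (twoRowsTwoCols k ℓ) (hookP1 k ℓ) (hookP1 k ℓ) = 1 := by
  have hC := isCell_hookP1_iff hk hℓ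
  have hfin := finite_cells_twoRowsTwoCols k ℓ (hookP1 k ℓ)
  refine lrCoeff_eq_one ?_ (fun i j => if i = 1 ∧ j < k - 1 then 1 else i + 1)
    fun T i j hc => ?_
  · refine LRTableau.nonempty_of_exists_pred hfin ?_
      (fun i j => if i = 1 ∧ j < k - 1 then 1 else i + 1) ?_ ?_ ?_ ?_ ?_
    · intro m hm
      simp only [hookP1]
      split_ifs <;> omega
    · intro i j _
      split_ifs <;> omega
    · intro i j j' hj hc hc'
      split_ifs <;> omega
    · intro i i' j hi hc hc'
      rw [hC] at hc hc'
      split_ifs <;> omega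
    · intro m hm
      rcases lt_trichotomy m 1 with h | rfl | h
      · omega
      · rw [Nat.subtype_card (insert (0, k - 1) ({1} ×ˢ Finset.Ico 1 (k - 1)))]
        · rw [Finset.card_insert_of_notMem (by simp)]
          simp [hookP1]
          omega
        · rintro ⟨i, j⟩
          simp only [Finset.mem_insert, Prod.mk.injEq, Finset.mem_product,
            Finset.mem_singleton, Finset.mem_Ico, hC]
          split_ifs <;> omega
      · rw [Nat.subtype_card
          (if m = 2 then {(1, k - 1)} else if m ≤ ℓ then {(m - 1, 1)} else ∅)]
        · simp only [hookP1]
          split_ifs <;> first | rfl | omega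
        · rintro ⟨i, j⟩
          split_ifs <;> simp only [Finset.mem_singleton, Prod.mk.injEq, Finset.notMem_empty, hC,
              false_iff]
            <;> omega
    · intro i j m hm hc he
      rw [hC] at hc
      rcases (by omega : m = 1 ∨ m = 2 ∨ 3 ≤ m) with rfl | rfl | h
      · exact ⟨0, k - 1, (hC _ _).2 (by omega), by simp, by split_ifs at he <;> omega⟩
      · exact ⟨1, k - 1, (hC _ _).2 (by omega), by simp, by split_ifs at he <;> omega⟩
      · refine ⟨m - 1, 1, (hC _ _).2 ?_, ?_, ?_⟩
        · split_ifs at he <;> omega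
        · rw [if_neg (by omega)]
          omega
        · split_ifs at he <;> omega
  · have hnu : hookP1 k ℓ 1 = 1 := by
      simp [hookP1]
      omega
    obtain ⟨h0, h1, hrow, hcol⟩ := entry_of_hookP1 hk hℓ hnu T
    rcases (hC _ _).1 hc with ⟨rfl, rfl⟩ | ⟨rfl, hj, hjk⟩ | ⟨hi, hiℓ, rfl⟩
    · simpa using h0
    · by_cases hj' : j < k - 1
      · simpa [hj'] using hrow j hj hj'
      · obtain rfl : j = k - 1 := by omega
        simpa using h1
    · have hle := hcol i hi hiℓ
      have hadd := T.entry_add_le (a := i) (j := 1) (ℓ - 1 - i)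
        fun i' _ _ => (hC _ _).2 (by omega)
      rw [show i + (ℓ - 1 - i) = ℓ - 1 by omega] at hadd
      have hne := T.content_entry_ne_zero hfin ((hC (ℓ - 1) 1).2 (by omega))
      have : T.entry (ℓ - 1) 1 ≤ ℓ := by
        simp only [hookP1] at hne
        split_ifs at hne <;> omega
      rw [if_neg (by omega)]
      omega

theorem lrCoeff_hookPL_hookPL (hk : 3 ≤ k) (hℓ : 3 ≤ ℓ) :
    lrCoeff (twoRowsTwoCols k ℓ) (hookPL k ℓ) (hookPL k ℓ) = 1 := by
  have hC := isCell_hookPL_iff hk hℓ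
  have hfin := finite_cells_twoRowsTwoCols k ℓ (hookPL k ℓ)
  refine lrCoeff_eq_one ?_ (fun i j => if j = 0 then 1 else i) fun T => ?_
  · refine LRTableau.nonempty_of_exists_pred hfin ?_
      (fun i j => if j = 0 then 1 else i) ?_ ?_ ?_ ?_ ?_
    · intro m hm
      simp only [hookPL]
      split_ifs <;> omega
    · intro i j hc
      rw [hC] at hc
      split_ifs <;> omega
    · intro i j j' hj hc hc'
      rw [hC] at hc hc'
      split_ifs <;> omega
    · intro i i' j hi hc hc'
      rw [hC] at hc hc'
      split_ifs <;> omega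
    · intro m hm
      rcases lt_trichotomy m 1 with h | rfl | h
      · omega
      · rw [Nat.subtype_card (insert (ℓ - 1, 0) ({1} ×ˢ Finset.Ico 1 k))]
        · rw [Finset.card_insert_of_notMem (by simp)]
          simp [hookPL]
          omega
        · rintro ⟨i, j⟩
          simp only [Finset.mem_insert, Prod.mk.injEq, Finset.mem_product,
            Finset.mem_singleton, Finset.mem_Ico, hC]
          split_ifs <;> omega
      · rw [Nat.subtype_card (if m < ℓ then {(m, 1)} else ∅)]
        · simp only [hookPL]
          split_ifs <;> first | rfl | omega
        · rintro ⟨i, j⟩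
          split_ifs <;> simp only [Finset.mem_singleton, Prod.mk.injEq, Finset.notMem_empty, hC,
              false_iff]
            <;> omega
    · intro i j m hm hc he
      rw [hC] at hc
      refine ⟨m, 1, (hC _ _).2 ?_, by simp, ?_⟩ <;> split_ifs at he <;> omega
  · have hmax : ∀ i j, IsCell (twoRowsTwoCols k ℓ) (hookPL k ℓ) i j →
        T.entry i j ≤ ℓ - 1 := by
      intro i j hc
      have hne := T.content_entry_ne_zero hfin hc
      simp only [hookPL] at hne
      split_ifs at hne <;> omega
    have hcol : ∀ i, 1 ≤ i → i < ℓ → T.entry i 1 = i := by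
      intro i hi hiℓ
      have hlow := T.entry_add_le (a := 1) (j := 1) (i - 1)
        fun i' _ _ => (hC _ _).2 (by omega)
      rw [show 1 + (i - 1) = i by omega,
        entry_row_one_of_hookPL hk hℓ T le_rfl (by omega)] at hlow
      have hupp := T.entry_add_le (a := i) (j := 1) (ℓ - 1 - i)
        fun i' _ _ => (hC _ _).2 (by omega)
      rw [show i + (ℓ - 1 - i) = ℓ - 1 by omega] at hupp
      have := hmax (ℓ - 1) 1 ((hC _ _).2 (by omega))
      omega
    intro i j hc
    rcases (hC _ _).1 hc with ⟨rfl, hj, hjk⟩ | ⟨hi, hiℓ, rfl⟩ | ⟨rfl, rfl⟩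
    · rw [entry_row_one_of_hookPL hk hℓ T hj hjk, ite_self]
    · simpa using hcol i (by omega) hiℓ
    · by_contra hne
      rw [if_pos rfl] at hne
      have hpos := T.pos _ _ hc
      have hle := hmax _ _ hc
      have he := hcol (T.entry (ℓ - 1) 0) hpos (by omega)
      have h := T.cell_unique hc ((hC (T.entry (ℓ - 1) 0) 1).2 (by omega)) he.symm (by
        rw [he]
        simp only [hookPL]
        split_ifs <;> omega)
      omega

end

/-- for the hook `λ = (k, 1^(ℓ-1))` with `k, ℓ ≥ 3` and
`β = (k^2, 2^(ℓ-2))`, the Littlewood–Richardson coefficients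
`c^β_{λ_(1), λ_(ℓ)}, c^β_{λ_(ℓ), λ_(ℓ)}, c^β_{λ_(1), λ_(1)}, c^β_{λ, λ_(1,ℓ)},
c^β_{λ, λ_(ℓ,↑)}, c^β_{λ, λ_(1,←)}` are `0, 1, 1, 1, 0, 0` respectively. -/
theorem hook_lr_special (k ℓ : ℕ) (hk : 3 ≤ k) (hℓ : 3 ≤ ℓ) :
    lrCoeff (fun i => if i < 2 then k else if i < ℓ then 2 else 0)
        (hookP1 k ℓ) (hookPL k ℓ) = 0 ∧
    lrCoeff (fun i => if i < 2 then k else if i < ℓ then 2 else 0)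
        (hookPL k ℓ) (hookPL k ℓ) = 1 ∧
    lrCoeff (fun i => if i < 2 then k else if i < ℓ then 2 else 0)
        (hookP1 k ℓ) (hookP1 k ℓ) = 1 ∧
    lrCoeff (fun i => if i < 2 then k else if i < ℓ then 2 else 0)
        (hookP k ℓ) (hookP1L k ℓ) = 1 ∧
    lrCoeff (fun i => if i < 2 then k else if i < ℓ then 2 else 0)
        (hookP k ℓ) (hookPUp k ℓ) = 0 ∧
    lrCoeff (fun i => if i < 2 then k else if i < ℓ then 2 else 0)
        (hookP k ℓ) (hookPLeft k ℓ) = 0 := by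
  exact ⟨lrCoeff_hookP1_hookPL hk hℓ, lrCoeff_hookPL_hookPL hk hℓ, lrCoeff_hookP1_hookP1 hk hℓ,
    lrCoeff_hookP_hookP1L hk hℓ, lrCoeff_hookP_hookPUp hk hℓ, lrCoeff_hookP_hookPLeft hk hℓ⟩

end
end

section
/- Let k ≥ 3, let λ = (k, k, 1), and set λ_{(2)} = (k, k−1, 1), λ_{(3)} = (k, k), λ_{(2,3)} = (k, k−1). Then for every partition α of 4k = 2|λ| − 2 that contains λ and is not equal to (2k, k, k) or (k, k, k, k), the Littlewood–Richardson coefficients satisfy 2·c^α_{λ_{(2)}, λ_{(3)}} ≥ c^α_{λ, λ_{(2,3)}}. -/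
noncomputable section

/-- The partition `λ = (k, k, 1)`. -/
def kkone (k : ℕ) : ℕ → ℕ := fun i => if i < 2 then k else if i = 2 then 1 else 0

/-- `λ_(2) = (k, k - 1, 1)` for `λ = (k, k, 1)`. -/
def kkone2 (k : ℕ) : ℕ → ℕ :=
  fun i => if i = 0 then k else if i = 1 then k - 1 else if i = 2 then 1 else 0

/-- `λ_(3) = (k, k)` for `λ = (k, k, 1)`. -/
def kkone3 (k : ℕ) : ℕ → ℕ := fun i => if i < 2 then k else 0

/-- `λ_(2,3) = (k, k - 1)` for `λ = (k, k, 1)`. -/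
def kkone23 (k : ℕ) : ℕ → ℕ := fun i => if i = 0 then k else if i = 1 then k - 1 else 0

/-- The filling of the skew shape `lam / mu` by `1`s and `2`s whose row `i` has its `1`s in the
columns before `s i`; it is `0` outside the shape. -/
def twoFill (lam mu s : ℕ → ℕ) (i j : ℕ) : ℕ :=
  if mu i ≤ j ∧ j < lam i then (if j < s i then 1 else 2) else 0

/-- Counting lattice points between two functions in the first `i` rows and, from column `j` on,
in row `i`. -/
theorem card_rows_between (lo hi : ℕ → ℕ) (i j : ℕ) :
    Nat.card {p : ℕ × ℕ // (lo p.1 ≤ p.2 ∧ p.2 < hi p.1) ∧ (p.1 < i ∨ (p.1 = i ∧ j ≤ p.2))} =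
      ∑ l ∈ Finset.range i, (hi l - lo l) + (hi i - max (lo i) j) := by
  rw [Nat.subtype_card (((Finset.range (i + 1)).sigma
    (fun l => Finset.Ico (if l < i then lo l else max (lo l) j) (hi l))).map
      (Equiv.sigmaEquivProd ℕ ℕ).toEmbedding)]
  · rw [Finset.card_map, Finset.card_sigma, Finset.sum_range_succ]
    congr 1
    · refine Finset.sum_congr rfl fun l hl => ?_
      simp [Finset.mem_range.1 hl]
    · simp
  · rintro ⟨l, m⟩
    simp only [Finset.mem_map_equiv, Finset.mem_sigma, Finset.mem_range, Finset.mem_Ico,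
      Equiv.sigmaEquivProd_symm_apply]
    split_ifs <;> omega

theorem card_twoFill_one {lam mu s : ℕ → ℕ} (hs : ∀ i, s i ≤ lam i) (i j : ℕ) :
    Nat.card {p : ℕ × ℕ // IsCell lam mu p.1 p.2 ∧ twoFill lam mu s p.1 p.2 = 1 ∧
        (p.1 < i ∨ (p.1 = i ∧ j ≤ p.2))} =
      ∑ l ∈ Finset.range i, (s l - mu l) + (s i - max (mu i) j) := by
  rw [← card_rows_between]
  refine Nat.card_congr (Equiv.subtypeEquivRight fun p => ?_)
  have := hs p.1
  unfold IsCell twoFill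
  split_ifs <;> omega

theorem card_twoFill_two {lam mu s : ℕ → ℕ} (hs : ∀ i, mu i ≤ s i) (i j : ℕ) :
    Nat.card {p : ℕ × ℕ // IsCell lam mu p.1 p.2 ∧ twoFill lam mu s p.1 p.2 = 2 ∧
        (p.1 < i ∨ (p.1 = i ∧ j ≤ p.2))} =
      ∑ l ∈ Finset.range i, (lam l - s l) + (lam i - max (s i) j) := by
  rw [← card_rows_between]
  refine Nat.card_congr (Equiv.subtypeEquivRight fun p => ?_)
  have := hs p.1
  unfold IsCell twoFill
  split_ifs <;> omega

/-- When `lam` vanishes from row `M` on, a restriction to the rows up to `M` is vacuous. -/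
theorem card_cells_eq_card_cells_rows_le {lam mu : ℕ → ℕ} {M : ℕ}
    (hM : ∀ i, M ≤ i → lam i = 0) (P : ℕ × ℕ → Prop) :
    Nat.card {p : ℕ × ℕ // IsCell lam mu p.1 p.2 ∧ P p} =
      Nat.card {p : ℕ × ℕ // IsCell lam mu p.1 p.2 ∧ P p ∧
        (p.1 < M ∨ (p.1 = M ∧ 0 ≤ p.2))} := by
  refine Nat.card_congr (Equiv.subtypeEquivRight fun p => ?_)
  have : IsCell lam mu p.1 p.2 → p.1 < M := fun h => by
    by_contra hp
    have := hM p.1 (not_lt.1 hp)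
    have := h.2
    omega
  tauto

theorem LRTableau.ext_entry {lam mu nu : ℕ → ℕ} {T U : LRTableau lam mu nu}
    (h : T.entry = U.entry) : T = U := by
  cases T
  cases U
  cases h
  rfl

theorem IsPartition.finite_cells {lam : ℕ → ℕ} (h : IsPartition lam) (mu : ℕ → ℕ) :
    {p : ℕ × ℕ | IsCell lam mu p.1 p.2}.Finite := by
  obtain ⟨hanti, M, hM⟩ := h
  refine ((Set.finite_Iio M).prod (Set.finite_Iio (lam 0))).subset fun p hp => ?_
  have h2 : p.2 < lam p.1 := hp.2
  refine ⟨?_, h2.trans_le (hanti (Nat.zero_le _))⟩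
  by_contra hp1
  have := hM p.1 (not_lt.1 hp1)
  omega

theorem LRTableau.entry_le_two {lam mu nu : ℕ → ℕ} (hlam : IsPartition lam)
    (hnu : ∀ m, 2 ≤ m → nu m = 0) (T : LRTableau lam mu nu) (i j : ℕ) : T.entry i j ≤ 2 := by
  by_contra! h
  have hc : IsCell lam mu i j := by
    by_contra hc
    have := T.zero i j hc
    omega
  have h0 := T.content (T.entry i j) (by omega)
  rw [hnu _ (by omega), Nat.card_eq_zero] at h0
  rcases h0 with h0 | h0
  · exact h0.false ⟨(i, j), hc, rfl⟩
  · have : Set.Finite {p : ℕ × ℕ | IsCell lam mu p.1 p.2 ∧ T.entry p.1 p.2 = T.entry i j} :=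
      (hlam.finite_cells mu).subset fun p hp => hp.1
    exact h0.not_finite this

theorem LRTableau.finite {lam mu nu : ℕ → ℕ} (hlam : IsPartition lam)
    (hnu : ∀ m, 2 ≤ m → nu m = 0) : Finite (LRTableau lam mu nu) := by
  have := (hlam.finite_cells mu).to_subtype
  refine Finite.of_injective
    (fun (T : LRTableau lam mu nu) (p : {p : ℕ × ℕ | IsCell lam mu p.1 p.2}) =>
      (⟨T.entry p.1.1 p.1.2, Nat.lt_succ_of_le (T.entry_le_two hlam hnu _ _)⟩ : Fin 3))
    fun T U h => LRTableau.ext_entry ?_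
  funext i j
  by_cases hc : IsCell lam mu i j
  · simpa using congrFun h ⟨(i, j), hc⟩
  · rw [T.zero i j hc, U.zero i j hc]

theorem LRTableau.exists_eq_twoFill {lam mu nu : ℕ → ℕ} (hlam : IsPartition lam)
    (hmu : ∀ i, mu i ≤ lam i) (hnu : ∀ m, 2 ≤ m → nu m = 0) (T : LRTableau lam mu nu) :
    ∃ s : ℕ → ℕ, (∀ i, mu i ≤ s i) ∧ (∀ i, s i ≤ lam i) ∧ T.entry = twoFill lam mu s := by
  classical
  have hex : ∀ i, ∃ s, mu i ≤ s ∧ (lam i ≤ s ∨ T.entry i s ≠ 1) :=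
    fun i => ⟨lam i, hmu i, Or.inl le_rfl⟩
  refine ⟨fun i => Nat.find (hex i), fun i => (Nat.find_spec (hex i)).1,
    fun i => Nat.find_min' (hex i) ⟨hmu i, Or.inl le_rfl⟩, ?_⟩
  funext i j
  unfold twoFill
  split_ifs with hc hj
  · have := Nat.find_min (hex i) hj
    by_contra h
    exact this ⟨hc.1, Or.inr h⟩
  · have hj : Nat.find (hex i) ≤ j := not_lt.1 hj
    obtain ⟨h1, h2⟩ := Nat.find_spec (hex i)
    have hc0 : IsCell lam mu i (Nat.find (hex i)) := ⟨h1, hj.trans_lt hc.2⟩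
    have h3 := T.pos i _ hc0
    have h4 := T.row_weak i _ j hj hc0 hc
    have h5 := T.entry_le_two hlam hnu i j
    have h6 := hc0.2
    rcases h2 with h2 | h2 <;> omega
  · exact T.zero i j hc

section Numerics

variable {lam mu nu s : ℕ → ℕ}

theorem LRTableau.twoFill_column {T : LRTableau lam mu nu} (hT : T.entry = twoFill lam mu s)
    (i i' j : ℕ) (hii : i < i') (h : mu i ≤ j) (hl : j < lam i) (h' : mu i' ≤ j)
    (hl' : j < lam i') : j < s i ∧ s i' ≤ j := by
  have := T.col_strict i i' j hii ⟨h, hl⟩ ⟨h', hl'⟩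
  rw [hT] at this
  unfold twoFill at this
  split_ifs at this <;> omega

theorem LRTableau.twoFill_content_one {T : LRTableau lam mu nu}
    (hT : T.entry = twoFill lam mu s) {M : ℕ} (hM : ∀ i, M ≤ i → lam i = 0)
    (hs : ∀ i, s i ≤ lam i) : ∑ l ∈ Finset.range M, (s l - mu l) = nu 0 := by
  have := T.content 1 le_rfl
  rw [card_cells_eq_card_cells_rows_le hM (fun p => T.entry p.1 p.2 = 1), hT,
    card_twoFill_one hs] at this
  have h0 := hM M le_rfl
  have h1 := hs M
  simp only [Nat.sub_self] at this
  omega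

theorem LRTableau.twoFill_lattice {T : LRTableau lam mu nu}
    (hT : T.entry = twoFill lam mu s) (hmu : ∀ i, mu i ≤ s i) (hs : ∀ i, s i ≤ lam i) (i : ℕ) :
    ∑ l ∈ Finset.range (i + 1), (lam l - s l) ≤ ∑ l ∈ Finset.range i, (s l - mu l) := by
  have := T.lattice i (s i) 1 le_rfl
  rw [hT, card_twoFill_one hs, card_twoFill_two hmu] at this
  rw [Finset.sum_range_succ]
  omega

/-- A filling by `1`s and `2`s is a Littlewood–Richardson tableau as soon as the lengths of its
runs satisfy the column, content and lattice inequalities. -/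
def LRTableau.ofTwoFill {M : ℕ} (hM : ∀ i, M ≤ i → lam i = 0) (hmu : ∀ i, mu i ≤ s i)
    (hs : ∀ i, s i ≤ lam i) (hnu : ∀ m, 2 ≤ m → nu m = 0)
    (hcol : ∀ i i' j, i < i' → mu i ≤ j → j < lam i → mu i' ≤ j → j < lam i' →
      j < s i ∧ s i' ≤ j)
    (hone : ∑ l ∈ Finset.range M, (s l - mu l) = nu 0)
    (htwo : ∑ l ∈ Finset.range M, (lam l - s l) = nu 1)
    (hle : nu 1 ≤ nu 0)
    (hlat : ∀ i < M,
      ∑ l ∈ Finset.range (i + 1), (lam l - s l) ≤ ∑ l ∈ Finset.range i, (s l - mu l)) :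
    LRTableau lam mu nu where
  entry := twoFill lam mu s
  pos i j h := by
    unfold IsCell at h
    unfold twoFill
    split_ifs <;> omega
  zero i j h := if_neg h
  row_weak i j j' hj h h' := by
    unfold IsCell at h h'
    unfold twoFill
    split_ifs <;> omega
  col_strict i i' j hi h h' := by
    have := hcol i i' j hi h.1 h.2 h'.1 h'.2
    unfold IsCell at h h'
    unfold twoFill
    split_ifs <;> omega
  content m hm := by
    have h0 := hM M le_rfl
    have h1 := hs M
    rcases (by omega : m = 1 ∨ m = 2 ∨ 3 ≤ m) with rfl | rfl | h
    · rw [card_cells_eq_card_cells_rows_le hM (fun p => twoFill lam mu s p.1 p.2 = 1),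
        card_twoFill_one hs, Nat.sub_self]
      omega
    · rw [card_cells_eq_card_cells_rows_le hM (fun p => twoFill lam mu s p.1 p.2 = 2),
        card_twoFill_two hmu]
      simp only [Nat.reduceSub]
      omega
    · rw [hnu _ (by omega), Nat.card_eq_zero]
      refine Or.inl ⟨fun p => ?_⟩
      have := p.2.2
      unfold twoFill at this
      split_ifs at this <;> omega
  lattice i j m hm := by
    rcases (by omega : m = 1 ∨ 2 ≤ m) with rfl | h
    · rw [card_twoFill_one hs, card_twoFill_two hmu]
      rcases lt_or_ge i M with hi | hi
      · have := hlat i hi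
        rw [Finset.sum_range_succ] at this
        omega
      · have hz : ∀ l ∈ Finset.range i, l ∉ Finset.range M → lam l = 0 := fun l _ hl =>
          hM l (by simpa using hl)
        have hsub : Finset.range M ⊆ Finset.range i := Finset.range_mono hi
        rw [← Finset.sum_subset hsub fun l hl hl' => by have := hz l hl hl'; omega,
          ← Finset.sum_subset hsub fun l hl hl' => by
            have := hz l hl hl'
            have := hs l
            omega, hone, htwo]
        have := hM i hi
        omega
    · rw [Nat.card_eq_zero.2 (Or.inl ⟨fun p => ?_⟩)]
      · exact Nat.zero_le _
      · have := p.2.2.1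
        unfold twoFill at this
        split_ifs at this <;> omega

end Numerics

/-- The constraints on the row thresholds of a tableau of shape `α / (k, k, 1)` with content
`(k, k - 1)`. -/
theorem LRTableau.kkone_thresholds {k : ℕ} (hk : 3 ≤ k) {α : ℕ → ℕ} (hα : IsPartition α)
    (hcont : ∀ i, kkone k i ≤ α i) (T : LRTableau α (kkone k) (kkone23 k)) :
    ∃ s : ℕ → ℕ, T.entry = twoFill α (kkone k) s ∧ (∀ i, 5 ≤ i → α i = 0) ∧
      (∀ i, s i ≤ α i) ∧ s 0 = α 0 ∧ s 1 = k ∧ 1 ≤ s 2 ∧ s 3 ≤ 1 ∧ s 4 = 0 ∧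
      α 2 ≤ k ∧ α 4 ≤ s 3 ∧ (2 ≤ α 3 → α 3 ≤ s 2) ∧
      α 1 + α 2 ≤ α 0 + s 2 ∧ α 0 + s 2 + s 3 = 2 * k + 1 := by
  obtain ⟨s, hmu, hs, hT⟩ := T.exists_eq_twoFill hα hcont
    (fun m hm => by simp [kkone23, show m ≠ 0 by omega, show m ≠ 1 by omega])
  have m0 : kkone k 0 = k := rfl
  have m1 : kkone k 1 = k := rfl
  have m2 : kkone k 2 = 1 := rfl
  have m3 : kkone k 3 = 0 := rfl
  have m4 : kkone k 4 = 0 := rfl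
  have m5 : kkone k 5 = 0 := rfl
  have col := LRTableau.twoFill_column hT
  have a01 := hα.1 (show 0 ≤ 1 by omega)
  have a12 := hα.1 (show 1 ≤ 2 by omega)
  have a23 := hα.1 (show 2 ≤ 3 by omega)
  have a34 := hα.1 (show 3 ≤ 4 by omega)
  have a45 := hα.1 (show 4 ≤ 5 by omega)
  have s0 := hs 0
  have s1 := hs 1
  have s2 := hs 2
  have s3 := hs 3
  have s4 := hs 4
  have u0 := hmu 0
  have u1 := hmu 1
  have u2 := hmu 2
  have h5 : α 5 = 0 := by
    have := col 3 4 0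
    have := col 4 5 0
    omega
  have hM : ∀ i, 5 ≤ i → α i = 0 := fun i hi => by
    have := hα.1 hi
    omega
  have hlat0 := LRTableau.twoFill_lattice hT hmu hs 0
  have hlat2 := LRTableau.twoFill_lattice hT hmu hs 2
  have hone := LRTableau.twoFill_content_one hT hM hs
  simp only [Finset.sum_range_succ, Finset.sum_range_zero, m0, m1, m2, m3, m4,
    show kkone23 k 0 = k from rfl] at hlat0 hlat2 hone
  have t0 : s 0 = α 0 := by omega
  have t1 : s 1 = k := by
    have := col 0 1 k
    omega
  have t4 : s 4 = 0 := by
    have := col 3 4 0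
    omega
  have t3 : s 3 ≤ 1 := by
    have := col 2 3 1
    omega
  refine ⟨s, hT, hM, hs, t0, t1, by omega, t3, t4, ?_, ?_, ?_, by omega, by omega⟩
  · have := col 1 2 k
    omega
  · have := col 3 4 0
    have := col 3 4 1
    omega
  · have := col 2 3 (α 3 - 1)
    omega

theorem lrCoeff_kkone_le_two {k : ℕ} (hk : 3 ≤ k) {α : ℕ → ℕ} (hα : IsPartition α)
    (hcont : ∀ i, kkone k i ≤ α i) : lrCoeff α (kkone k) (kkone23 k) ≤ 2 := by
  have hinj : Function.Injective
      (fun T : LRTableau α (kkone k) (kkone23 k) => decide (T.entry 3 0 = 1)) := by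
    intro T U h
    obtain ⟨s, hT, hM, hs, s0, s1, s2, s3, s4, -, -, -, -, ssum⟩ :=
      T.kkone_thresholds hk hα hcont
    obtain ⟨t, hU, -, ht, t0, t1, t2, t3, t4, -, -, -, -, tsum⟩ :=
      U.kkone_thresholds hk hα hcont
    have h3 : s 3 = t 3 := by
      have h := decide_eq_decide.1 h
      have := hs 3
      have := ht 3
      rw [hT, hU] at h
      have m3 : kkone k 3 = 0 := rfl
      unfold twoFill at h
      rw [m3] at h
      split_ifs at h <;> omega
    have hst : s = t := by
      funext i
      rcases (by omega : i = 0 ∨ i = 1 ∨ i = 2 ∨ i = 3 ∨ i = 4 ∨ 5 ≤ i) with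
        rfl | rfl | rfl | rfl | rfl | hi
      · omega
      · omega
      · omega
      · omega
      · omega
      · have := hM i hi
        have := hs i
        have := ht i
        omega
    exact LRTableau.ext_entry (by rw [hT, hU, hst])
  simpa [lrCoeff] using Nat.card_le_card_of_injective _ hinj

/-- A tableau of shape `α / (k, k - 1, 1)` with content `(k, k)`, from the position `v` of the
first `2` in row `1` and the position `w` of the first `2` in row `2`. -/
theorem nonempty_kkone2_of_thresholds {k v w : ℕ} (hk : 3 ≤ k) {α : ℕ → ℕ}
    (hα : IsPartition α) (hM : ∀ i, 5 ≤ i → α i = 0)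
    (hcont : ∀ i, kkone k i ≤ α i) (hsum : α 0 + α 1 + α 2 + α 3 + α 4 = 4 * k)
    (h2 : α 2 ≤ k) (h3 : α 3 < k) (h4 : α 4 ≤ 1)
    (hv : k ≤ v + 1) (hv' : v ≤ k) (hw : 1 ≤ w) (hw' : w ≤ α 2) (h3w : 2 ≤ α 3 → α 3 ≤ w)
    (h2v : α 2 = k → v = k ∧ w < k) (hone : α 0 + v + w + α 4 = 3 * k)
    (hlat1 : α 1 + k ≤ α 0 + v) (hlat2 : α 1 + α 2 + 2 * k ≤ α 0 + w + 2 * v + 1) :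
    Nonempty (LRTableau α (kkone2 k) (kkone3 k)) := by
  have c0 : k ≤ α 0 := hcont 0
  have c1 : k ≤ α 1 := hcont 1
  have c2 : 1 ≤ α 2 := hcont 2
  have a01 := hα.1 (show 0 ≤ 1 by omega)
  have a12 := hα.1 (show 1 ≤ 2 by omega)
  have a23 := hα.1 (show 2 ≤ 3 by omega)
  have a34 := hα.1 (show 3 ≤ 4 by omega)
  obtain ⟨s, s0, s1, s2, s3, s4, s5⟩ : ∃ s : ℕ → ℕ, s 0 = α 0 ∧ s 1 = v ∧ s 2 = w ∧
      s 3 = α 4 ∧ s 4 = 0 ∧ ∀ i, 5 ≤ i → s i = 0 :=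
    ⟨fun i => if i = 0 then α 0 else if i = 1 then v else if i = 2 then w else
      if i = 3 then α 4 else 0, rfl, rfl, rfl, rfl, rfl, fun i hi => by
        simp [show i ≠ 0 by omega, show i ≠ 1 by omega, show i ≠ 2 by omega,
          show i ≠ 3 by omega]⟩
  have m0 : kkone2 k 0 = k := rfl
  have m1 : kkone2 k 1 = k - 1 := rfl
  have m2 : kkone2 k 2 = 1 := rfl
  have m3 : kkone2 k 3 = 0 := rfl
  have m4 : kkone2 k 4 = 0 := rfl
  have m5 : ∀ i, 5 ≤ i → kkone2 k i = 0 := fun i hi => by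
    simp [kkone2, show i ≠ 0 by omega, show i ≠ 1 by omega, show i ≠ 2 by omega]
  have n0 : kkone3 k 0 = k := rfl
  have n1 : kkone3 k 1 = k := rfl
  have rows : ∀ i : ℕ, i = 0 ∨ i = 1 ∨ i = 2 ∨ i = 3 ∨ i = 4 ∨ 5 ≤ i := fun i => by omega
  refine ⟨LRTableau.ofTwoFill (M := 5) (s := s) hM ?_ ?_ ?_ ?_ ?_ ?_ ?_ ?_⟩
  · intro i
    rcases rows i with rfl | rfl | rfl | rfl | rfl | hi
    on_goal 6 => have := m5 i hi
    all_goals omega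
  · intro i
    rcases rows i with rfl | rfl | rfl | rfl | rfl | hi
    on_goal 6 => have := s5 i hi
    all_goals omega
  · intro m hm
    simp [kkone3, show ¬ m < 2 by omega]
  · intro i i' j hii hi hl hi' hl'
    have hb : i' < 5 := by
      by_contra h
      have := hM i' (not_lt.1 h)
      omega
    have hi5 : i < 5 := hii.trans hb
    clear hα hM hcont s5 m5 rows
    rcases (by omega : i = 0 ∨ i = 1 ∨ i = 2 ∨ i = 3) with rfl | rfl | rfl | rfl <;>
      rcases (by omega : i' = 1 ∨ i' = 2 ∨ i' = 3 ∨ i' = 4) with rfl | rfl | rfl | rfl <;>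
      omega
  · simp only [Finset.sum_range_succ, Finset.sum_range_zero]
    omega
  · simp only [Finset.sum_range_succ, Finset.sum_range_zero]
    omega
  · omega
  · intro i hi
    interval_cases i <;> simp only [Finset.sum_range_succ, Finset.sum_range_zero] <;> omega

/-- for `λ = (k, k, 1)` with `k ≥ 3` and any partition `α` of
`4k = 2|λ| - 2` containing `λ` and different from `(2k, k, k)` and `(k, k, k, k)`, we
have `2 * c^α_{λ_(2), λ_(3)} ≥ c^α_{λ, λ_(2,3)}`. -/
theorem kk1_lr_inequality (k : ℕ) (hk : 3 ≤ k) (α : ℕ → ℕ) (hα : IsPartition α)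
    (hsize : ∑ᶠ i, α i = 4 * k) (hcont : ∀ i, kkone k i ≤ α i)
    (hne1 : α ≠ fun i => if i = 0 then 2 * k else if i < 3 then k else 0)
    (hne2 : α ≠ fun i => if i < 4 then k else 0) :
    lrCoeff α (kkone k) (kkone23 k) ≤ 2 * lrCoeff α (kkone2 k) (kkone3 k) := by
  rcases isEmpty_or_nonempty (LRTableau α (kkone k) (kkone23 k)) with hE | ⟨⟨T⟩⟩
  · simp [lrCoeff]
  obtain ⟨s, -, hM, hs, -, -, s2, s3, -, h2, h4, h3, hlat, hone⟩ :=
    T.kkone_thresholds hk hα hcont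
  have hsum : α 0 + α 1 + α 2 + α 3 + α 4 = 4 * k := by
    rw [← hsize, finsum_eq_sum_of_support_subset (s := Finset.range 5) α fun i hi => by
      by_contra h
      exact hi (hM i (by simpa using h))]
    simp [Finset.sum_range_succ]
  have c0 : k ≤ α 0 := hcont 0
  have c1 : k ≤ α 1 := hcont 1
  have c2 : 1 ≤ α 2 := hcont 2
  have a01 := hα.1 (show 0 ≤ 1 by omega)
  have a12 := hα.1 (show 1 ≤ 2 by omega)
  have a23 := hα.1 (show 2 ≤ 3 by omega)
  have a34 := hα.1 (show 3 ≤ 4 by omega)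
  have hs2 := hs 2
  have hs3 := hs 3
  have ext5 : ∀ β : ℕ → ℕ, α 0 = β 0 → α 1 = β 1 → α 2 = β 2 → α 3 = β 3 → α 4 = β 4 →
      (∀ i, 5 ≤ i → β i = 0) → α = β := by
    intro β b0 b1 b2 b3 b4 b5
    funext i
    rcases (by omega : i = 0 ∨ i = 1 ∨ i = 2 ∨ i = 3 ∨ i = 4 ∨ 5 ≤ i) with
      rfl | rfl | rfl | rfl | rfl | hi
    · exact b0
    · exact b1
    · exact b2
    · exact b3
    · exact b4
    · rw [hM i hi, b5 i hi]
  have e1 : ¬ (α 0 = 2 * k ∧ α 1 = k ∧ α 2 = k ∧ α 3 = 0 ∧ α 4 = 0) := by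
    rintro ⟨b0, b1, b2, b3, b4⟩
    refine hne1 (ext5 _ b0 b1 b2 b3 b4 fun i hi => ?_)
    simp [show i ≠ 0 by omega, show ¬ i < 3 by omega]
  have e2 : α 3 < k := by
    by_contra h
    refine hne2 (ext5 _ ?_ ?_ ?_ ?_ ?_ fun i hi => if_neg (by omega)) <;> norm_num <;> omega
  have hB : Nonempty (LRTableau α (kkone2 k) (kkone3 k)) := by
    by_cases hu : (1 ≤ α 3 ∧ α 0 + α 3 + α 4 ≤ 2 * k) ∨ (α 3 = 0 ∧ α 0 < 2 * k)
    · exact nonempty_kkone2_of_thresholds (v := k) (w := 2 * k - α 0 - α 4) hk hα hM hcont hsum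
        h2 e2 (by omega) (by omega) (by omega) (by omega) (by omega) (by omega) (by omega)
        (by omega) (by omega) (by omega)
    · exact nonempty_kkone2_of_thresholds (v := k - 1) (w := 2 * k + 1 - α 0 - α 4) hk hα hM
        hcont hsum h2 e2 (by omega) (by omega) (by omega) (by omega) (by omega) (by omega)
        (by omega) (by omega) (by omega) (by omega)
  have := LRTableau.finite (mu := kkone2 k) (nu := kkone3 k) hα fun m hm =>
    if_neg (by omega)
  have hpos : 0 < lrCoeff α (kkone2 k) (kkone3 k) := Nat.card_pos
  have := lrCoeff_kkone_le_two hk hα hcont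
  omega

end
end
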